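/- Let d ≥ 1, let s > 0 be real and let 1 < p < ∞. Define μ(ξ) := (4 ∑_{j=1}^d sin²(π ξ_j))^s / ( ∑_{j=1}^d (4 sin²(π ξ_j))^s ) for ξ ∈ 𝕋^d ∖ {0}, and μ(0) := 1; both μ and 1/μ are bounded on 𝕋^d. Then there is a constant C = C(d,s,p) such that for every f ∈ ℓ¹(ℤ^d) both functions n ↦ ∫_{𝕋^d} μ(ξ) 𝓕f(ξ) e^{−2π i n·ξ} dξ and n ↦ ∫_{𝕋^d} μ(ξ)^{−1} 𝓕f(ξ) e^{−2π i n·ξ} dξ have ℓ^p(ℤ^d) norm at most C ‖f‖_{ℓ^p(ℤ^d)}. -/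

import Mathlib

open MeasureTheory Real
open scoped ENNReal NNReal

/-- The torus `𝕋^d = [-1/2, 1/2]^d`. -/
noncomputable def Td (d : ℕ) : Set (Fin d → ℝ) :=
  Set.univ.pi fun _ => Set.Icc (-(1 : ℝ) / 2) (1 / 2)

/-- The Fourier transform of `f ∈ ℓ¹(ℤ^d)`. -/
noncomputable def Ftd (d : ℕ) (f : (Fin d → ℤ) → ℂ) (ξ : Fin d → ℝ) : ℂ :=
  ∑' n : Fin d → ℤ,
    f n * Complex.exp (2 * Real.pi * Complex.I * ∑ j, (n j : ℂ) * (ξ j : ℂ))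

/-- The `ℓ^p(ℤ^d)` norm, valued in `ℝ≥0∞`. -/
noncomputable def lpN (d : ℕ) (p : ℝ) (f : (Fin d → ℤ) → ℂ) : ℝ≥0∞ :=
  (∑' n : Fin d → ℤ, (‖f n‖₊ : ℝ≥0∞) ^ p) ^ (1 / p)

/-- The multiplier `μ(ξ) = (4 ∑_j sin²(π ξ_j))^s / ∑_j (4 sin²(π ξ_j))^s`, with `μ(0) = 1`,
comparing `(-Δ_{ℤ^d})^s` with the sum of `s`-th powers of the one-dimensional coordinate
discrete Laplacians. -/
noncomputable def muS (d : ℕ) (s : ℝ) (ξ : Fin d → ℝ) : ℝ :=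
  if ξ = 0 then 1
  else (4 * ∑ j, Real.sin (Real.pi * ξ j) ^ 2) ^ s /
    ∑ j, (4 * Real.sin (Real.pi * ξ j) ^ 2) ^ s

/-- The linear multiplier operator on `ℤ^d` with symbol `μ : 𝕋^d → ℝ`. -/
noncomputable def TmultZ (d : ℕ) (μ : (Fin d → ℝ) → ℝ) (f : (Fin d → ℤ) → ℂ)
    (n : Fin d → ℤ) : ℂ :=
  ∫ ξ in Td d,
    (μ ξ : ℂ) * Ftd d f ξ *
      Complex.exp (-(2 * Real.pi * Complex.I) * ∑ j, (n j : ℂ) * (ξ j : ℂ))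

/-- The dyadic interval of generation `j` with index `k`. -/
noncomputable def dyadicInterval (j : ℕ) (k : ℤ) : Finset ℤ := Finset.Ico (k * 2 ^ j) ((k + 1) * 2 ^ j)

lemma mem_dyadicInterval {j : ℕ} {k x : ℤ} : x ∈ dyadicInterval j k ↔ x / 2 ^ j = k := by
  have h2 : (0 : ℤ) < 2 ^ j := by positivity
  rw [dyadicInterval, Finset.mem_Ico, ← Int.le_ediv_iff_mul_le h2, ← Int.ediv_lt_iff_lt_mul h2]
  omega

lemma card_dyadicInterval (j : ℕ) (k : ℤ) : (dyadicInterval j k).card = 2 ^ j := by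
  rw [dyadicInterval, Int.card_Ico]
  have : (k + 1) * 2 ^ j - k * 2 ^ j = ((2 ^ j : ℕ) : ℤ) := by push_cast; ring
  rw [this, Int.toNat_natCast]

lemma dyadicInterval_subset_succ (j : ℕ) (k : ℤ) :
    dyadicInterval j k ⊆ dyadicInterval (j + 1) (k / 2 ^ 1) := by
  intro x hx
  rw [mem_dyadicInterval] at hx ⊢
  rw [← hx, pow_succ, Int.ediv_ediv_of_nonneg (by positivity)]
  simp

/-- Calderón–Zygmund stopping-time selection of dyadic intervals on `ℤ`. -/
lemma exists_dyadic_stopping (a : ℤ → ℝ) (ha : ∀ y, 0 ≤ a y) (S : Finset ℤ)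
    (hS : ∀ y, y ∉ S → a y = 0) (α : ℝ) (hα : 0 < α) :
    ∃ 𝒬 : Finset (ℕ × ℤ),
      (∀ P ∈ 𝒬, ∀ Q ∈ 𝒬, ∀ x, x ∈ dyadicInterval P.1 P.2 → x ∈ dyadicInterval Q.1 Q.2 → P = Q) ∧
      (∀ Q ∈ 𝒬, α * 2 ^ Q.1 < ∑ y ∈ dyadicInterval Q.1 Q.2, a y ∧
        ∑ y ∈ dyadicInterval Q.1 Q.2, a y ≤ 2 * α * 2 ^ Q.1) ∧
      ∀ x, (∀ Q ∈ 𝒬, x ∉ dyadicInterval Q.1 Q.2) → a x ≤ α := by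
  classical
  set bad : ℕ → ℤ → Prop := fun j k => α * 2 ^ j < ∑ y ∈ dyadicInterval j k, a y with hbad
  obtain ⟨J, hJ⟩ : ∃ J : ℕ, ∑ y ∈ S, a y ≤ α * 2 ^ J := by
    obtain ⟨J, hJ⟩ := pow_unbounded_of_one_lt ((∑ y ∈ S, a y) / α) (one_lt_two : (1 : ℝ) < 2)
    exact ⟨J, by rw [div_lt_iff₀ hα] at hJ; linarith⟩
  have hle : ∀ j k, ∑ y ∈ dyadicInterval j k, a y ≤ ∑ y ∈ S, a y := by
    intro j k
    calc ∑ y ∈ dyadicInterval j k, a y = ∑ y ∈ dyadicInterval j k ∩ S, a y := by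
          symm
          apply Finset.sum_subset Finset.inter_subset_left
          intro x hx hx'
          apply hS
          intro h
          exact hx' (Finset.mem_inter.2 ⟨hx, h⟩)
      _ ≤ _ := Finset.sum_le_sum_of_subset_of_nonneg Finset.inter_subset_right
          fun _ _ _ => ha _
  have hbJ : ∀ j k, bad j k → j < J := by
    intro j k h
    by_contra hj
    push Not at hj
    have h1 : (2 : ℝ) ^ J ≤ 2 ^ j := pow_le_pow_right₀ (by norm_num) hj
    have h2 := hle j k
    have h3 : α * 2 ^ J ≤ α * 2 ^ j := by gcongr
    simp only [hbad] at h
    linarith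
  have hbS : ∀ j k, bad j k → ∃ y ∈ S, k = y / 2 ^ j := by
    intro j k h
    by_contra hc
    push Not at hc
    have : ∑ y ∈ dyadicInterval j k, a y = 0 := by
      apply Finset.sum_eq_zero
      intro y hy
      apply hS
      intro hyS
      exact hc y hyS (mem_dyadicInterval.1 hy).symm
    simp only [hbad, this] at h
    have : 0 < α * 2 ^ j := by positivity
    linarith
  set 𝓑 : Finset (ℕ × ℤ) := ((Finset.range J ×ˢ S).image fun q => (q.1, q.2 / 2 ^ q.1)).filter
    fun q => bad q.1 q.2 with h𝓑
  have mem𝓑 : ∀ q : ℕ × ℤ, q ∈ 𝓑 ↔ bad q.1 q.2 := by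
    rintro ⟨j, k⟩
    simp only [h𝓑, Finset.mem_filter, Finset.mem_image, Finset.mem_product, Finset.mem_range,
      and_iff_right_iff_imp]
    intro h
    obtain ⟨y, hy, rfl⟩ := hbS j k h
    exact ⟨(j, y), ⟨hbJ _ _ h, hy⟩, rfl⟩
  refine ⟨𝓑.filter fun q => ∀ i : ℕ, 0 < i → ¬ bad (q.1 + i) (q.2 / 2 ^ i), ?_, ?_, ?_⟩
  · have key : ∀ j k j' k' x, (∀ i : ℕ, 0 < i → ¬ bad (j + i) (k / 2 ^ i)) → bad j' k' →
        x ∈ dyadicInterval j k → x ∈ dyadicInterval j' k' → j' ≤ j := by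
      intro j k j' k' x h h' hx hx'
      by_contra hlt
      push Not at hlt
      apply h (j' - j) (by omega)
      rw [mem_dyadicInterval] at hx hx'
      rw [← hx, Int.ediv_ediv_of_nonneg (by positivity), ← pow_add]
      rw [show j + (j' - j) = j' by omega, hx']
      exact h'
    rintro ⟨j, k⟩ hP ⟨j', k'⟩ hQ x hx hx'
    simp only [Finset.mem_filter, mem𝓑] at hP hQ
    have e : j = j' := le_antisymm (key j' k' j k x hQ.2 hP.1 hx' hx) (key j k j' k' x hP.2 hQ.1 hx hx')
    subst e
    simp only [mem_dyadicInterval] at hx hx'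
    rw [← hx, ← hx']
  · rintro ⟨j, k⟩ hQ
    simp only [Finset.mem_filter, mem𝓑] at hQ
    refine ⟨hQ.1, ?_⟩
    have h1 := hQ.2 1 one_pos
    simp only [hbad, not_lt] at h1
    calc ∑ y ∈ dyadicInterval j k, a y ≤ ∑ y ∈ dyadicInterval (j + 1) (k / 2 ^ 1), a y :=
          Finset.sum_le_sum_of_subset_of_nonneg (dyadicInterval_subset_succ j k) fun _ _ _ => ha _
      _ ≤ _ := h1
      _ = _ := by ring
  · intro x hx
    by_contra hlt
    push Not at hlt
    have h0 : bad 0 (x / 2 ^ 0) := by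
      simp only [hbad]
      have : dyadicInterval 0 (x / 2 ^ 0) = {x} := by
        ext y; rw [mem_dyadicInterval]; simp
      rw [this]; simpa using hlt
    have hne : ((Finset.range J).filter fun j => bad j (x / 2 ^ j)).Nonempty :=
      ⟨0, by simp only [Finset.mem_filter, Finset.mem_range]; exact ⟨hbJ _ _ h0, h0⟩⟩
    set m := Finset.max' _ hne with hm
    have hmem := Finset.max'_mem _ hne
    rw [← hm, Finset.mem_filter] at hmem
    refine hx (m, x / 2 ^ m) ?_ (mem_dyadicInterval.2 rfl)
    simp only [Finset.mem_filter, mem𝓑]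
    refine ⟨hmem.2, fun i hi hb => ?_⟩
    rw [Int.ediv_ediv_of_nonneg (by positivity), ← pow_add] at hb
    have : m + i ≤ m := Finset.le_max' _ _ (by
      simp only [Finset.mem_filter, Finset.mem_range]; exact ⟨hbJ _ _ hb, hb⟩)
    omega

/-- Convolution with `K` on `ℤ` is bounded on `ℓ^p` with constant `D`, tested on finite windows. -/
def ConvBound (K : ℤ → ℂ) (p D : ℝ) : Prop :=
  ∀ (R S : Finset ℤ) (f : ℤ → ℂ),
    ∑ x ∈ R, ‖∑ y ∈ S, K (x - y) * f y‖ ^ p ≤ D ^ p * ∑ y ∈ S, ‖f y‖ ^ p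

/-- The Calderón–Zygmund smoothness condition for kernels on `ℤ`. -/
def SmoothKernel (K : ℤ → ℂ) (A : ℝ) : Prop :=
  ∀ n : ℕ, 1 ≤ n → ‖K (n + 1) - K n‖ ≤ A / (n : ℝ) ^ 2 ∧
    ‖K (-(n : ℤ) - 1) - K (-(n : ℤ))‖ ≤ A / (n : ℝ) ^ 2

lemma SmoothKernel.neg {K : ℤ → ℂ} {A : ℝ} (h : SmoothKernel K A) :
    SmoothKernel (fun n => K (-n)) A := by
  intro n hn
  obtain ⟨h1, h2⟩ := h n hn
  refine ⟨?_, ?_⟩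
  · convert h2 using 4; ring
  · convert h1 using 4 <;> ring

/-- Increment over many steps, each of which is small. -/
lemma norm_sub_le_of_steps (G : ℕ → ℂ) (c : ℝ) (m h : ℕ)
    (hstep : ∀ i, m ≤ i → i < m + h → ‖G (i + 1) - G i‖ ≤ c) : ‖G (m + h) - G m‖ ≤ h * c := by
  induction h with
  | zero => simp
  | succ h ih =>
    have h1 := ih fun i h1 h2 => hstep i h1 (by omega)
    have h2 := hstep (m + h) (by omega) (by omega)
    calc ‖G (m + (h + 1)) - G m‖ = ‖(G (m + h + 1) - G (m + h)) + (G (m + h) - G m)‖ := by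
          rw [← add_assoc]; ring_nf
      _ ≤ c + h * c := (norm_add_le _ _).trans (add_le_add h2 h1)
      _ = _ := by push_cast; ring

lemma SmoothKernel.norm_sub_le {K : ℤ → ℂ} {A : ℝ} (hA : 0 ≤ A) (hK : SmoothKernel K A)
    (L : ℕ) (n h : ℤ) (hh0 : 0 ≤ h) (hhL : h < L) (hn : 2 * (L : ℤ) ≤ |n|) :
    ‖K (n - h) - K n‖ ≤ 4 * A * L / (n : ℝ) ^ 2 := by
  have hL : 0 < L := by omega
  obtain ⟨k, rfl⟩ := Int.eq_ofNat_of_zero_le hh0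
  have hkL : (k : ℝ) ≤ L := by exact_mod_cast (by omega : k ≤ L)
  rcases le_or_gt 0 n with hn0 | hn0
  · obtain ⟨m, rfl⟩ := Int.eq_ofNat_of_zero_le hn0
    rw [abs_of_nonneg hn0] at hn
    obtain ⟨l, rfl⟩ : ∃ l, m = l + k := ⟨m - k, by omega⟩
    have hl : (l : ℝ) + k ≤ 2 * l := by exact_mod_cast (by omega : l + k ≤ 2 * l)
    have hl1 : (1 : ℝ) ≤ l := by exact_mod_cast (by omega : 1 ≤ l)
    have := norm_sub_le_of_steps (fun i => K i) (4 * A / ((l : ℝ) + k) ^ 2) l k (by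
      intro i hi1 hi2
      have hi : (l : ℝ) ≤ i := by exact_mod_cast hi1
      have hi0 : (0 : ℝ) < i := by linarith
      have h1 := (hK i (by omega)).1
      refine le_trans (by simpa using h1) ?_
      rw [div_le_div_iff₀ (by positivity) (by positivity)]
      have : ((l : ℝ) + k) ^ 2 ≤ (2 * i) ^ 2 := by gcongr; linarith
      nlinarith)
    rw [norm_sub_rev] at this
    have e : ((l + k : ℕ) : ℤ) - (k : ℤ) = l := by push_cast; ring
    rw [e]
    refine this.trans ?_
    push_cast
    rw [mul_div_assoc', div_le_div_iff_of_pos_right (by positivity)]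
    nlinarith
  · obtain ⟨m, rfl⟩ : ∃ m : ℕ, n = -(m : ℤ) := ⟨n.natAbs, by omega⟩
    rw [abs_neg, Nat.abs_cast] at hn
    have hm1 : (1 : ℝ) ≤ m := by exact_mod_cast (by omega : 1 ≤ m)
    have := norm_sub_le_of_steps (fun i => K (-(i : ℤ))) (A / (m : ℝ) ^ 2) m k (by
      intro i hi1 hi2
      have hi : (m : ℝ) ≤ i := by exact_mod_cast hi1
      have h1 := (hK i (by omega)).2
      rw [show (-((i + 1 : ℕ) : ℤ)) = -(i : ℤ) - 1 by push_cast; ring]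
      refine h1.trans ?_
      gcongr)
    have e : -((m + k : ℕ) : ℤ) = -(m : ℤ) - k := by push_cast; ring
    simp only [e] at this
    refine this.trans ?_
    push_cast
    rw [neg_sq, mul_div_assoc', div_le_div_iff_of_pos_right (by positivity)]
    have : (k : ℝ) * A ≤ L * A := by gcongr
    nlinarith [mul_nonneg hA (Nat.cast_nonneg (α := ℝ) L)]

lemma sum_inv_sq_le (T : Finset ℕ) (M : ℕ) (hM : 1 ≤ M) (hT : ∀ n ∈ T, M ≤ n) :
    ∑ n ∈ T, 1 / (n : ℝ) ^ 2 ≤ 2 / (M : ℝ) := by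
  obtain ⟨N, hN⟩ := T.exists_nat_subset_range
  have := sum_Ioo_inv_sq_le (α := ℝ) (M - 1) N
  rw [Nat.cast_sub hM] at this
  simp only [Nat.cast_one, sub_add_cancel] at this
  refine le_trans ?_ this
  simp only [one_div]
  apply Finset.sum_le_sum_of_subset_of_nonneg
  · intro n hn
    have h1 := hT n hn
    have h2 := Finset.mem_range.1 (hN hn)
    rw [Finset.mem_Ioo]; omega
  · intros; positivity

lemma sum_int_inv_sq_le (R : Finset ℤ) (a : ℤ) (M : ℕ) (hM : 1 ≤ M)
    (hR : ∀ x ∈ R, (M : ℤ) ≤ |x - a|) :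
    ∑ x ∈ R, 1 / ((x - a : ℤ) : ℝ) ^ 2 ≤ 4 / (M : ℝ) := by
  classical
  have h1 : ∀ (R' : Finset ℤ), R' ⊆ R → Set.InjOn (fun x : ℤ => (x - a).natAbs) R' →
      ∑ x ∈ R', 1 / ((x - a : ℤ) : ℝ) ^ 2 ≤ 2 / (M : ℝ) := by
    intro R' hR' hinj
    have := sum_inv_sq_le (R'.image fun x => (x - a).natAbs) M hM (by
      intro n hn
      obtain ⟨x, hx, rfl⟩ := Finset.mem_image.1 hn
      have := hR x (hR' hx)
      rw [Int.abs_eq_natAbs] at this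
      exact_mod_cast this)
    rw [Finset.sum_image hinj] at this
    refine le_trans (le_of_eq ?_) this
    refine Finset.sum_congr rfl fun x _ => ?_
    rw [Nat.cast_natAbs, Int.cast_abs, sq_abs]
  rw [← Finset.sum_filter_add_sum_filter_not R (fun x => a ≤ x)]
  have e1 := h1 (R.filter fun x => a ≤ x) (Finset.filter_subset _ _) (by
    intro x hx y hy hxy
    simp only [Finset.coe_filter, Set.mem_ofPred_eq] at hx hy hxy
    omega)
  have e2 := h1 (R.filter fun x => ¬ a ≤ x) (Finset.filter_subset _ _) (by
    intro x hx y hy hxy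
    simp only [Finset.coe_filter, Set.mem_ofPred_eq] at hx hy hxy
    omega)
  calc _ ≤ 2 / (M : ℝ) + 2 / M := add_le_add e1 e2
    _ = _ := by ring

/-- Cancellation estimate away from the support of an atom. -/
lemma SmoothKernel.sum_atom_le {K : ℤ → ℂ} (hK : SmoothKernel K 1)
    (R : Finset ℤ) (j : ℕ) (k : ℤ) (b : ℤ → ℂ)
    (hb : ∑ y ∈ dyadicInterval j k, b y = 0)
    (hR : ∀ x ∈ R, 2 * 2 ^ j ≤ |x - k * 2 ^ j|) :
    ∑ x ∈ R, ‖∑ y ∈ dyadicInterval j k, K (x - y) * b y‖ ≤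
      8 * ∑ y ∈ dyadicInterval j k, ‖b y‖ := by
  set a := k * 2 ^ j with ha
  have h1 : ∀ x ∈ R, ‖∑ y ∈ dyadicInterval j k, K (x - y) * b y‖ ≤
      (4 * 2 ^ j * ∑ y ∈ dyadicInterval j k, ‖b y‖) * (1 / ((x - a : ℤ) : ℝ) ^ 2) := by
    intro x hx
    have e : ∑ y ∈ dyadicInterval j k, K (x - y) * b y
        = ∑ y ∈ dyadicInterval j k, (K (x - y) - K (x - a)) * b y := by
      simp only [sub_mul, Finset.sum_sub_distrib, ← Finset.mul_sum, hb]; simp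
    rw [e, Finset.mul_sum, Finset.sum_mul]
    refine (norm_sum_le _ _).trans (Finset.sum_le_sum fun y hy => ?_)
    rw [norm_mul]
    have hy' := hy
    rw [dyadicInterval, Finset.mem_Ico] at hy'
    have := hK.norm_sub_le zero_le_one (2 ^ j) (x - a) (y - a) (by rw [ha]; linarith)
      (by push_cast; rw [ha]; linarith [hy'.2]) (by push_cast; exact hR x hx)
    rw [show x - a - (y - a) = x - y by ring] at this
    calc _ ≤ (4 * 1 * ((2 ^ j : ℕ) : ℝ) / ((x - a : ℤ) : ℝ) ^ 2) * ‖b y‖ := by gcongr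
      _ = _ := by push_cast; ring
  refine (Finset.sum_le_sum h1).trans ?_
  rw [← Finset.mul_sum]
  have h2 := sum_int_inv_sq_le R a (2 * 2 ^ j) (by have := Nat.one_le_two_pow (n := j); omega)
    (by intro x hx; push_cast; exact hR x hx)
  calc _ ≤ (4 * 2 ^ j * ∑ y ∈ dyadicInterval j k, ‖b y‖) * (4 / ((2 * 2 ^ j : ℕ) : ℝ)) := by
        gcongr
    _ = _ := by
        have : (2 : ℝ) ^ j ≠ 0 := by positivity
        push_cast; field_simp; ring

lemma card_filter_lt_mul_le (R : Finset ℤ) (u : ℤ → ℝ) (hu : ∀ x ∈ R, 0 ≤ u x) (c : ℝ) :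
    c * ((R.filter fun x => c < u x).card : ℝ) ≤ ∑ x ∈ R, u x := by
  calc c * ((R.filter fun x => c < u x).card : ℝ) = ∑ x ∈ R.filter (fun x => c < u x), c := by
        rw [Finset.sum_const, nsmul_eq_mul, mul_comm]
    _ ≤ ∑ x ∈ R.filter (fun x => c < u x), u x :=
        Finset.sum_le_sum fun x hx => (Finset.mem_filter.1 hx).2.le
    _ ≤ _ := Finset.sum_le_sum_of_subset_of_nonneg (Finset.filter_subset _ _)
        fun x hx _ => hu x hx

lemma ConvBound.two {K : ℤ → ℂ} {A : ℝ} (h : ConvBound K 2 A) (R S : Finset ℤ) (f : ℤ → ℂ) :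
    ∑ x ∈ R, ‖∑ y ∈ S, K (x - y) * f y‖ ^ 2 ≤ A ^ 2 * ∑ y ∈ S, ‖f y‖ ^ 2 := by
  have := h R S f
  simpa only [Real.rpow_two] using this

/-- Calderón–Zygmund: weak type `(1,1)` bound on `ℤ`. -/
lemma weak_type_one_one {K : ℤ → ℂ} (h2 : ConvBound K 2 1) (hK : SmoothKernel K 1)
    (R S : Finset ℤ) (f : ℤ → ℂ) (α : ℝ) (hα : 0 < α) :
    α * ((R.filter fun x => α < ‖∑ y ∈ S, K (x - y) * f y‖).card : ℝ) ≤
      60 * ∑ y ∈ S, ‖f y‖ := by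
  classical
  set F : ℤ → ℂ := fun y => if y ∈ S then f y else 0 with hF
  set N := ∑ y ∈ S, ‖f y‖ with hN
  obtain ⟨𝒬, hdisj, hQ, hout⟩ := exists_dyadic_stopping (fun y => ‖F y‖) (fun _ => norm_nonneg _) S
    (by intro y hy; simp [hF, hy]) α hα
  set avg : ℕ × ℤ → ℂ := fun Q => (∑ y ∈ dyadicInterval Q.1 Q.2, F y) / 2 ^ Q.1 with havg
  set b : ℕ × ℤ → ℤ → ℂ := fun Q y =>
    if y ∈ dyadicInterval Q.1 Q.2 then F y - avg Q else 0 with hb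
  set U := 𝒬.biUnion fun Q => dyadicInterval Q.1 Q.2 with hU
  set S' := S ∪ U with hS'
  set g : ℤ → ℂ := fun y => F y - ∑ Q ∈ 𝒬, b Q y with hg
  have hdisj' : Set.PairwiseDisjoint (𝒬 : Set (ℕ × ℤ)) fun Q => dyadicInterval Q.1 Q.2 := by
    intro P hP Q hQ' hne
    rw [Function.onFun, Finset.disjoint_left]
    intro x hx hx'
    exact hne (hdisj P hP Q hQ' x hx hx')
  have hFS' : ∑ y ∈ S', ‖F y‖ = N := by
    rw [hN, ← Finset.sum_subset (Finset.subset_union_left : S ⊆ S ∪ U)]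
    · exact Finset.sum_congr rfl fun y hy => by simp [hF, hy]
    · intro x _ hx; simp [hF, hx]
  have hQsum : ∑ Q ∈ 𝒬, ∑ y ∈ dyadicInterval Q.1 Q.2, ‖F y‖ ≤ N := by
    rw [← Finset.sum_biUnion hdisj', ← hFS']
    exact Finset.sum_le_sum_of_subset_of_nonneg Finset.subset_union_right
      fun _ _ _ => norm_nonneg _
  have hDS' : ∀ Q ∈ 𝒬, dyadicInterval Q.1 Q.2 ⊆ S' := fun Q hQ' x hx =>
    Finset.mem_union_right _ (Finset.mem_biUnion.2 ⟨Q, hQ', hx⟩)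
  have havg_le : ∀ Q, ‖avg Q‖ * 2 ^ Q.1 ≤ ∑ y ∈ dyadicInterval Q.1 Q.2, ‖F y‖ := by
    intro Q
    rw [havg, norm_div, norm_pow, Complex.norm_ofNat, div_mul_cancel₀ _ (by positivity)]
    exact norm_sum_le _ _
  have hbnorm : ∀ Q, ∑ y ∈ dyadicInterval Q.1 Q.2, ‖b Q y‖ ≤
      2 * ∑ y ∈ dyadicInterval Q.1 Q.2, ‖F y‖ := by
    intro Q
    calc ∑ y ∈ dyadicInterval Q.1 Q.2, ‖b Q y‖
        ≤ ∑ y ∈ dyadicInterval Q.1 Q.2, (‖F y‖ + ‖avg Q‖) :=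
          Finset.sum_le_sum fun y hy => by simp only [hb, hy, if_true]; exact norm_sub_le _ _
      _ = ∑ y ∈ dyadicInterval Q.1 Q.2, ‖F y‖ + ‖avg Q‖ * 2 ^ Q.1 := by
          rw [Finset.sum_add_distrib, Finset.sum_const, card_dyadicInterval, nsmul_eq_mul]
          push_cast; ring
      _ ≤ _ := by have := havg_le Q; linarith
  have hbzero : ∀ Q, ∑ y ∈ dyadicInterval Q.1 Q.2, b Q y = 0 := by
    intro Q
    rw [Finset.sum_congr rfl (g := fun y => F y - avg Q) fun y hy => by simp only [hb, hy, if_true],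
      Finset.sum_sub_distrib, Finset.sum_const, card_dyadicInterval, nsmul_eq_mul]
    simp only [havg]; push_cast
    rw [mul_div_cancel₀ _ (by simp), sub_self]
  have hg_le : ∀ y, ‖g y‖ ≤ 2 * α := by
    intro y
    by_cases h : ∃ Q ∈ 𝒬, y ∈ dyadicInterval Q.1 Q.2
    · obtain ⟨Q, hQ', hy⟩ := h
      have e : g y = avg Q := by
        simp only [hg]
        rw [Finset.sum_eq_single Q]
        · simp only [hb, hy, if_true]; ring
        · intro P hP hne
          simp only [hb]
          rw [if_neg]
          exact fun hy' => hne (hdisj P hP Q hQ' y hy' hy)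
        · exact fun h => absurd hQ' h
      rw [e]
      have h1 := (havg_le Q).trans (hQ Q hQ').2
      exact le_of_mul_le_mul_right h1 (by positivity)
    · push Not at h
      have e : g y = F y := by
        simp only [hg]
        rw [Finset.sum_eq_zero, sub_zero]
        intro Q hQ'
        simp only [hb, h Q hQ', if_false]
      rw [e]
      have := hout y h
      linarith
  have hbS' : ∀ Q ∈ 𝒬, ∀ c : ℤ → ℂ, ∑ y ∈ S', c y * b Q y =
      ∑ y ∈ dyadicInterval Q.1 Q.2, c y * b Q y := by
    intro Q hQ' c
    symm
    apply Finset.sum_subset (hDS' Q hQ')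
    intro y _ hy
    simp only [hb, hy, if_false, mul_zero]
  have hbS'n : ∀ Q ∈ 𝒬, ∑ y ∈ S', ‖b Q y‖ = ∑ y ∈ dyadicInterval Q.1 Q.2, ‖b Q y‖ := by
    intro Q hQ'
    symm
    apply Finset.sum_subset (hDS' Q hQ')
    intro y _ hy
    simp only [hb, hy, if_false, norm_zero]
  have hg1 : ∑ y ∈ S', ‖g y‖ ≤ 3 * N := by
    calc ∑ y ∈ S', ‖g y‖ ≤ ∑ y ∈ S', (‖F y‖ + ∑ Q ∈ 𝒬, ‖b Q y‖) :=
          Finset.sum_le_sum fun y _ => (norm_sub_le _ _).trans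
            (by gcongr; exact norm_sum_le _ _)
      _ = N + ∑ Q ∈ 𝒬, ∑ y ∈ dyadicInterval Q.1 Q.2, ‖b Q y‖ := by
          rw [Finset.sum_add_distrib, hFS', Finset.sum_comm, Finset.sum_congr rfl hbS'n]
      _ ≤ N + ∑ Q ∈ 𝒬, 2 * ∑ y ∈ dyadicInterval Q.1 Q.2, ‖F y‖ := by
          gcongr with Q hQ'; exact hbnorm Q
      _ ≤ _ := by rw [← Finset.mul_sum]; linarith
  have hg2 : ∑ y ∈ S', ‖g y‖ ^ 2 ≤ 6 * α * N := by
    calc ∑ y ∈ S', ‖g y‖ ^ 2 ≤ ∑ y ∈ S', 2 * α * ‖g y‖ := Finset.sum_le_sum fun y _ => by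
          rw [pow_two]; exact mul_le_mul_of_nonneg_right (hg_le y) (norm_nonneg _)
      _ = 2 * α * ∑ y ∈ S', ‖g y‖ := by rw [Finset.mul_sum]
      _ ≤ 2 * α * (3 * N) := by gcongr
      _ = _ := by ring
  have hdecomp : ∀ x, ∑ y ∈ S, K (x - y) * f y = ∑ y ∈ S', K (x - y) * g y +
      ∑ Q ∈ 𝒬, ∑ y ∈ dyadicInterval Q.1 Q.2, K (x - y) * b Q y := by
    intro x
    have e1 : ∑ y ∈ S, K (x - y) * f y = ∑ y ∈ S', K (x - y) * F y := by
      rw [← Finset.sum_subset (Finset.subset_union_left : S ⊆ S ∪ U)]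
      · exact Finset.sum_congr rfl fun y hy => by simp [hF, hy]
      · intro y _ hy; simp [hF, hy]
    have e2 : ∑ y ∈ S', ∑ Q ∈ 𝒬, K (x - y) * b Q y
        = ∑ Q ∈ 𝒬, ∑ y ∈ dyadicInterval Q.1 Q.2, K (x - y) * b Q y := by
      rw [Finset.sum_comm]
      exact Finset.sum_congr rfl fun Q hQ' => hbS' Q hQ' _
    rw [e1, ← e2, ← Finset.sum_add_distrib]
    refine Finset.sum_congr rfl fun y _ => ?_
    rw [← Finset.mul_sum, ← mul_add]
    simp only [hg, sub_add_cancel]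
  set star : ℕ × ℤ → Finset ℤ := fun Q =>
    Finset.Ioo (Q.2 * 2 ^ Q.1 - 2 * 2 ^ Q.1) (Q.2 * 2 ^ Q.1 + 2 * 2 ^ Q.1) with hstar
  set E := 𝒬.biUnion star with hE
  have hEcard : α * (E.card : ℝ) ≤ 4 * N := by
    have h1 : ∀ Q, ((star Q).card : ℝ) ≤ 4 * 2 ^ Q.1 := by
      intro Q
      have : (star Q).card ≤ 4 * 2 ^ Q.1 := by
        simp only [hstar]
        rw [Int.card_Ioo, Int.toNat_le]
        push_cast
        linarith
      exact_mod_cast this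
    calc α * (E.card : ℝ) ≤ α * ∑ Q ∈ 𝒬, ((star Q).card : ℝ) := by
          gcongr; exact_mod_cast Finset.card_biUnion_le
      _ ≤ α * ∑ Q ∈ 𝒬, 4 * 2 ^ Q.1 := by gcongr with Q; exact h1 Q
      _ = 4 * ∑ Q ∈ 𝒬, α * 2 ^ Q.1 := by
          simp only [Finset.mul_sum]; exact Finset.sum_congr rfl fun _ _ => by ring
      _ ≤ 4 * ∑ Q ∈ 𝒬, ∑ y ∈ dyadicInterval Q.1 Q.2, ‖F y‖ := by
          gcongr with Q hQ'; exact (hQ Q hQ').1.le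
      _ ≤ _ := by gcongr
  set B : ℤ → ℝ := fun x => ‖∑ Q ∈ 𝒬, ∑ y ∈ dyadicInterval Q.1 Q.2, K (x - y) * b Q y‖ with hB
  have hBsum : ∑ x ∈ R \ E, B x ≤ 16 * N := by
    calc ∑ x ∈ R \ E, B x
        ≤ ∑ x ∈ R \ E, ∑ Q ∈ 𝒬, ‖∑ y ∈ dyadicInterval Q.1 Q.2, K (x - y) * b Q y‖ :=
          Finset.sum_le_sum fun x _ => norm_sum_le _ _
      _ = ∑ Q ∈ 𝒬, ∑ x ∈ R \ E, ‖∑ y ∈ dyadicInterval Q.1 Q.2, K (x - y) * b Q y‖ :=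
          Finset.sum_comm
      _ ≤ ∑ Q ∈ 𝒬, 8 * ∑ y ∈ dyadicInterval Q.1 Q.2, ‖b Q y‖ := by
          refine Finset.sum_le_sum fun Q hQ' => hK.sum_atom_le _ _ _ _ (hbzero Q) ?_
          intro x hx
          have hx2 := (Finset.mem_sdiff.1 hx).2
          by_contra hlt
          push Not at hlt
          rw [abs_lt] at hlt
          apply hx2
          rw [hE, Finset.mem_biUnion]
          refine ⟨Q, hQ', ?_⟩
          simp only [hstar, Finset.mem_Ioo]
          constructor <;> linarith [hlt.1, hlt.2]
      _ ≤ ∑ Q ∈ 𝒬, 8 * (2 * ∑ y ∈ dyadicInterval Q.1 Q.2, ‖F y‖) := by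
          gcongr with Q hQ'; exact hbnorm Q
      _ = 16 * ∑ Q ∈ 𝒬, ∑ y ∈ dyadicInterval Q.1 Q.2, ‖F y‖ := by
          simp only [Finset.mul_sum]
          exact Finset.sum_congr rfl fun _ _ => Finset.sum_congr rfl fun _ _ => by ring
      _ ≤ _ := by gcongr
  set G : ℤ → ℝ := fun x => ‖∑ y ∈ S', K (x - y) * g y‖ with hG
  have hsub : (R.filter fun x => α < ‖∑ y ∈ S, K (x - y) * f y‖) ⊆
      (R.filter fun x => (α / 2) ^ 2 < G x ^ 2) ∪ (E ∪ ((R \ E).filter fun x => α / 2 < B x)) := by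
    intro x hx
    rw [Finset.mem_filter] at hx
    simp only [Finset.mem_union, Finset.mem_filter, Finset.mem_sdiff]
    by_contra hc
    push Not at hc
    obtain ⟨h1, h2, h3⟩ := hc
    have h1' := h1 hx.1
    have h3' := h3 ⟨hx.1, h2⟩
    have h1'' : G x ≤ α / 2 := (pow_le_pow_iff_left₀ (norm_nonneg _) (by positivity) two_ne_zero).1 h1'
    have := hx.2
    rw [hdecomp x] at this
    have h4 := norm_add_le (∑ y ∈ S', K (x - y) * g y)
      (∑ Q ∈ 𝒬, ∑ y ∈ dyadicInterval Q.1 Q.2, K (x - y) * b Q y)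
    simp only [hG, hB] at h1'' h3'
    linarith
  have hcard := (Finset.card_le_card hsub).trans (Finset.card_union_le _ _)
  have hcard2 := Finset.card_union_le E ((R \ E).filter fun x => α / 2 < B x)
  have hcard3 : ((R.filter fun x => α < ‖∑ y ∈ S, K (x - y) * f y‖).card : ℝ) ≤
      ((R.filter fun x => (α / 2) ^ 2 < G x ^ 2).card : ℝ) +
      ((E.card : ℝ) + (((R \ E).filter fun x => α / 2 < B x).card : ℝ)) := by
    exact_mod_cast hcard.trans (Nat.add_le_add_left hcard2 _)
  have c1 := card_filter_lt_mul_le R (fun x => G x ^ 2) (fun _ _ => by positivity) ((α / 2) ^ 2)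
  have hT2 := h2.two R S' g
  rw [one_pow, one_mul] at hT2
  have c1' := c1.trans (hT2.trans hg2)
  have c1'' : α * ((R.filter fun x => (α / 2) ^ 2 < G x ^ 2).card : ℝ) ≤ 24 * N := by
    have : α * (α * ((R.filter fun x => (α / 2) ^ 2 < G x ^ 2).card : ℝ)) ≤ α * (24 * N) := by
      nlinarith
    exact le_of_mul_le_mul_left this hα
  have c3 := (card_filter_lt_mul_le (R \ E) B (fun _ _ => norm_nonneg _) (α / 2)).trans hBsum
  nlinarith

lemma lintegral_rpow_indicator_Iio (r t : ℝ) (hr : -1 < r) (ht : 0 ≤ t) :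
    ∫⁻ α in Set.Ioi (0 : ℝ), (Set.Iio t).indicator (fun α => ENNReal.ofReal (α ^ r)) α =
      ENNReal.ofReal (t ^ (r + 1) / (r + 1)) := by
  rw [lintegral_indicator measurableSet_Iio, Measure.restrict_restrict measurableSet_Iio,
    Set.inter_comm, Set.Ioi_inter_Iio, ← ofReal_integral_eq_lintegral_ofReal]
  · rw [← integral_Ioc_eq_integral_Ioo, ← intervalIntegral.integral_of_le ht,
      integral_rpow (Or.inl hr), Real.zero_rpow (by linarith), sub_zero]
  · exact ((intervalIntegrable_iff_integrableOn_Ioo_of_le ht).1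
      (intervalIntegral.intervalIntegrable_rpow' hr))
  · filter_upwards [ae_restrict_mem measurableSet_Ioo] with x hx
    exact Real.rpow_nonneg hx.1.le _

lemma lintegral_rpow_indicator_Ici (r t : ℝ) (hr : r < -1) (ht : 0 < t) :
    ∫⁻ α in Set.Ioi (0 : ℝ), (Set.Ici t).indicator (fun α => ENNReal.ofReal (α ^ r)) α =
      ENNReal.ofReal (-t ^ (r + 1) / (r + 1)) := by
  have : Set.Ici t ∩ Set.Ioi 0 = Set.Ici t := by
    ext x; simp only [Set.mem_inter_iff, Set.mem_Ici, Set.mem_Ioi]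
    exact ⟨fun h => h.1, fun h => ⟨h, by linarith⟩⟩
  rw [lintegral_indicator measurableSet_Ici, Measure.restrict_restrict measurableSet_Ici,
    this, ← restrict_Ioi_eq_restrict_Ici, ← ofReal_integral_eq_lintegral_ofReal]
  · rw [integral_Ioi_rpow_of_lt hr ht]
  · exact integrableOn_Ioi_rpow_of_lt hr ht
  · filter_upwards [ae_restrict_mem measurableSet_Ioi] with x hx
    exact Real.rpow_nonneg (ht.trans hx).le _

/-- Splitting a function at height `α` between the weak type `(1,1)` and the `ℓ²` bounds. -/
lemma card_level_le {K : ℤ → ℂ} (h2 : ConvBound K 2 1) (hK : SmoothKernel K 1)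
    (R S : Finset ℤ) (f : ℤ → ℂ) (α : ℝ) (hα : 0 < α) :
    ((R.filter fun x => α < ‖∑ y ∈ S, K (x - y) * f y‖).card : ℝ) ≤
      ∑ y ∈ S, ((Set.Iio ‖f y‖).indicator (fun α => 120 * ‖f y‖ * α ^ (-1 : ℝ)) α +
        (Set.Ici ‖f y‖).indicator (fun α => 4 * ‖f y‖ ^ 2 * α ^ (-2 : ℝ)) α) := by
  classical
  set f1 : ℤ → ℂ := fun y => if α < ‖f y‖ then f y else 0 with hf1
  set f2 : ℤ → ℂ := fun y => if α < ‖f y‖ then 0 else f y with hf2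
  have hsplit : ∀ x, ∑ y ∈ S, K (x - y) * f y =
      ∑ y ∈ S, K (x - y) * f1 y + ∑ y ∈ S, K (x - y) * f2 y := by
    intro x
    rw [← Finset.sum_add_distrib]
    refine Finset.sum_congr rfl fun y _ => ?_
    simp only [hf1, hf2]; split_ifs <;> simp
  have hsub : (R.filter fun x => α < ‖∑ y ∈ S, K (x - y) * f y‖) ⊆
      (R.filter fun x => α / 2 < ‖∑ y ∈ S, K (x - y) * f1 y‖) ∪
      (R.filter fun x => (α / 2) ^ 2 < ‖∑ y ∈ S, K (x - y) * f2 y‖ ^ 2) := by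
    intro x hx
    rw [Finset.mem_filter] at hx
    simp only [Finset.mem_union, Finset.mem_filter]
    by_contra hc
    push Not at hc
    have h1 := hc.1 hx.1
    have h2 := (pow_le_pow_iff_left₀ (norm_nonneg _) (by positivity) two_ne_zero).1 (hc.2 hx.1)
    have := hx.2
    rw [hsplit x] at this
    have h4 := norm_add_le (∑ y ∈ S, K (x - y) * f1 y) (∑ y ∈ S, K (x - y) * f2 y)
    linarith
  have hcard := (Finset.card_le_card hsub).trans (Finset.card_union_le _ _)
  have hcard' : ((R.filter fun x => α < ‖∑ y ∈ S, K (x - y) * f y‖).card : ℝ) ≤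
      ((R.filter fun x => α / 2 < ‖∑ y ∈ S, K (x - y) * f1 y‖).card : ℝ) +
      ((R.filter fun x => (α / 2) ^ 2 < ‖∑ y ∈ S, K (x - y) * f2 y‖ ^ 2).card : ℝ) := by
    exact_mod_cast hcard
  have c1 := weak_type_one_one h2 hK R S f1 (α / 2) (by positivity)
  have hT2 := h2.two R S f2
  rw [one_pow, one_mul] at hT2
  have c2 := (card_filter_lt_mul_le R (fun x => ‖∑ y ∈ S, K (x - y) * f2 y‖ ^ 2)
    (fun _ _ => by positivity) ((α / 2) ^ 2)).trans hT2
  refine hcard'.trans ?_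
  rw [Finset.sum_add_distrib]
  have e1 : ∑ y ∈ S, (Set.Iio ‖f y‖).indicator (fun α => 120 * ‖f y‖ * α ^ (-1 : ℝ)) α =
      (120 / α) * ∑ y ∈ S, ‖f1 y‖ := by
    rw [Finset.mul_sum]
    refine Finset.sum_congr rfl fun y _ => ?_
    simp only [Set.indicator_apply, Set.mem_Iio, hf1]
    split_ifs
    · rw [Real.rpow_neg_one]; ring
    · simp
  have e2 : ∑ y ∈ S, (Set.Ici ‖f y‖).indicator (fun α => 4 * ‖f y‖ ^ 2 * α ^ (-2 : ℝ)) α =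
      (4 / α ^ 2) * ∑ y ∈ S, ‖f2 y‖ ^ 2 := by
    rw [Finset.mul_sum]
    refine Finset.sum_congr rfl fun y _ => ?_
    simp only [Set.indicator_apply, Set.mem_Ici, hf2]
    by_cases h : α < ‖f y‖
    · rw [if_neg (not_le.2 h), if_pos h]; simp
    · rw [if_pos (not_lt.1 h), if_neg h, Real.rpow_neg hα.le, Real.rpow_two]; ring
  rw [e1, e2]
  apply add_le_add
  · rw [div_mul_eq_mul_div, le_div_iff₀ hα]; linarith
  · rw [div_mul_eq_mul_div, le_div_iff₀ (by positivity)]; linarith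

/-- Marcinkiewicz interpolation between weak type `(1,1)` and `ℓ²`. -/
lemma convBound_of_lt_two {K : ℤ → ℂ} (h2 : ConvBound K 2 1) (hK : SmoothKernel K 1)
    (p : ℝ) (hp : 1 < p) (hp2 : p < 2) :
    ConvBound K p ((120 * p / (p - 1) + 4 * p / (2 - p)) ^ (1 / p)) := by
  classical
  intro R S f
  have hp1 : 0 < p - 1 := by linarith
  have hp2' : 0 < 2 - p := by linarith
  have hp0 : 0 < p := by linarith
  rw [← Real.rpow_mul (by positivity), one_div_mul_cancel hp0.ne', Real.rpow_one]
  set T : ℤ → ℝ := fun x => ‖∑ y ∈ S, K (x - y) * f y‖ with hT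
  rw [← ENNReal.ofReal_le_ofReal_iff (by positivity)]
  have hlhs : ENNReal.ofReal (∑ x ∈ R, T x ^ p) =
      ∫⁻ α in Set.Ioi (0 : ℝ), ∑ x ∈ R, ENNReal.ofReal p *
        (Set.Iio (T x)).indicator (fun α => ENNReal.ofReal (α ^ (p - 1))) α := by
    rw [ENNReal.ofReal_sum_of_nonneg (fun _ _ => by positivity), lintegral_finsetSum]
    · refine Finset.sum_congr rfl fun x _ => ?_
      rw [lintegral_const_mul _ (by fun_prop (disch := measurability)),
        lintegral_rpow_indicator_Iio _ _ (by linarith) (norm_nonneg _),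
        ← ENNReal.ofReal_mul hp0.le, sub_add_cancel, mul_div_cancel₀ _ hp0.ne']
    · intro x _
      exact Measurable.const_mul (Measurable.indicator (by fun_prop) measurableSet_Iio) _
  rw [hlhs]
  calc _ ≤ ∫⁻ α in Set.Ioi (0 : ℝ), ∑ y ∈ S,
        (ENNReal.ofReal (120 * p * ‖f y‖) *
          (Set.Iio ‖f y‖).indicator (fun α => ENNReal.ofReal (α ^ (p - 2))) α +
        ENNReal.ofReal (4 * p * ‖f y‖ ^ 2) *
          (Set.Ici ‖f y‖).indicator (fun α => ENNReal.ofReal (α ^ (p - 3))) α) := by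
        refine setLIntegral_mono' measurableSet_Ioi fun α hα => ?_
        have hα : 0 < α := hα
        have h := card_level_le h2 hK R S f α hα
        have e : ∑ x ∈ R, ENNReal.ofReal p *
            (Set.Iio (T x)).indicator (fun α => ENNReal.ofReal (α ^ (p - 1))) α =
            ENNReal.ofReal (p * α ^ (p - 1) * ((R.filter fun x => α < T x).card : ℝ)) := by
          simp only [Set.indicator_apply, Set.mem_Iio]
          rw [← Finset.mul_sum, ← Finset.sum_filter, Finset.sum_const, nsmul_eq_mul,
            ENNReal.ofReal_mul (by positivity), ENNReal.ofReal_mul hp0.le, ENNReal.ofReal_natCast]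
          ring
        rw [e]
        refine (ENNReal.ofReal_le_ofReal (mul_le_mul_of_nonneg_left h (by positivity))).trans ?_
        rw [Finset.mul_sum, ENNReal.ofReal_sum_of_nonneg]
        · refine Finset.sum_le_sum fun y _ => ?_
          rw [mul_add]
          refine ENNReal.ofReal_add_le.trans (add_le_add (le_of_eq ?_) (le_of_eq ?_))
          · simp only [Set.indicator_apply]
            split_ifs
            · rw [← ENNReal.ofReal_mul (by positivity),
                show p - 2 = (p - 1) + (-1) by ring, Real.rpow_add hα]
              congr 1; ring
            · simp
          · simp only [Set.indicator_apply]
            split_ifs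
            · rw [← ENNReal.ofReal_mul (by positivity),
                show p - 3 = (p - 1) + (-2) by ring, Real.rpow_add hα]
              congr 1; ring
            · simp
        · intro y _
          simp only [Set.indicator_apply]
          split_ifs <;> positivity
    _ = ∑ y ∈ S, (ENNReal.ofReal (120 * p * ‖f y‖) *
          ENNReal.ofReal (‖f y‖ ^ (p - 2 + 1) / (p - 2 + 1)) +
        ENNReal.ofReal (4 * p * ‖f y‖ ^ 2) *
          ∫⁻ α in Set.Ioi (0 : ℝ),
            (Set.Ici ‖f y‖).indicator (fun α => ENNReal.ofReal (α ^ (p - 3))) α) := by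
        rw [lintegral_finsetSum]
        · refine Finset.sum_congr rfl fun y _ => ?_
          rw [lintegral_add_left, lintegral_const_mul, lintegral_const_mul,
            lintegral_rpow_indicator_Iio _ _ (by linarith) (norm_nonneg _)]
          · exact Measurable.indicator (by fun_prop) measurableSet_Ici
          · exact Measurable.indicator (by fun_prop) measurableSet_Iio
          · exact Measurable.const_mul (Measurable.indicator (by fun_prop) measurableSet_Iio) _
        · intro y _
          exact (Measurable.const_mul (Measurable.indicator (by fun_prop) measurableSet_Iio) _).add
            (Measurable.const_mul (Measurable.indicator (by fun_prop) measurableSet_Ici) _)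
    _ ≤ ∑ y ∈ S, ENNReal.ofReal ((120 * p / (p - 1) + 4 * p / (2 - p)) * ‖f y‖ ^ p) := by
        refine Finset.sum_le_sum fun y _ => ?_
        rcases (norm_nonneg (f y)).eq_or_lt with h0 | h0
        · rw [← h0]; simp
        rw [lintegral_rpow_indicator_Ici _ _ (by linarith) h0,
          ← ENNReal.ofReal_mul (by positivity), ← ENNReal.ofReal_mul (by positivity),
          ← ENNReal.ofReal_add]
        · apply le_of_eq
          congr 1
          have e1 : ‖f y‖ ^ (p - 2 + 1) = ‖f y‖ ^ p / ‖f y‖ := by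
            rw [show p - 2 + 1 = p - 1 by ring, Real.rpow_sub_one h0.ne']
          have e2 : ‖f y‖ ^ (p - 3 + 1) = ‖f y‖ ^ p / ‖f y‖ ^ 2 := by
            rw [show p - 3 + 1 = p - 2 by ring, Real.rpow_sub h0, Real.rpow_two]
          rw [e1, e2, show p - 2 + 1 = p - 1 by ring, show p - 3 + 1 = -(2 - p) by ring]
          field_simp
        · rw [show p - 2 + 1 = p - 1 by ring]; positivity
        · rw [show p - 3 + 1 = -(2 - p) by ring, neg_div_neg_eq]; positivity
    _ = _ := by
        rw [← ENNReal.ofReal_sum_of_nonneg (fun _ _ => by positivity), ← Finset.mul_sum]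

lemma ConvBound.const_mul {K : ℤ → ℂ} {p D : ℝ} (hD : 0 ≤ D) (h : ConvBound K p D)
    (c : ℝ) (hc : 0 ≤ c) : ConvBound (fun n => (c : ℂ) * K n) p (c * D) := by
  intro R S f
  have h1 := h R S f
  have e : ∀ x, ‖∑ y ∈ S, (c : ℂ) * K (x - y) * f y‖ ^ p =
      c ^ p * ‖∑ y ∈ S, K (x - y) * f y‖ ^ p := by
    intro x
    simp only [mul_assoc, ← Finset.mul_sum]
    rw [norm_mul, Complex.norm_real, Real.norm_of_nonneg hc, Real.mul_rpow hc (norm_nonneg _)]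
  simp only [e]
  rw [← Finset.mul_sum, Real.mul_rpow hc hD, mul_assoc]
  gcongr

/-- Duality: convolution with the reflected kernel is bounded on the dual space. -/
lemma ConvBound.dual {K : ℤ → ℂ} {p q D : ℝ} (hpq : p.HolderConjugate q) (hD : 0 ≤ D)
    (h : ConvBound K q D) : ConvBound (fun n => K (-n)) p D := by
  intro R S f
  have hp := hpq.pos
  have hq := hpq.symm.pos
  simp only [neg_sub]
  set H : ℤ → ℂ := fun x => ∑ y ∈ S, K (y - x) * f y with hH
  set g : ℤ → ℂ := fun x => (starRingEnd ℂ) (H x) * ((‖H x‖ ^ (p - 2) : ℝ) : ℂ) with hg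
  have hHg : ∀ x, H x * g x = ((‖H x‖ ^ p : ℝ) : ℂ) := by
    intro x
    simp only [hg]
    rcases eq_or_ne (H x) 0 with h0 | h0
    · simp [h0, Real.zero_rpow hp.ne']
    · have h0' : 0 < ‖H x‖ := norm_pos_iff.2 h0
      rw [← mul_assoc, Complex.mul_conj, Complex.normSq_eq_norm_sq, ← Complex.ofReal_mul,
        ← Real.rpow_two, ← Real.rpow_add h0']
      congr 2; ring
  have hgq : ∀ x, ‖g x‖ ^ q = ‖H x‖ ^ p := by
    intro x
    simp only [hg]
    rcases eq_or_ne (H x) 0 with h0 | h0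
    · simp [h0, Real.zero_rpow hp.ne', Real.zero_rpow hq.ne']
    · have h0' : 0 < ‖H x‖ := norm_pos_iff.2 h0
      rw [norm_mul, RCLike.norm_conj, Complex.norm_real, Real.norm_of_nonneg (by positivity)]
      nth_rewrite 1 [← Real.rpow_one ‖H x‖]
      rw [← Real.rpow_add h0', ← Real.rpow_mul h0'.le]
      congr 1
      have := hpq.sub_one_mul_conj
      linarith
  set X := ∑ x ∈ R, ‖H x‖ ^ p with hX
  set F := ∑ y ∈ S, ‖f y‖ ^ p with hF
  have hX0 : 0 ≤ X := Finset.sum_nonneg fun _ _ => by positivity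
  have hF0 : 0 ≤ F := Finset.sum_nonneg fun _ _ => by positivity
  have e1 : (X : ℂ) = ∑ y ∈ S, f y * ∑ x ∈ R, K (y - x) * g x := by
    rw [hX]; push_cast
    simp only [Finset.mul_sum]
    rw [Finset.sum_comm]
    refine Finset.sum_congr rfl fun x _ => ?_
    rw [← hHg x]
    simp only [hH]
    rw [Finset.sum_mul]
    exact Finset.sum_congr rfl fun y _ => by ring
  have e2 : X ≤ F ^ (1 / p) * (D * X ^ (1 / q)) := by
    calc X = ‖(X : ℂ)‖ := by rw [Complex.norm_real, Real.norm_of_nonneg hX0]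
      _ ≤ ∑ y ∈ S, ‖f y‖ * ‖∑ x ∈ R, K (y - x) * g x‖ := by
          rw [e1]
          exact (norm_sum_le _ _).trans (Finset.sum_le_sum fun _ _ => (norm_mul _ _).le)
      _ ≤ F ^ (1 / p) * (∑ y ∈ S, ‖∑ x ∈ R, K (y - x) * g x‖ ^ q) ^ (1 / q) :=
          Real.inner_le_Lp_mul_Lq_of_nonneg S hpq (fun _ _ => norm_nonneg _)
            (fun _ _ => norm_nonneg _)
      _ ≤ F ^ (1 / p) * (D ^ q * X) ^ (1 / q) := by
          have := h S R g
          simp only [hgq] at this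
          gcongr
      _ = _ := by
          rw [Real.mul_rpow (by positivity) hX0, ← Real.rpow_mul hD, mul_one_div_cancel hq.ne',
            Real.rpow_one]
  rcases hX0.eq_or_lt with h0 | h0
  · rw [← h0]; positivity
  · have e3 : X ^ (1 / p) ≤ F ^ (1 / p) * D := by
      have e4 : X = X ^ (1 / p) * X ^ (1 / q) := by
        rw [← Real.rpow_add h0, one_div, one_div, hpq.inv_add_inv_eq_one, Real.rpow_one]
      have h5 : 0 < X ^ (1 / q) := by positivity
      have : X ^ (1 / p) * X ^ (1 / q) ≤ (F ^ (1 / p) * D) * X ^ (1 / q) := by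
        rw [← e4]; linarith
      exact le_of_mul_le_mul_right this h5
    calc X = (X ^ (1 / p)) ^ p := by
          rw [← Real.rpow_mul hX0, one_div_mul_cancel hp.ne', Real.rpow_one]
      _ ≤ (F ^ (1 / p) * D) ^ p := by gcongr
      _ = _ := by
          rw [Real.mul_rpow (by positivity) hD, ← Real.rpow_mul hF0, one_div_mul_cancel hp.ne',
            Real.rpow_one, mul_comm]

lemma ConvBound.mono {K : ℤ → ℂ} {p D D' : ℝ} (hp : 0 < p) (hD : 0 ≤ D) (h : ConvBound K p D)
    (hDD' : D ≤ D') : ConvBound K p D' := by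
  intro R S f
  refine (h R S f).trans ?_
  gcongr

/-- Calderón–Zygmund theorem on `ℤ`. -/
theorem exists_convBound (p : ℝ) (hp : 1 < p) : ∃ C : ℝ, 0 < C ∧ ∀ (K : ℤ → ℂ) (A : ℝ), 0 < A →
    ConvBound K 2 A → SmoothKernel K A → ConvBound K p (C * A) := by
  suffices H : ∃ C : ℝ, 0 < C ∧ ∀ (K : ℤ → ℂ), ConvBound K 2 1 → SmoothKernel K 1 →
      ConvBound K p C by
    obtain ⟨C, hC, H⟩ := H
    refine ⟨C, hC, fun K A hA h2 hK => ?_⟩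
    have h1 := H (fun n => ((A⁻¹ : ℝ) : ℂ) * K n)
      (by have := h2.const_mul hA.le A⁻¹ (by positivity)
          rwa [inv_mul_cancel₀ hA.ne'] at this)
      (by
        intro n hn
        obtain ⟨a, b⟩ := hK n hn
        simp only [← mul_sub, norm_mul, Complex.norm_real,
          Real.norm_of_nonneg (inv_nonneg.2 hA.le)]
        constructor
        · calc _ ≤ A⁻¹ * (A / (n : ℝ) ^ 2) := by gcongr
            _ = _ := by field_simp
        · calc _ ≤ A⁻¹ * (A / (n : ℝ) ^ 2) := by gcongr
            _ = _ := by field_simp)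
    have h3 := h1.const_mul hC.le A hA.le
    rw [mul_comm C A]
    convert h3 using 2 with n
    rw [← mul_assoc, ← Complex.ofReal_mul, mul_inv_cancel₀ hA.ne']; simp
  rcases lt_trichotomy p 2 with h | h | h
  · have h1 : 0 < p - 1 := by linarith
    have h2 : 0 < 2 - p := by linarith
    exact ⟨_, by positivity, fun K h2 hK => convBound_of_lt_two h2 hK p hp h⟩
  · subst h
    exact ⟨1, one_pos, fun K h2 _ => h2⟩
  · have hpq := Real.HolderConjugate.conjExponent hp
    set q := p.conjExponent with hq
    have hq1 := hpq.symm.lt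
    have hq2 : q < 2 := by
      rw [hq, Real.conjExponent, div_lt_iff₀ (by linarith)]; linarith
    have h1 : 0 < q - 1 := by linarith
    have h2 : 0 < 2 - q := by linarith
    have h22 : (2 : ℝ).HolderConjugate 2 := by
      rw [Real.holderConjugate_iff]; norm_num
    refine ⟨(120 * q / (q - 1) + 4 * q / (2 - q)) ^ (1 / q), by positivity, fun K h2 hK => ?_⟩
    have := (convBound_of_lt_two (h2.dual h22 zero_le_one) hK.neg q hq1 hq2).dual hpq
      (by positivity)
    simpa only [neg_neg] using this

/-- The tent window `(1 - |n|/N)₊`. -/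
noncomputable def tent (N : ℕ) (n : ℤ) : ℝ := (((N : ℤ) - |n|).toNat : ℝ) / N

lemma tent_eq_card (N : ℕ) (x y : ℤ) :
    tent N (x - y) = ((Finset.Ioc (x - N) x ∩ Finset.Ioc (y - N) y).card : ℝ) / N := by
  rw [tent, Finset.Ioc_inter_Ioc, Int.card_Ioc]
  congr 3
  rcases le_total x y with h | h
  · rw [abs_of_nonpos (by linarith), sup_eq_right.2 (by linarith), inf_eq_left.2 h]; ring
  · rw [abs_of_nonneg (by linarith), sup_eq_left.2 (by linarith), inf_eq_right.2 h]; ring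

/-- Tent truncations of a bounded convolution kernel are bounded with the same constant. -/
lemma ConvBound.tent_mul {K : ℤ → ℂ} {p D : ℝ} (hp : 1 ≤ p) (hD : 0 ≤ D) (h : ConvBound K p D)
    (N : ℕ) (hN : 1 ≤ N) : ConvBound (fun n => (tent N n : ℂ) * K n) p D := by
  classical
  intro R S f
  have hN0 : (0 : ℝ) < N := by exact_mod_cast hN
  set W : ℤ → Finset ℤ := fun x => Finset.Ioc (x - N) x with hW
  have hWcard : ∀ x, (W x).card = N := by intro x; simp [hW]
  set I := (R ∪ S).biUnion W with hI
  have hWR : ∀ x ∈ R, W x ⊆ I := fun x hx i hi =>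
    Finset.mem_biUnion.2 ⟨x, Finset.mem_union_left _ hx, hi⟩
  set T : ℤ → ℤ → ℂ := fun i x => ∑ y ∈ S, K (x - y) * (if i ∈ W y then f y else 0) with hT
  have e1 : ∀ x, ∑ y ∈ S, (tent N (x - y) : ℂ) * K (x - y) * f y
      = ∑ i ∈ W x, ((1 / N : ℝ) : ℂ) * T i x := by
    intro x
    simp only [hT, Finset.mul_sum]
    rw [Finset.sum_comm]
    refine Finset.sum_congr rfl fun y _ => ?_
    rw [tent_eq_card]
    simp only [mul_ite, mul_zero]
    rw [← Finset.sum_filter, Finset.filter_mem_eq_inter, Finset.sum_const, nsmul_eq_mul]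
    push_cast; ring
  have e2 : ∀ x, ‖∑ y ∈ S, (tent N (x - y) : ℂ) * K (x - y) * f y‖ ^ p ≤
      ∑ i ∈ W x, (1 / N : ℝ) * ‖T i x‖ ^ p := by
    intro x
    rw [e1 x]
    calc _ ≤ (∑ i ∈ W x, (1 / N : ℝ) * ‖T i x‖) ^ p := by
          gcongr
          refine (norm_sum_le _ _).trans (Finset.sum_le_sum fun i _ => ?_)
          rw [norm_mul, Complex.norm_real, Real.norm_of_nonneg (by positivity)]
      _ ≤ _ := by
          apply Real.rpow_arith_mean_le_arith_mean_rpow _ _ _ (fun _ _ => by positivity) _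
            (fun _ _ => norm_nonneg _) hp
          rw [Finset.sum_const, hWcard, nsmul_eq_mul]; field_simp
  calc _ ≤ ∑ x ∈ R, ∑ i ∈ W x, (1 / N : ℝ) * ‖T i x‖ ^ p := Finset.sum_le_sum fun x _ => e2 x
    _ ≤ ∑ x ∈ R, ∑ i ∈ I, (1 / N : ℝ) * ‖T i x‖ ^ p := Finset.sum_le_sum fun x hx =>
        Finset.sum_le_sum_of_subset_of_nonneg (hWR x hx) fun _ _ _ => by positivity
    _ = ∑ i ∈ I, (1 / N : ℝ) * ∑ x ∈ R, ‖T i x‖ ^ p := by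
        rw [Finset.sum_comm]; simp only [Finset.mul_sum]
    _ ≤ ∑ i ∈ I, (1 / N : ℝ) * (D ^ p * ∑ y ∈ S, ‖if i ∈ W y then f y else 0‖ ^ p) := by
        gcongr with i
        exact h R S _
    _ = D ^ p * ∑ y ∈ S, ∑ i ∈ I, (1 / N : ℝ) * ‖if i ∈ W y then f y else 0‖ ^ p := by
        rw [Finset.sum_comm]
        simp only [Finset.mul_sum]
        exact Finset.sum_congr rfl fun _ _ => Finset.sum_congr rfl fun _ _ => by ring
    _ ≤ _ := by
        gcongr with y hy
        have : ∀ i, (1 / N : ℝ) * ‖if i ∈ W y then f y else 0‖ ^ p =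
            if i ∈ W y then (1 / N : ℝ) * ‖f y‖ ^ p else 0 := by
          intro i
          split_ifs
          · rfl
          · rw [norm_zero, Real.zero_rpow (by linarith), mul_zero]
        simp only [this]
        rw [← Finset.sum_filter, Finset.filter_mem_eq_inter, Finset.sum_const, nsmul_eq_mul]
        calc _ ≤ (N : ℝ) * ((1 / N : ℝ) * ‖f y‖ ^ p) := by
              gcongr
              rw [← hWcard y]
              exact Finset.card_le_card Finset.inter_subset_right
          _ = _ := by field_simp

section Bessel

variable {α : Type*} [MeasurableSpace α] {ν : Measure α} [IsFiniteMeasure ν] {e : ℤ → α → ℂ}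

lemma integral_normSq_sum_orthonormal (hem : ∀ n, Measurable (e n)) (he : ∀ n a, ‖e n a‖ ≤ 1)
    (horth : ∀ m n, ∫ a, e m a * (starRingEnd ℂ) (e n a) ∂ν = if m = n then 1 else 0)
    (S : Finset ℤ) (f : ℤ → ℂ) :
    ∫ a, ‖∑ y ∈ S, f y * e y a‖ ^ 2 ∂ν = ∑ y ∈ S, ‖f y‖ ^ 2 := by
  have hint : ∀ m n, Integrable (fun a => e m a * (starRingEnd ℂ) (e n a)) ν := by
    intro m n
    refine Integrable.of_bound ((hem m).mul (Complex.continuous_conj.measurable.comp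
      (hem n))).aestronglyMeasurable 1 (Filter.Eventually.of_forall fun a => ?_)
    rw [norm_mul, RCLike.norm_conj]
    exact mul_le_one₀ (he _ _) (norm_nonneg _) (he _ _)
  apply Complex.ofReal_injective
  rw [← integral_complex_ofReal]
  have : ∀ a, ((‖∑ y ∈ S, f y * e y a‖ ^ 2 : ℝ) : ℂ) = ∑ y ∈ S, ∑ z ∈ S,
      f y * (starRingEnd ℂ) (f z) * (e y a * (starRingEnd ℂ) (e z a)) := by
    intro a
    rw [Complex.ofReal_pow, ← Complex.mul_conj', map_sum, Finset.sum_mul_sum]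
    simp only [map_mul]
    exact Finset.sum_congr rfl fun _ _ => Finset.sum_congr rfl fun _ _ => by ring
  calc _ = ∫ a, ∑ y ∈ S, ∑ z ∈ S,
      f y * (starRingEnd ℂ) (f z) * (e y a * (starRingEnd ℂ) (e z a)) ∂ν := by
        congr 1; ext a; exact this a
    _ = ∑ y ∈ S, ∑ z ∈ S, f y * (starRingEnd ℂ) (f z) * (if y = z then 1 else 0) := by
        rw [integral_finsetSum _ fun y _ => integrable_finsetSum _ fun z _ =>
          (hint y z).const_mul _]
        refine Finset.sum_congr rfl fun y _ => ?_
        rw [integral_finsetSum _ fun z _ => (hint y z).const_mul _]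
        refine Finset.sum_congr rfl fun z _ => ?_
        rw [integral_const_mul, horth]
    _ = _ := by
        push_cast
        refine Finset.sum_congr rfl fun y hy => ?_
        simp [hy, Complex.mul_conj']

/-- Bessel's inequality. -/
lemma sum_normSq_coeff_le (hem : ∀ n, Measurable (e n)) (he : ∀ n a, ‖e n a‖ ≤ 1)
    (horth : ∀ m n, ∫ a, e m a * (starRingEnd ℂ) (e n a) ∂ν = if m = n then 1 else 0)
    (R : Finset ℤ) (g : α → ℂ) (hg : Measurable g) (B : ℝ) (hB : ∀ a, ‖g a‖ ≤ B) :
    ∑ x ∈ R, ‖∫ a, g a * (starRingEnd ℂ) (e x a) ∂ν‖ ^ 2 ≤ ∫ a, ‖g a‖ ^ 2 ∂ν := by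
  set c : ℤ → ℂ := fun x => ∫ a, g a * (starRingEnd ℂ) (e x a) ∂ν with hc
  set P : α → ℂ := fun a => ∑ x ∈ R, c x * e x a with hP
  have hPm : Measurable P := Finset.measurable_fun_sum _ fun x _ => (hem x).const_mul _
  have hPB : ∀ a, ‖P a‖ ≤ ∑ x ∈ R, ‖c x‖ := fun a => (norm_sum_le _ _).trans
    (Finset.sum_le_sum fun x _ => by
      rw [norm_mul]; exact mul_le_of_le_one_right (norm_nonneg _) (he _ _))
  have hconj := Complex.continuous_conj.measurable
  have i0 : ∀ x, Integrable (fun a => g a * (starRingEnd ℂ) (e x a)) ν := fun x =>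
    Integrable.of_bound (hg.mul (hconj.comp (hem x))).aestronglyMeasurable B
      (Filter.Eventually.of_forall fun a => by
        rw [norm_mul, RCLike.norm_conj]
        exact (mul_le_of_le_one_right (norm_nonneg _) (he _ _)).trans (hB a))
  have i1 : Integrable (fun a => ‖g a‖ ^ 2) ν :=
    Integrable.of_bound (hg.norm.pow_const 2).aestronglyMeasurable (B ^ 2)
      (Filter.Eventually.of_forall fun a => by
        rw [norm_pow, norm_norm]; gcongr; exact hB a)
  have i2 : Integrable (fun a => ‖P a‖ ^ 2) ν :=
    Integrable.of_bound (hPm.norm.pow_const 2).aestronglyMeasurable ((∑ x ∈ R, ‖c x‖) ^ 2)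
      (Filter.Eventually.of_forall fun a => by
        rw [norm_pow, norm_norm]; gcongr; exact hPB a)
  have e0 : ∀ a, g a * (starRingEnd ℂ) (P a) =
      ∑ x ∈ R, (starRingEnd ℂ) (c x) * (g a * (starRingEnd ℂ) (e x a)) := by
    intro a
    simp only [hP, map_sum, map_mul, Finset.mul_sum]
    exact Finset.sum_congr rfl fun _ _ => by ring
  have i3 : Integrable (fun a => g a * (starRingEnd ℂ) (P a)) ν := by
    simp only [e0]
    exact integrable_finsetSum _ fun x _ => (i0 x).const_mul _
  have e1 : ∫ a, g a * (starRingEnd ℂ) (P a) ∂ν = ((∑ x ∈ R, ‖c x‖ ^ 2 : ℝ) : ℂ) := by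
    simp only [e0]
    rw [integral_finsetSum _ fun x _ => (i0 x).const_mul _]
    push_cast
    refine Finset.sum_congr rfl fun x _ => ?_
    rw [integral_const_mul, ← Complex.mul_conj', mul_comm]
  have e2 : ∫ a, (g a * (starRingEnd ℂ) (P a)).re ∂ν = ∑ x ∈ R, ‖c x‖ ^ 2 := by
    have := integral_re i3
    simp only [RCLike.re_eq_complex_re] at this
    rw [this, e1, Complex.ofReal_re]
  have e3 := integral_normSq_sum_orthonormal hem he horth R c
  have e4 : ∀ a, 2 * (g a * (starRingEnd ℂ) (P a)).re ≤ ‖g a‖ ^ 2 + ‖P a‖ ^ 2 := by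
    intro a
    have h1 := (Complex.re_le_norm (g a * (starRingEnd ℂ) (P a)))
    rw [norm_mul, RCLike.norm_conj] at h1
    nlinarith [sq_nonneg (‖g a‖ - ‖P a‖)]
  have e5 : ∫ a, 2 * (g a * (starRingEnd ℂ) (P a)).re ∂ν ≤ ∫ a, (‖g a‖ ^ 2 + ‖P a‖ ^ 2) ∂ν :=
    integral_mono (i3.re.const_mul 2) (i1.add i2) e4
  rw [integral_const_mul, e2, integral_add i1 i2, e3] at e5
  linarith

end Bessel

/-- The character `ξ ↦ e^{2πinξ}`. -/
noncomputable def chi (n : ℤ) (ξ : ℝ) : ℂ := Complex.exp (2 * π * Complex.I * (n * ξ))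

lemma norm_chi (n : ℤ) (ξ : ℝ) : ‖chi n ξ‖ = 1 := by
  rw [chi, show 2 * (π : ℂ) * Complex.I * (n * ξ) = ((2 * π * (n * ξ) : ℝ) : ℂ) * Complex.I by
    push_cast; ring, Complex.norm_exp_ofReal_mul_I]

lemma continuous_chi (n : ℤ) : Continuous (chi n) := by
  unfold chi; fun_prop

lemma chi_add (m n : ℤ) (ξ : ℝ) : chi (m + n) ξ = chi m ξ * chi n ξ := by
  rw [chi, chi, chi, ← Complex.exp_add]; push_cast; ring_nf

lemma chi_zero (ξ : ℝ) : chi 0 ξ = 1 := by simp [chi]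

lemma conj_chi (n : ℤ) (ξ : ℝ) : (starRingEnd ℂ) (chi n ξ) = chi (-n) ξ := by
  rw [chi, chi, ← Complex.exp_conj]; simp [Complex.conj_ofNat]

lemma chi_one_right (n : ℤ) : chi n 1 = 1 := by
  rw [chi, Complex.exp_eq_one_iff]
  exact ⟨n, by push_cast; ring⟩

lemma hasDerivAt_chi (n : ℤ) (ξ : ℝ) :
    HasDerivAt (chi n) (2 * π * Complex.I * n * chi n ξ) ξ := by
  have h1 : HasDerivAt (fun x : ℝ => 2 * (π : ℂ) * Complex.I * (n * (x : ℂ)))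
      (2 * π * Complex.I * (n * 1)) ξ :=
    ((hasDerivAt_id ξ).ofReal_comp.const_mul _).const_mul _
  exact h1.cexp.congr_deriv (by rw [chi]; ring)

lemma integral_chi_of_ne_zero (n : ℤ) (hn : n ≠ 0) (a b : ℝ) :
    ∫ ξ in a..b, chi n ξ = (chi n b - chi n a) / (2 * π * Complex.I * n) := by
  have hc : (2 * π * Complex.I * n : ℂ) ≠ 0 := by
    simp [Complex.I_ne_zero, hn, Real.pi_ne_zero]
  rw [intervalIntegral.integral_eq_sub_of_hasDerivAt
    (f := fun x => chi n x / (2 * π * Complex.I * n))]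
  · rw [sub_div]
  · intro x _
    exact ((hasDerivAt_chi n x).div_const (2 * π * Complex.I * n)).congr_deriv
      (by rw [mul_div_cancel_left₀ _ hc])
  · exact (continuous_chi n).intervalIntegrable _ _

lemma chi_zero_right (n : ℤ) : chi n 0 = 1 := by simp [chi]

lemma integral_chi (n : ℤ) : ∫ ξ in Set.Ioc (0 : ℝ) 1, chi n ξ = if n = 0 then 1 else 0 := by
  rw [← intervalIntegral.integral_of_le zero_le_one]
  split_ifs with h
  · simp [h, chi_zero]
  · rw [integral_chi_of_ne_zero n h, chi_one_right, chi_zero_right, sub_self, zero_div]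

/-- Fourier coefficients on the unit interval. -/
noncomputable def coeffI (m : ℝ → ℂ) (n : ℤ) : ℂ := ∫ ξ in Set.Ioc (0 : ℝ) 1, m ξ * chi (-n) ξ

/-- Bounded multipliers act boundedly on `ℓ²(ℤ)`. -/
lemma convBound_two_coeffI (m : ℝ → ℂ) (hm : Measurable m) (A : ℝ) (hA : ∀ ξ, ‖m ξ‖ ≤ A) :
    ConvBound (coeffI m) 2 A := by
  intro R S f
  simp only [Real.rpow_two]
  have horth : ∀ k n, ∫ a in Set.Ioc (0 : ℝ) 1, chi k a * (starRingEnd ℂ) (chi n a) =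
      if k = n then 1 else 0 := by
    intro k n
    simp only [conj_chi, ← chi_add, integral_chi, ← sub_eq_add_neg, sub_eq_zero]
  have hcm : ∀ n, Measurable (chi n) := fun n => (continuous_chi n).measurable
  have hc1 : ∀ n a, ‖chi n a‖ ≤ 1 := fun n a => (norm_chi n a).le
  have hA0 : 0 ≤ A := (norm_nonneg _).trans (hA 0)
  set P : ℝ → ℂ := fun a => ∑ y ∈ S, f y * chi y a with hP
  have hPm : Measurable P := Finset.measurable_fun_sum _ fun x _ => (hcm x).const_mul _
  have hPB : ∀ a, ‖P a‖ ≤ ∑ x ∈ S, ‖f x‖ := fun a => (norm_sum_le _ _).trans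
    (Finset.sum_le_sum fun x _ => by rw [norm_mul, norm_chi, mul_one])
  have key := sum_normSq_coeff_le (ν := volume.restrict (Set.Ioc (0 : ℝ) 1)) hcm hc1 horth R
    (fun a => m a * P a) (hm.mul hPm) (A * ∑ x ∈ S, ‖f x‖)
    (fun a => by rw [norm_mul]; exact mul_le_mul (hA a) (hPB a) (norm_nonneg _) hA0)
  have e1 : ∀ x, ∑ y ∈ S, coeffI m (x - y) * f y =
      ∫ a in Set.Ioc (0 : ℝ) 1, m a * P a * (starRingEnd ℂ) (chi x a) := by
    intro x
    have : ∀ a, m a * P a * (starRingEnd ℂ) (chi x a) =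
        ∑ y ∈ S, f y * (m a * chi (-(x - y)) a) := by
      intro a
      simp only [hP, Finset.mul_sum, Finset.sum_mul, conj_chi]
      refine Finset.sum_congr rfl fun y _ => ?_
      rw [show -(x - y) = y + -x by ring, chi_add]; ring
    simp only [this]
    rw [integral_finsetSum]
    · simp only [integral_const_mul, coeffI]
      exact Finset.sum_congr rfl fun _ _ => mul_comm _ _
    · intro y _
      refine Integrable.const_mul ?_ _
      refine Integrable.of_bound (hm.mul (hcm _)).aestronglyMeasurable A
        (Filter.Eventually.of_forall fun a => ?_)
      rw [norm_mul, norm_chi, mul_one]; exact hA a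
  simp only [e1]
  refine key.trans ?_
  have e3 := integral_normSq_sum_orthonormal (ν := volume.restrict (Set.Ioc (0 : ℝ) 1))
    hcm hc1 horth S f
  rw [← e3, ← integral_const_mul]
  have iP : ∀ (g : ℝ → ℂ) (B : ℝ), Measurable g → (∀ a, ‖g a‖ ≤ B) →
      Integrable (fun a => ‖g a‖ ^ 2) (volume.restrict (Set.Ioc (0 : ℝ) 1)) := fun g B hg hB =>
    Integrable.of_bound (hg.norm.pow_const 2).aestronglyMeasurable (B ^ 2)
      (Filter.Eventually.of_forall fun a => by
        rw [norm_pow, norm_norm]; gcongr; exact hB a)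
  refine integral_mono (iP _ (A * ∑ x ∈ S, ‖f x‖) (hm.mul hPm) fun a => ?_)
    ((iP P _ hPm hPB).const_mul _) fun a => ?_
  · rw [norm_mul]; exact mul_le_mul (hA a) (hPB a) (norm_nonneg _) hA0
  · simp only [norm_mul, mul_pow]
    gcongr
    exact hA a

lemma coeffI_sawtooth (n : ℤ) :
    coeffI ((Set.Icc (0 : ℝ) 1).indicator fun ξ => -(2 * π * Complex.I) * (ξ - 1 / 2)) n =
      (n : ℂ)⁻¹ := by
  have h2 : (2 * π * Complex.I : ℂ) ≠ 0 := by simp [Complex.I_ne_zero, Real.pi_ne_zero]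
  rw [coeffI, setIntegral_congr_fun measurableSet_Ioc
    (g := fun ξ : ℝ => -(2 * π * Complex.I) * (ξ - 1 / 2) * chi (-n) ξ) fun ξ hξ => by
      simp only [Set.indicator_of_mem (Set.Ioc_subset_Icc_self hξ)],
    ← intervalIntegral.integral_of_le zero_le_one]
  rcases eq_or_ne n 0 with rfl | hn
  · simp only [neg_zero, chi_zero, mul_one, Int.cast_zero, inv_zero]
    rw [intervalIntegral.integral_eq_sub_of_hasDerivAt
      (f := fun ξ : ℝ => -(2 * π * Complex.I) * (ξ ^ 2 / 2 - ξ / 2))]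
    · norm_num
    · intro x _
      have h1 : HasDerivAt (fun x : ℝ => (x : ℂ)) 1 x := (hasDerivAt_id x).ofReal_comp
      exact ((((h1.fun_pow 2).div_const 2).sub (h1.div_const 2)).const_mul _).congr_deriv
        (by push_cast; ring)
    · exact Continuous.intervalIntegrable (by fun_prop) _ _
  · have hn' : (n : ℂ) ≠ 0 := by exact_mod_cast hn
    rw [intervalIntegral.integral_eq_sub_of_hasDerivAt
      (f := fun ξ : ℝ => (n : ℂ)⁻¹ * ((ξ - 1 / 2) * chi (-n) ξ
        + chi (-n) ξ / (2 * π * Complex.I * n)))]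
    · rw [chi_one_right, chi_zero_right]; push_cast; ring
    · intro x _
      have h1 : HasDerivAt (fun x : ℝ => (x : ℂ)) 1 x := (hasDerivAt_id x).ofReal_comp
      refine ((((h1.sub_const (1 / 2)).mul (hasDerivAt_chi (-n) x)).add
        ((hasDerivAt_chi (-n) x).div_const (2 * π * Complex.I * n))).const_mul _).congr_deriv ?_
      push_cast
      field_simp
      ring
    · refine Continuous.intervalIntegrable ?_ _ _
      have := continuous_chi (-n)
      fun_prop

/-- The discrete Hilbert transform is bounded on `ℓ^p(ℤ)`. -/
lemma exists_convBound_hilbert (p : ℝ) (hp : 1 < p) :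
    ∃ D : ℝ, 0 < D ∧ ConvBound (fun n => (n : ℂ)⁻¹) p D := by
  obtain ⟨C, hC, H⟩ := exists_convBound p hp
  refine ⟨C * 4, by positivity, H _ 4 (by norm_num) ?_ ?_⟩
  · have := convBound_two_coeffI
      ((Set.Icc (0 : ℝ) 1).indicator fun ξ => -(2 * π * Complex.I) * (ξ - 1 / 2))
      (Measurable.indicator (by fun_prop) measurableSet_Icc) 4 (fun ξ => ?_)
    · simpa only [funext coeffI_sawtooth] using this
    · rw [Set.indicator_apply]
      split_ifs with h
      · have e : ‖(ξ : ℂ) - 1 / 2‖ = |ξ - 1 / 2| := by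
          rw [← Real.norm_eq_abs, ← Complex.norm_real]; push_cast; rfl
        rw [norm_mul, e]
        have h1 : |ξ - 1 / 2| ≤ 1 / 2 := abs_le.2 ⟨by linarith [h.1], by linarith [h.2]⟩
        have h2 : ‖-(2 * π * Complex.I : ℂ)‖ = 2 * π := by simp [abs_of_pos Real.pi_pos]
        rw [h2]
        nlinarith [Real.pi_le_four, Real.pi_pos]
      · simp
  · intro n hn
    have hn0 : (0 : ℝ) < n := by exact_mod_cast hn
    have hnc : (n : ℂ) ≠ 0 := by exact_mod_cast hn0.ne'
    have hnc1 : (n : ℂ) + 1 ≠ 0 := by exact_mod_cast (by positivity : (n : ℝ) + 1 ≠ 0)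
    have key : ‖((n : ℂ) * (n + 1))⁻¹‖ ≤ 4 / (n : ℝ) ^ 2 := by
      rw [norm_inv, norm_mul]
      have : ‖(n : ℂ) + 1‖ = n + 1 := by exact_mod_cast Complex.norm_natCast (n + 1)
      rw [this, Complex.norm_natCast, ← one_div]
      gcongr
      · norm_num
      · nlinarith
    constructor
    · refine le_of_eq_of_le ?_ key
      rw [← norm_neg]
      congr 1
      push_cast; field_simp; ring
    · refine le_of_eq_of_le ?_ key
      congr 1
      push_cast
      rw [← neg_add', inv_neg, inv_neg]
      field_simp; ring

/-- The symbol `|2 sin πξ|^{2 z}`. -/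
noncomputable def powSymbol (z : ℂ) (ξ : ℝ) : ℂ := ((|2 * Real.sin (π * ξ)| : ℝ) : ℂ) ^ (2 * z)

section PowSymbol

variable {z : ℂ}

lemma continuous_powSymbol (hz : 0 < z.re) : Continuous (powSymbol z) := by
  have h := Complex.continuous_ofReal_cpow_const (y := 2 * z) (by simpa using hz)
  exact h.comp (by fun_prop : Continuous fun ξ : ℝ => |2 * Real.sin (π * ξ)|)

lemma norm_powSymbol_le (hz : 0 < z.re) (hz2 : z.re ≤ 1 / 2) (ξ : ℝ) : ‖powSymbol z ξ‖ ≤ 2 := by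
  have hre : (2 * z).re = 2 * z.re := by simp
  rw [powSymbol, Complex.norm_cpow_eq_rpow_re_of_nonneg (abs_nonneg _) (by rw [hre]; positivity),
    hre]
  have h1 : |2 * Real.sin (π * ξ)| ≤ 2 := by
    rw [abs_mul, abs_two]
    linarith [Real.abs_sin_le_one (π * ξ)]
  calc _ ≤ (2 : ℝ) ^ (2 * z.re) := by gcongr
    _ ≤ (2 : ℝ) ^ (1 : ℝ) := by gcongr <;> linarith
    _ = 2 := Real.rpow_one 2

lemma powSymbol_periodic : Function.Periodic (powSymbol z) 1 := by
  intro ξ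
  rw [powSymbol, powSymbol, mul_add, mul_one, Real.sin_add_pi, mul_neg, abs_neg]

lemma powSymbol_one_sub (ξ : ℝ) : powSymbol z (1 - ξ) = powSymbol z ξ := by
  rw [powSymbol, powSymbol, mul_sub, mul_one, Real.sin_pi_sub]

lemma hasDerivAt_powSymbol (hz : 0 < z.re) {ξ : ℝ} (hξ : ξ ∈ Set.Ioo (0 : ℝ) 1) :
    ∃ D, HasDerivAt (powSymbol z) D ξ ∧
      (chi 1 ξ - 1) * D = 2 * π * Complex.I * z * (chi 1 ξ + 1) * powSymbol z ξ := by
  have hsin : 0 < Real.sin (π * ξ) := Real.sin_pos_of_pos_of_lt_pi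
    (mul_pos Real.pi_pos hξ.1) (by nlinarith [Real.pi_pos, hξ.2])
  have h1 : HasDerivAt (fun x : ℝ => 2 * Real.sin (π * x)) (2 * (Real.cos (π * ξ) * π)) ξ := by
    have := (((hasDerivAt_id ξ).const_mul π).sin).const_mul 2
    simpa using this
  have h2 : HasDerivAt (fun x : ℝ => |2 * Real.sin (π * x)|) (2 * (Real.cos (π * ξ) * π)) ξ := by
    refine h1.congr_of_eventuallyEq ?_
    filter_upwards [h1.continuousAt.eventually (lt_mem_nhds (by positivity :
      0 < 2 * Real.sin (π * ξ)))] with x hx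
    exact abs_of_pos hx
  have hlam : |2 * Real.sin (π * ξ)| = 2 * Real.sin (π * ξ) := abs_of_pos (by positivity)
  have hz0 : 2 * z ≠ 0 := fun h => by
    have := congrArg Complex.re h
    simp at this
    exact hz.ne' this
  have h3 := (hasDerivAt_ofReal_cpow_const (x := |2 * Real.sin (π * ξ)|)
    (by rw [hlam]; positivity) hz0).scomp ξ h2
  refine ⟨_, h3, ?_⟩
  have hs : (Complex.sin (π * ξ) : ℂ) ≠ 0 := by
    have : (Complex.sin (π * ξ) : ℂ) = (Real.sin (π * ξ) : ℝ) := by push_cast; rfl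
    rw [this]; exact_mod_cast hsin.ne'
  have hl0 : ((2 * Real.sin (π * ξ) : ℝ) : ℂ) ≠ 0 := by
    push_cast; exact mul_ne_zero two_ne_zero hs
  rw [hlam, Complex.cpow_sub _ _ hl0, Complex.cpow_one]
  rw [powSymbol, hlam]
  have e1 : chi 1 ξ = Complex.exp (π * ξ * Complex.I) ^ 2 := by
    rw [chi, ← Complex.exp_nat_mul]; push_cast; ring_nf
  have e2 : Complex.exp (π * ξ * Complex.I) = Complex.cos (π * ξ) + Complex.sin (π * ξ) * Complex.I :=
    Complex.exp_mul_I _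
  rw [e1, e2, Complex.real_smul]
  push_cast
  set c := Complex.cos (π * ξ)
  set s := Complex.sin (π * ξ)
  have e3 : c ^ 2 = 1 - s ^ 2 := by
    linear_combination Complex.sin_sq_add_cos_sq (π * (ξ : ℂ))
  have hI := Complex.I_sq
  have e4 : (c + s * Complex.I) ^ 2 - 1 = 2 * s * Complex.I * (c + s * Complex.I) := by
    linear_combination (-1 : ℂ) * (s ^ 2 * hI) + e3
  have e5 : (c + s * Complex.I) ^ 2 + 1 = 2 * c * (c + s * Complex.I) := by
    linear_combination s ^ 2 * hI - e3
  rw [e4, e5]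
  field_simp

/-- Recurrence for the Fourier coefficients of `powSymbol`. -/
lemma coeffI_powSymbol_recurrence (hz : 0 < z.re) (n : ℤ) :
    (1 + z + n) * coeffI (powSymbol z) (n + 1) = (n - z) * coeffI (powSymbol z) n := by
  have hc := continuous_powSymbol hz
  have hi : ∀ k, IntervalIntegrable (fun ξ => powSymbol z ξ * chi k ξ) volume 0 1 := fun k =>
    (hc.mul (continuous_chi k)).intervalIntegrable _ _
  have key := intervalIntegral.integral_eq_sub_of_hasDerivAt_of_le (a := 0) (b := 1)
    (f := fun ξ => (chi 1 ξ - 1) * powSymbol z ξ * chi (-(n + 1)) ξ)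
    (f' := fun ξ => 2 * π * Complex.I * ((z - n) * (powSymbol z ξ * chi (-n) ξ) +
      (1 + z + n) * (powSymbol z ξ * chi (-(n + 1)) ξ)))
    zero_le_one
    ((((continuous_chi 1).sub continuous_const).mul hc).mul (continuous_chi _)).continuousOn
    (fun ξ hξ => by
      obtain ⟨D, hD, hD2⟩ := hasDerivAt_powSymbol hz hξ
      refine ((((hasDerivAt_chi 1 ξ).sub_const 1).mul hD).mul
        (hasDerivAt_chi (-(n + 1)) ξ)).congr_deriv ?_
      simp only [Pi.mul_apply]
      rw [hD2]
      have : chi (-n) ξ = chi 1 ξ * chi (-(n + 1)) ξ := by rw [← chi_add]; congr 1; ring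
      rw [this]
      push_cast
      ring)
    ((((hi _).const_mul _).add ((hi _).const_mul _)).const_mul _)
  simp only [chi_one_right, chi_zero_right, sub_self, zero_mul] at key
  rw [intervalIntegral.integral_const_mul, intervalIntegral.integral_add ((hi _).const_mul _)
    ((hi _).const_mul _), intervalIntegral.integral_const_mul,
    intervalIntegral.integral_const_mul] at key
  have h2 : (2 * π * Complex.I : ℂ) ≠ 0 := by simp [Complex.I_ne_zero, Real.pi_ne_zero]
  have key2 := (mul_eq_zero.1 key).resolve_left h2
  simp only [coeffI]
  rw [← intervalIntegral.integral_of_le zero_le_one, ← intervalIntegral.integral_of_le zero_le_one]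
  linear_combination key2

lemma coeffI_powSymbol_neg (n : ℤ) :
    coeffI (powSymbol z) (-n) = coeffI (powSymbol z) n := by
  simp only [coeffI]
  rw [← intervalIntegral.integral_of_le zero_le_one, ← intervalIntegral.integral_of_le zero_le_one]
  have := intervalIntegral.integral_comp_sub_left (a := 0) (b := 1)
    (fun ξ => powSymbol z ξ * chi (-n) ξ) 1
  rw [sub_self, sub_zero] at this
  rw [← this]
  congr 1
  ext ξ
  rw [powSymbol_one_sub]
  congr 1
  rw [chi, chi, Complex.exp_eq_exp_iff_exists_int]
  exact ⟨n, by push_cast; ring⟩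

lemma norm_coeffI_le {m : ℝ → ℂ} {B : ℝ} (hB : ∀ ξ, ‖m ξ‖ ≤ B) (n : ℤ) : ‖coeffI m n‖ ≤ B := by
  have := norm_setIntegral_le_of_norm_le_const (μ := volume) (s := Set.Ioc (0 : ℝ) 1)
    (f := fun ξ => m ξ * chi (-n) ξ) (C := B) (by simp)
    (fun ξ _ => by rw [norm_mul, norm_chi, mul_one]; exact hB ξ)
  simpa [coeffI] using this

lemma normSq_add_of_re (a : ℝ) (w : ℂ) : ‖(a : ℂ) + w‖ ^ 2 = (a + w.re) ^ 2 + w.im ^ 2 := by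
  rw [Complex.sq_norm, Complex.normSq_apply]; simp; ring

lemma sq_recurrence (hz : 0 < z.re) (n : ℕ) :
    ‖coeffI (powSymbol z) (n + 1 : ℕ)‖ ^ 2 * ((n + 1 + z.re) ^ 2 + z.im ^ 2) =
      ‖coeffI (powSymbol z) n‖ ^ 2 * ((n - z.re) ^ 2 + z.im ^ 2) := by
  have h := congrArg (fun w => ‖w‖ ^ 2) (coeffI_powSymbol_recurrence hz n)
  simp only [norm_mul, mul_pow] at h
  have e1 : ‖1 + z + ((n : ℤ) : ℂ)‖ ^ 2 = (n + 1 + z.re) ^ 2 + z.im ^ 2 := by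
    rw [← normSq_add_of_re]; congr 2; push_cast; ring
  have e2 : ‖((n : ℤ) : ℂ) - z‖ ^ 2 = (n - z.re) ^ 2 + z.im ^ 2 := by
    have := normSq_add_of_re n (-z)
    simp only [Complex.neg_re, Complex.neg_im, neg_sq, ← sub_eq_add_neg] at this
    rw [← this]; push_cast; rfl
  rw [e1, e2] at h
  push_cast at h ⊢
  linarith

lemma coeffI_powSymbol_decay (hz : 0 < z.re) (hz2 : z.re ≤ 1 / 2) (n : ℕ) (hn : 1 ≤ n) :
    ‖coeffI (powSymbol z) n‖ ^ 2 * (n ^ 2 + z.im ^ 2) ≤ 4 * (1 + z.im ^ 2) := by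
  induction n, hn using Nat.le_induction with
  | base =>
    have h := sq_recurrence hz 0
    have h0 := norm_coeffI_le (norm_powSymbol_le hz hz2) 0
    push_cast at h ⊢
    simp only [zero_add, zero_sub, neg_sq] at h ⊢
    have h1 : ‖coeffI (powSymbol z) 0‖ ^ 2 ≤ 4 := by nlinarith [norm_nonneg (coeffI (powSymbol z) 0)]
    calc _ ≤ ‖coeffI (powSymbol z) 1‖ ^ 2 * ((1 + z.re) ^ 2 + z.im ^ 2) := by
          gcongr; linarith
      _ = _ := h
      _ ≤ 4 * (z.re ^ 2 + z.im ^ 2) := by gcongr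
      _ ≤ _ := by nlinarith
  | succ n hn ih =>
    have h := sq_recurrence hz n
    have hn1 : (1 : ℝ) ≤ n := by exact_mod_cast hn
    calc _ ≤ ‖coeffI (powSymbol z) (n + 1 : ℕ)‖ ^ 2 * ((n + 1 + z.re) ^ 2 + z.im ^ 2) := by
          have h7 : ((n + 1 : ℕ) : ℝ) ≤ n + 1 + z.re := by push_cast; linarith
          gcongr
      _ = _ := h
      _ ≤ ‖coeffI (powSymbol z) n‖ ^ 2 * (n ^ 2 + z.im ^ 2) := by
          gcongr ‖_‖ ^ 2 * (?_ + _)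
          nlinarith
      _ ≤ _ := ih

lemma smoothKernel_powSymbol (hz : 0 < z.re) (hz2 : z.re ≤ 1 / 2) :
    SmoothKernel (coeffI (powSymbol z)) (4 * (1 + |z.im|) ^ 2) := by
  intro n hn
  have hn0 : (0 : ℝ) < n := by exact_mod_cast hn
  set K := coeffI (powSymbol z) with hK
  have hd := coeffI_powSymbol_decay hz hz2 n hn
  have h1 : ‖K n‖ * n ≤ 2 * (1 + |z.im|) := by
    rw [← sq_le_sq₀ (by positivity) (by positivity), mul_pow, mul_pow]
    have : z.im ^ 2 = |z.im| ^ 2 := (sq_abs _).symm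
    nlinarith [abs_nonneg z.im, sq_nonneg (‖K n‖ * z.im)]
  have hrec := coeffI_powSymbol_recurrence hz n
  have h2 : (1 + z + n) * (K (n + 1) - K n) = -(1 + 2 * z) * K n := by
    push_cast at hrec; linear_combination hrec
  have h3 : ‖1 + z + (n : ℂ)‖ ≥ n := by
    refine le_trans ?_ (Complex.re_le_norm _)
    simp; linarith
  have h4 : ‖-(1 + 2 * z)‖ ≤ 2 * (1 + |z.im|) := by
    rw [norm_neg]
    refine (Complex.norm_le_abs_re_add_abs_im _).trans ?_
    simp only [Complex.add_re, Complex.one_re, Complex.add_im, Complex.one_im, zero_add,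
      Complex.mul_re, Complex.mul_im, Complex.re_ofNat, Complex.im_ofNat, zero_mul, sub_zero,
      add_zero, abs_mul, abs_two]
    rw [abs_of_pos (by linarith)]
    linarith
  have h5 : ‖K (n + 1) - K n‖ ≤ 4 * (1 + |z.im|) ^ 2 / (n : ℝ) ^ 2 := by
    rw [le_div_iff₀ (by positivity)]
    have h6 := congrArg norm h2
    rw [norm_mul, norm_mul] at h6
    calc _ = (n * ‖K (n + 1) - K n‖) * n := by ring
      _ ≤ (‖1 + z + (n : ℂ)‖ * ‖K (n + 1) - K n‖) * n := by gcongr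
      _ = ‖-(1 + 2 * z)‖ * (‖K n‖ * n) := by rw [h6]; ring
      _ ≤ (2 * (1 + |z.im|)) * (2 * (1 + |z.im|)) := by gcongr
      _ = _ := by ring
  refine ⟨h5, ?_⟩
  rw [show -(n : ℤ) - 1 = -(n + 1) by ring, hK, coeffI_powSymbol_neg, coeffI_powSymbol_neg]
  exact h5

lemma summable_coeffI_powSymbol (hz : 0 < z.re) : Summable fun n => ‖coeffI (powSymbol z) n‖ := by
  set K := coeffI (powSymbol z) with hK
  set c : ℝ := 4 * z.re / (2 + 2 * ‖z‖) with hc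
  have hc0 : 0 < c := by positivity
  have hgap : ∀ n : ℕ, ‖((n + 1 : ℕ) : ℂ) - z‖ + c ≤ ‖1 + z + (n : ℂ)‖ := by
    intro n
    set X := ‖((n + 1 : ℕ) : ℂ) - z‖
    set Y := ‖1 + z + (n : ℂ)‖
    have hX : X ^ 2 = (n + 1 - z.re) ^ 2 + z.im ^ 2 := by
      have := normSq_add_of_re (n + 1) (-z)
      simp only [Complex.neg_re, Complex.neg_im, neg_sq, ← sub_eq_add_neg] at this
      simp only [X]; rw [← this]; push_cast; rfl
    have hY : Y ^ 2 = (n + 1 + z.re) ^ 2 + z.im ^ 2 := by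
      simp only [Y]; rw [← normSq_add_of_re]; congr 2; push_cast; ring
    have hXle : X ≤ n + 1 + ‖z‖ := by
      refine (norm_sub_le _ _).trans ?_
      rw [Complex.norm_natCast]; push_cast; rfl
    have hYle : Y ≤ n + 1 + ‖z‖ := by
      have : 1 + z + (n : ℂ) = ((n + 1 : ℕ) : ℂ) + z := by push_cast; ring
      simp only [Y]
      rw [this]
      refine (norm_add_le _ _).trans ?_
      rw [Complex.norm_natCast]; push_cast; rfl
    have hX0 : 0 ≤ X := norm_nonneg _
    have hY0 : 0 ≤ Y := norm_nonneg _
    have hcm : c * (2 + 2 * ‖z‖) = 4 * z.re := by rw [hc]; field_simp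
    have h1 : (Y - X) * (Y + X) = 4 * (n + 1) * z.re := by nlinarith
    have h2 : Y + X ≤ (n + 1) * (2 + 2 * ‖z‖) := by
      nlinarith [norm_nonneg z, Nat.cast_nonneg (α := ℝ) n, mul_nonneg (Nat.cast_nonneg (α := ℝ) n) (norm_nonneg z)]
    by_contra! hlt
    have h3 : (Y - X) * (Y + X) ≤ c * (Y + X) :=
      mul_le_mul_of_nonneg_right (by linarith) (by positivity)
    have hn0 : (0 : ℝ) ≤ n := Nat.cast_nonneg n
    have hYX : 0 < Y + X := by
      rcases (by positivity : 0 ≤ Y + X).eq_or_lt with h | h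
      · rw [← h, mul_zero] at h1; nlinarith
      · exact h
    have h4 : (Y - X) * (Y + X) < c * (Y + X) := mul_lt_mul_of_pos_right (by linarith) hYX
    have h5 : c * (Y + X) ≤ c * ((n + 1) * (2 + 2 * ‖z‖)) := by gcongr
    have h6 : c * ((n + 1) * (2 + 2 * ‖z‖)) = 4 * (n + 1) * z.re := by
      rw [mul_left_comm, hcm]; ring
    linarith
  have hsum : ∀ N : ℕ, ∑ n ∈ Finset.range N, ‖K ((n + 1 : ℕ) : ℤ)‖ * c ≤
      ‖K 0‖ * ‖z‖ - ‖K N‖ * ‖(N : ℂ) - z‖ := by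
    intro N
    induction N with
    | zero => simp
    | succ N ih =>
      rw [Finset.sum_range_succ]
      have hrec := congrArg norm (coeffI_powSymbol_recurrence hz N)
      rw [norm_mul, norm_mul] at hrec
      have h1 := mul_le_mul_of_nonneg_left (hgap N) (norm_nonneg (K ((N + 1 : ℕ) : ℤ)))
      push_cast at hrec h1 ih ⊢
      simp only [← hK] at hrec
      nlinarith
  have hnat : Summable fun n : ℕ => ‖K n‖ := by
    rw [← summable_nat_add_iff 1]
    have : Summable fun n : ℕ => ‖K ((n + 1 : ℕ) : ℤ)‖ * c :=
      summable_of_sum_range_le (fun _ => by positivity) fun N => (hsum N).trans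
        (sub_le_self _ (by positivity))
    exact (summable_mul_right_iff hc0.ne').1 this
  refine Summable.of_nat_of_neg hnat ?_
  simpa only [hK, coeffI_powSymbol_neg] using hnat

/-- Fourier inversion for `powSymbol`. -/
lemma hasSum_powSymbol (hz : 0 < z.re) (ξ : ℝ) :
    HasSum (fun n : ℤ => coeffI (powSymbol z) n * chi n ξ) (powSymbol z ξ) := by
  have : Fact ((0 : ℝ) < 1) := ⟨one_pos⟩
  have hper : Function.Periodic (powSymbol z) 1 := powSymbol_periodic
  set F : C(AddCircle (1 : ℝ), ℂ) := ⟨hper.lift,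
    continuous_coinduced_dom.mpr (continuous_powSymbol hz)⟩ with hF
  have hFapp : ∀ x : ℝ, F (x : AddCircle (1 : ℝ)) = powSymbol z x := fun x => hper.lift_coe x
  have hchi : ∀ (n : ℤ) (x : ℝ), fourier n (x : AddCircle (1 : ℝ)) = chi n x := by
    intro n x
    rw [fourier_coe_apply, chi]; congr 1; push_cast; ring
  have hco : ∀ n, fourierCoeff F n = coeffI (powSymbol z) n := by
    intro n
    rw [fourierCoeff_eq_intervalIntegral _ n 0, coeffI, zero_add, div_one, one_smul,
      intervalIntegral.integral_of_le zero_le_one]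
    simp only [hFapp, hchi, smul_eq_mul, mul_comm]
  have hs : Summable (fourierCoeff F) := by
    simp only [funext hco]
    exact (summable_coeffI_powSymbol hz).of_norm
  have := has_pointwise_sum_fourier_series_of_summable hs (ξ : AddCircle (1 : ℝ))
  simpa only [hco, hchi, hFapp, smul_eq_mul] using this

end PowSymbol

/-- The character `ξ ↦ e^{2πi n·ξ}` of the torus `𝕋^d`. -/
noncomputable def chiT {d : ℕ} (n : Fin d → ℤ) (ξ : Fin d → ℝ) : ℂ :=
  Complex.exp (2 * Real.pi * Complex.I * ∑ j, (n j : ℂ) * (ξ j : ℂ))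

/-- The Fourier coefficients of a function on `𝕋^d`. -/
noncomputable def coeffT {d : ℕ} (φ : (Fin d → ℝ) → ℂ) (n : Fin d → ℤ) : ℂ :=
  ∫ ξ in Td d, φ ξ * chiT (-n) ξ

/-- Bounded measurable functions. -/
def BddMeas {d : ℕ} (φ : (Fin d → ℝ) → ℂ) : Prop := Measurable φ ∧ ∃ B, ∀ ξ, ‖φ ξ‖ ≤ B

/-- The Fourier coefficients of `φ` have `ℓ^p` norm at most `M`. -/
def CoeffBound {d : ℕ} (p : ℝ) (φ : (Fin d → ℝ) → ℂ) (M : ℝ) : Prop :=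
  ∀ R : Finset (Fin d → ℤ), ∑ x ∈ R, ‖coeffT φ x‖ ^ p ≤ M ^ p

/-- `m` is a Fourier multiplier of `ℓ^p(ℤ^d)` with norm at most `C`. -/
structure IsMul {d : ℕ} (p : ℝ) (m : (Fin d → ℝ) → ℂ) (C : ℝ) : Prop where
  bdd : BddMeas m
  nonneg : 0 ≤ C
  bound : ∀ φ, BddMeas φ → ∀ M, 0 ≤ M → CoeffBound p φ M →
    CoeffBound p (fun ξ => m ξ * φ ξ) (C * M)

section Torus

variable {d : ℕ} {p : ℝ}

lemma continuous_chiT (n : Fin d → ℤ) : Continuous (chiT n) := by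
  unfold chiT; fun_prop

lemma norm_chiT (n : Fin d → ℤ) (ξ : Fin d → ℝ) : ‖chiT n ξ‖ = 1 := by
  rw [chiT, show 2 * (π : ℂ) * Complex.I * ∑ j, (n j : ℂ) * (ξ j : ℂ) =
    ((2 * π * ∑ j, (n j : ℝ) * ξ j : ℝ) : ℂ) * Complex.I by push_cast; ring,
    Complex.norm_exp_ofReal_mul_I]

lemma chiT_add (m n : Fin d → ℤ) (ξ : Fin d → ℝ) : chiT (m + n) ξ = chiT m ξ * chiT n ξ := by
  rw [chiT, chiT, chiT, ← Complex.exp_add, ← mul_add, ← Finset.sum_add_distrib]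
  simp only [Pi.add_apply, Int.cast_add, add_mul]

lemma bddMeas_chiT (n : Fin d → ℤ) : BddMeas (chiT n) :=
  ⟨(continuous_chiT n).measurable, 1, fun ξ => (norm_chiT n ξ).le⟩

lemma volume_Td : volume (Td d) = 1 := by
  rw [Td, volume_pi_pi]
  simp only [Real.volume_Icc]
  norm_num

instance isProbabilityMeasure_Td : IsProbabilityMeasure (volume.restrict (Td d)) :=
  ⟨by rw [Measure.restrict_apply_univ, volume_Td]⟩

lemma BddMeas.mul {φ ψ : (Fin d → ℝ) → ℂ} (h1 : BddMeas φ) (h2 : BddMeas ψ) :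
    BddMeas fun ξ => φ ξ * ψ ξ := by
  obtain ⟨m1, B1, b1⟩ := h1
  obtain ⟨m2, B2, b2⟩ := h2
  refine ⟨m1.mul m2, B1 * B2, fun ξ => ?_⟩
  rw [norm_mul]
  exact mul_le_mul (b1 ξ) (b2 ξ) (norm_nonneg _) ((norm_nonneg _).trans (b1 ξ))

lemma BddMeas.add {φ ψ : (Fin d → ℝ) → ℂ} (h1 : BddMeas φ) (h2 : BddMeas ψ) :
    BddMeas fun ξ => φ ξ + ψ ξ := by
  obtain ⟨m1, B1, b1⟩ := h1
  obtain ⟨m2, B2, b2⟩ := h2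
  exact ⟨m1.add m2, B1 + B2, fun ξ => (norm_add_le _ _).trans (add_le_add (b1 ξ) (b2 ξ))⟩

lemma bddMeas_const (c : ℂ) : BddMeas fun _ : Fin d → ℝ => c :=
  ⟨measurable_const, ‖c‖, fun _ => le_rfl⟩

lemma BddMeas.integrable {φ : (Fin d → ℝ) → ℂ} (h : BddMeas φ) :
    Integrable φ (volume.restrict (Td d)) := by
  obtain ⟨m, B, b⟩ := h
  exact Integrable.of_bound m.aestronglyMeasurable B (Filter.Eventually.of_forall b)

lemma BddMeas.integrable_mul_chiT {φ : (Fin d → ℝ) → ℂ} (h : BddMeas φ) (n : Fin d → ℤ) :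
    Integrable (fun ξ => φ ξ * chiT n ξ) (volume.restrict (Td d)) :=
  (h.mul (bddMeas_chiT n)).integrable

lemma coeffT_congr {φ ψ : (Fin d → ℝ) → ℂ} (h : φ =ᵐ[volume.restrict (Td d)] ψ) :
    coeffT φ = coeffT ψ := by
  ext n
  refine integral_congr_ae ?_
  filter_upwards [h] with ξ hξ
  rw [hξ]

lemma coeffT_add {φ ψ : (Fin d → ℝ) → ℂ} (h1 : BddMeas φ) (h2 : BddMeas ψ) (n : Fin d → ℤ) :
    coeffT (fun ξ => φ ξ + ψ ξ) n = coeffT φ n + coeffT ψ n := by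
  simp only [coeffT, add_mul]
  exact integral_add (h1.integrable_mul_chiT _) (h2.integrable_mul_chiT _)

lemma coeffT_const_mul (c : ℂ) (φ : (Fin d → ℝ) → ℂ) (n : Fin d → ℤ) :
    coeffT (fun ξ => c * φ ξ) n = c * coeffT φ n := by
  simp only [coeffT, mul_assoc]
  exact integral_const_mul _ _

lemma coeffT_sum {ι : Type*} (s : Finset ι) {φ : ι → (Fin d → ℝ) → ℂ}
    (h : ∀ i ∈ s, BddMeas (φ i)) (n : Fin d → ℤ) :
    coeffT (fun ξ => ∑ i ∈ s, φ i ξ) n = ∑ i ∈ s, coeffT (φ i) n := by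
  simp only [coeffT, Finset.sum_mul]
  exact integral_finsetSum _ fun i hi => (h i hi).integrable_mul_chiT _

lemma coeffT_chiT_mul (k : Fin d → ℤ) (φ : (Fin d → ℝ) → ℂ) (n : Fin d → ℤ) :
    coeffT (fun ξ => chiT k ξ * φ ξ) n = coeffT φ (n - k) := by
  simp only [coeffT]
  congr 1; ext ξ
  rw [show -(n - k) = k + -n by abel, chiT_add]; ring

lemma coeffT_tendsto {F : ℕ → (Fin d → ℝ) → ℂ} {φ : (Fin d → ℝ) → ℂ} {B : ℝ}
    (hF : ∀ k, Measurable (F k)) (hB : ∀ k ξ, ‖F k ξ‖ ≤ B)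
    (h : ∀ᵐ ξ ∂volume.restrict (Td d),
      Filter.Tendsto (fun k => F k ξ) Filter.atTop (nhds (φ ξ))) (n : Fin d → ℤ) :
    Filter.Tendsto (fun k => coeffT (F k) n) Filter.atTop (nhds (coeffT φ n)) := by
  refine tendsto_integral_of_dominated_convergence (fun _ => B)
    (fun k => ((hF k).mul (continuous_chiT _).measurable).aestronglyMeasurable)
    (integrable_const B) (fun k => Filter.Eventually.of_forall fun ξ => ?_) ?_
  · rw [norm_mul, norm_chiT, mul_one]; exact hB k ξ
  · filter_upwards [h] with ξ hξ using hξ.mul_const _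

lemma IsMul.mono {m : (Fin d → ℝ) → ℂ} {C C' : ℝ} (hp : 0 < p) (h : IsMul p m C) (hC : C ≤ C') :
    IsMul p m C' := by
  refine ⟨h.bdd, h.nonneg.trans hC, fun φ hφ M hM hM' R => (h.bound φ hφ M hM hM' R).trans ?_⟩
  have := h.nonneg
  gcongr

lemma IsMul.mul {m₁ m₂ : (Fin d → ℝ) → ℂ} {C₁ C₂ : ℝ} (h1 : IsMul p m₁ C₁)
    (h2 : IsMul p m₂ C₂) : IsMul p (fun ξ => m₁ ξ * m₂ ξ) (C₁ * C₂) := by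
  refine ⟨h1.bdd.mul h2.bdd, mul_nonneg h1.nonneg h2.nonneg, fun φ hφ M hM hM' => ?_⟩
  have := h1.bound _ (h2.bdd.mul hφ) (C₂ * M) (mul_nonneg h2.nonneg hM) (h2.bound φ hφ M hM hM')
  simpa only [mul_assoc] using this

lemma CoeffBound.add {φ ψ : (Fin d → ℝ) → ℂ} {M N : ℝ} (hp : 1 ≤ p) (hM : 0 ≤ M) (hN : 0 ≤ N)
    (h1 : BddMeas φ) (h2 : BddMeas ψ) (hφ : CoeffBound p φ M) (hψ : CoeffBound p ψ N) :
    CoeffBound p (fun ξ => φ ξ + ψ ξ) (M + N) := by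
  intro R
  have hp0 : 0 < p := by linarith
  have key := Real.Lp_add_le_of_nonneg (s := R) (f := fun x => ‖coeffT φ x‖)
    (g := fun x => ‖coeffT ψ x‖) hp (fun _ _ => norm_nonneg _) (fun _ _ => norm_nonneg _)
  have aux : ∀ {S Q : ℝ}, 0 ≤ S → 0 ≤ Q → S ≤ Q ^ p → S ^ (1 / p) ≤ Q := by
    intro S Q hS hQ h
    calc S ^ (1 / p) ≤ (Q ^ p) ^ (1 / p) := by gcongr
      _ = Q := by rw [← Real.rpow_mul hQ, mul_one_div_cancel hp0.ne', Real.rpow_one]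
  have h3 := key.trans (add_le_add (aux (by positivity) hM (hφ R)) (aux (by positivity) hN (hψ R)))
  calc ∑ x ∈ R, ‖coeffT (fun ξ => φ ξ + ψ ξ) x‖ ^ p
      ≤ ∑ x ∈ R, (‖coeffT φ x‖ + ‖coeffT ψ x‖) ^ p := by
        gcongr with x
        rw [coeffT_add h1 h2]
        exact norm_add_le _ _
    _ = ((∑ x ∈ R, (‖coeffT φ x‖ + ‖coeffT ψ x‖) ^ p) ^ (1 / p)) ^ p := by
        rw [← Real.rpow_mul (by positivity), one_div_mul_cancel hp0.ne', Real.rpow_one]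
    _ ≤ _ := by gcongr

lemma IsMul.add {m₁ m₂ : (Fin d → ℝ) → ℂ} {C₁ C₂ : ℝ} (hp : 1 ≤ p) (h1 : IsMul p m₁ C₁)
    (h2 : IsMul p m₂ C₂) : IsMul p (fun ξ => m₁ ξ + m₂ ξ) (C₁ + C₂) := by
  refine ⟨h1.bdd.add h2.bdd, add_nonneg h1.nonneg h2.nonneg, fun φ hφ M hM hM' => ?_⟩
  simp only [add_mul]
  exact (h1.bound φ hφ M hM hM').add hp (mul_nonneg h1.nonneg hM) (mul_nonneg h2.nonneg hM)
    (h1.bdd.mul hφ) (h2.bdd.mul hφ) (h2.bound φ hφ M hM hM')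

lemma isMul_const (c : ℂ) : IsMul (d := d) p (fun _ => c) ‖c‖ := by
  refine ⟨bddMeas_const c, norm_nonneg _, fun φ _ M hM hM' R => ?_⟩
  simp only [coeffT_const_mul, norm_mul]
  rw [Real.mul_rpow (norm_nonneg _) hM]
  simp only [Real.mul_rpow (norm_nonneg _) (norm_nonneg _), ← Finset.mul_sum]
  gcongr
  exact hM' R

lemma IsMul.sum {ι : Type*} (hp : 1 ≤ p) (s : Finset ι) {m : ι → (Fin d → ℝ) → ℂ} {C : ι → ℝ}
    (h : ∀ i ∈ s, IsMul p (m i) (C i)) :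
    IsMul p (fun ξ => ∑ i ∈ s, m i ξ) (∑ i ∈ s, C i) := by
  classical
  induction s using Finset.induction_on with
  | empty =>
    have := isMul_const (d := d) (p := p) 0
    simpa using this
  | insert i s hi ih =>
    simp only [Finset.sum_insert hi]
    exact (h i (Finset.mem_insert_self _ _)).add hp
      (ih fun j hj => h j (Finset.mem_insert_of_mem hj))

lemma isMul_chiT (k : Fin d → ℤ) : IsMul p (chiT k) 1 := by
  classical
  refine ⟨bddMeas_chiT k, zero_le_one, fun φ _ M hM hM' R => ?_⟩
  simp only [coeffT_chiT_mul, one_mul]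
  have := hM' (R.image fun n => n - k)
  rwa [Finset.sum_image fun a _ b _ h => sub_left_injective h] at this

lemma IsMul.congr {m m' : (Fin d → ℝ) → ℂ} {C : ℝ} (h : IsMul p m C) (hm' : BddMeas m')
    (he : m =ᵐ[volume.restrict (Td d)] m') : IsMul p m' C := by
  refine ⟨hm', h.nonneg, fun φ hφ M hM hM' R => ?_⟩
  have := h.bound φ hφ M hM hM' R
  rwa [coeffT_congr (ψ := fun ξ => m' ξ * φ ξ)] at this
  filter_upwards [he] with ξ hξ
  rw [hξ]

/-- Multipliers are closed under bounded pointwise limits. -/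
lemma IsMul.tendsto {F : ℕ → (Fin d → ℝ) → ℂ} {m : (Fin d → ℝ) → ℂ} {B C : ℝ} (hp : 0 < p)
    (hF : ∀ k, IsMul p (F k) C) (hB : ∀ k ξ, ‖F k ξ‖ ≤ B) (hm : BddMeas m)
    (h : ∀ᵐ ξ ∂volume.restrict (Td d),
      Filter.Tendsto (fun k => F k ξ) Filter.atTop (nhds (m ξ))) : IsMul p m C := by
  refine ⟨hm, (hF 0).nonneg, fun φ hφ M hM hM' R => ?_⟩
  obtain ⟨Bφ, hBφ⟩ := hφ.2
  have hlim := fun x => coeffT_tendsto (F := fun k ξ => F k ξ * φ ξ) (φ := fun ξ => m ξ * φ ξ)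
    (B := B * Bφ) (fun k => (hF k).bdd.1.mul hφ.1)
    (fun k ξ => by
      rw [norm_mul]
      exact mul_le_mul (hB k ξ) (hBφ ξ) (norm_nonneg _) ((norm_nonneg _).trans (hB k ξ)))
    (by filter_upwards [h] with ξ hξ using hξ.mul_const _) x
  refine le_of_tendsto (tendsto_finsetSum R fun x _ => ((hlim x).norm.rpow_const (Or.inr hp.le)))
    (Filter.Eventually.of_forall fun k => (hF k).bound φ hφ M hM hM' R)

/-- Multipliers are closed under integration in a parameter. -/
lemma IsMul.integral {q : ℝ → (Fin d → ℝ) → ℂ} {B C : ℝ → ℝ} (hp : 1 ≤ p)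
    (hq : Measurable (Function.uncurry q)) (hB : ∀ v ξ, ‖q v ξ‖ ≤ B v) (hBi : Integrable B)
    (hC : ∀ v, IsMul p (q v) (C v)) (hCi : Integrable C) :
    IsMul p (fun ξ => ∫ v, q v ξ) (∫ v, C v) := by
  have hp0 : 0 < p := by linarith
  refine ⟨⟨?_, ∫ v, B v, fun ξ => ?_⟩, integral_nonneg fun v => (hC v).nonneg,
    fun φ hφ M hM hM' R => ?_⟩
  · exact (hq.stronglyMeasurable.integral_prod_left' (μ := volume)).measurable
  · exact norm_integral_le_of_norm_le hBi (Filter.Eventually.of_forall fun v => hB v ξ)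
  obtain ⟨Bφ, hBφ⟩ := hφ.2
  have hint : ∀ x : Fin d → ℤ, Integrable (Function.uncurry fun (v : ℝ) (ξ : Fin d → ℝ) =>
      q v ξ * φ ξ * chiT (-x) ξ) (volume.prod (volume.restrict (Td d))) := by
    intro x
    refine Integrable.mono' ((hBi.mul_const Bφ).comp_fst (volume.restrict (Td d)))
      ((hq.mul (hφ.1.comp measurable_snd)).mul
        ((continuous_chiT _).measurable.comp measurable_snd)).aestronglyMeasurable
      (Filter.Eventually.of_forall fun z => ?_)
    simp only [Function.uncurry]
    rw [norm_mul, norm_chiT, mul_one, norm_mul]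
    exact mul_le_mul (hB _ _) (hBφ _) (norm_nonneg _) ((norm_nonneg _).trans (hB z.1 z.2))
  have hco : ∀ x, coeffT (fun ξ => (∫ v, q v ξ) * φ ξ) x =
      ∫ v, coeffT (fun ξ => q v ξ * φ ξ) x := by
    intro x
    simp only [coeffT]
    rw [integral_integral_swap (hint x)]
    congr 1; ext ξ
    rw [← integral_mul_const, ← integral_mul_const]
  have hint2 : ∀ x, Integrable fun v => coeffT (fun ξ => q v ξ * φ ξ) x := fun x =>
    (hint x).integral_prod_left
  set P : ℝ≥0∞ := ENNReal.ofReal p with hP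
  have hPr : P.toReal = p := ENNReal.toReal_ofReal hp0.le
  have : Fact (1 ≤ P) := ⟨by rw [hP, ← ENNReal.ofReal_one]; exact ENNReal.ofReal_le_ofReal hp⟩
  set F : ℝ → PiLp P fun _ : R => ℂ := fun v =>
    WithLp.toLp P fun x : R => coeffT (fun ξ => q v ξ * φ ξ) x with hF
  have hnorm : ∀ a : (Fin d → ℤ) → ℂ, ‖(WithLp.toLp P fun x : R => a x : PiLp P fun _ : R => ℂ)‖ =
      (∑ x ∈ R, ‖a x‖ ^ p) ^ (1 / p) := by
    intro a
    rw [PiLp.norm_eq_sum (by rw [hPr]; exact hp0), hPr]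
    congr 1
    exact Finset.sum_coe_sort R fun x => ‖a x‖ ^ p
  have hFn : ∀ v, ‖F v‖ ≤ C v * M := by
    intro v
    rw [hF, hnorm]
    have h0 : 0 ≤ C v * M := mul_nonneg (hC v).nonneg hM
    calc _ ≤ ((C v * M) ^ p) ^ (1 / p) := by
          gcongr
          exact (hC v).bound φ hφ M hM hM' R
      _ = _ := by rw [← Real.rpow_mul h0, mul_one_div_cancel hp0.ne', Real.rpow_one]
  have h3 := norm_integral_le_of_norm_le (hCi.mul_const M) (Filter.Eventually.of_forall hFn)
  have h4 : ∫ v, F v = WithLp.toLp P fun x : R => coeffT (fun ξ => (∫ v, q v ξ) * φ ξ) x := by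
    ext x
    exact (eval_integral_piLp (f := F) (fun x : R => hint2 x) x).trans (hco x).symm
  rw [h4, hnorm, integral_mul_const] at h3
  calc _ = ((∑ x ∈ R, ‖coeffT (fun ξ => (∫ v, q v ξ) * φ ξ) x‖ ^ p) ^ (1 / p)) ^ p := by
        rw [← Real.rpow_mul (by positivity), one_div_mul_cancel hp0.ne', Real.rpow_one]
    _ ≤ _ := by gcongr

end Torus

section Transference

variable {d : ℕ} {p : ℝ}

lemma CoeffBound.summable {φ : (Fin d → ℝ) → ℂ} {M : ℝ} (h : CoeffBound p φ M) :
    Summable fun x => ‖coeffT φ x‖ ^ p :=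
  summable_of_sum_le (fun _ => by positivity) h

lemma CoeffBound.tsum_le {φ : (Fin d → ℝ) → ℂ} {M : ℝ} (h : CoeffBound p φ M) :
    ∑' x, ‖coeffT φ x‖ ^ p ≤ M ^ p :=
  h.summable.tsum_le_of_sum_le h

lemma CoeffBound.tsum_rpow {φ : (Fin d → ℝ) → ℂ} {M : ℝ} (hp : 0 < p) (h : CoeffBound p φ M) :
    CoeffBound p φ ((∑' x, ‖coeffT φ x‖ ^ p) ^ (1 / p)) := by
  intro R
  rw [← Real.rpow_mul (tsum_nonneg fun _ => by positivity), one_div_mul_cancel hp.ne',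
    Real.rpow_one]
  exact h.summable.sum_le_tsum R fun _ _ => by positivity

/-- Coifman–Weiss transference: a convolution operator on `ℤ` acts on a uniformly bounded group
of multipliers. -/
lemma IsMul.transference {w : (Fin d → ℝ) → ℂ} (hp : 1 ≤ p) (hw : ∀ ξ, w ξ ≠ 0) {N : ℕ} {B D : ℝ}
    (hB : ∀ k : ℤ, |k| ≤ 2 * N → IsMul p (fun ξ => w ξ ^ k) B)
    {K : ℤ → ℂ} (hK : ConvBound K p D) (hD : 0 ≤ D) (hK0 : ∀ n : ℤ, N < |n| → K n = 0) :
    IsMul p (fun ξ => ∑ n ∈ Finset.Icc (-N : ℤ) N, K n * w ξ ^ (-n)) (2 * B ^ 2 * D) := by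
  have hp0 : 0 < p := by linarith
  have hB0 : 0 ≤ B := (hB 0 (by simp)).nonneg
  set T : (Fin d → ℝ) → ℂ := fun ξ => ∑ n ∈ Finset.Icc (-N : ℤ) N, K n * w ξ ^ (-n) with hT
  have hTm : IsMul p T (∑ n ∈ Finset.Icc (-N : ℤ) N, ‖K n‖ * B) := by
    refine IsMul.sum hp _ fun n hn => (isMul_const (K n)).mul (hB (-n) ?_)
    rw [Finset.mem_Icc] at hn
    rw [abs_neg, abs_le]; constructor <;> linarith
  refine ⟨hTm.bdd, by positivity, fun φ hφ M hM hM' R => ?_⟩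
  set a : ℤ → (Fin d → ℤ) → ℂ := fun k => coeffT fun ξ => w ξ ^ k * φ ξ with ha
  set X : ℤ → (Fin d → ℤ) → ℂ := fun m => coeffT fun ξ => w ξ ^ m * (T ξ * φ ξ) with hX
  set I := Finset.Icc (-N : ℤ) N with hI
  set J := Finset.Icc (-(2 * N) : ℤ) (2 * N) with hJ
  have hIcard : (I.card : ℝ) = 2 * N + 1 := by
    have : (I.card : ℤ) = 2 * N + 1 := by rw [hI, Int.card_Icc]; omega
    exact_mod_cast this
  have hJcard : (J.card : ℝ) = 4 * N + 1 := by
    have : (J.card : ℤ) = 4 * N + 1 := by rw [hJ, Int.card_Icc]; omega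
    exact_mod_cast this
  have hIJ : ∀ m ∈ I, |m| ≤ 2 * N := by
    intro m hm
    rw [hI, Finset.mem_Icc] at hm
    rw [abs_le]; constructor <;> linarith
  have hXa : ∀ m ∈ I, ∀ x, X m x = ∑ y ∈ J, K (m - y) * a y x := by
    intro m hm x
    have e1 : ∀ ξ, w ξ ^ m * (T ξ * φ ξ) = ∑ y ∈ J, K (m - y) * (w ξ ^ y * φ ξ) := by
      intro ξ
      have e2 : ∑ y ∈ J, K (m - y) * (w ξ ^ y * φ ξ) =
          ∑ y ∈ I.image (fun n => m - n), K (m - y) * (w ξ ^ y * φ ξ) := by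
        symm
        refine Finset.sum_subset ?_ ?_
        · intro y hy
          rw [Finset.mem_image] at hy
          obtain ⟨n, hn, rfl⟩ := hy
          rw [hI, Finset.mem_Icc] at hn hm
          rw [hJ, Finset.mem_Icc]; constructor <;> linarith
        · intro y _ hy
          have : K (m - y) = 0 := by
            refine hK0 _ ?_
            by_contra! hle
            refine hy (Finset.mem_image.2 ⟨m - y, ?_, by ring⟩)
            rw [hI, Finset.mem_Icc]
            exact abs_le.1 hle
          rw [this, zero_mul]
      rw [e2, Finset.sum_image fun a _ b _ h => sub_right_injective h, hT, Finset.sum_mul,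
        Finset.mul_sum]
      refine Finset.sum_congr rfl fun n _ => ?_
      have e3 : m - (m - n) = n := by ring
      change w ξ ^ m * (K n * w ξ ^ (-n) * φ ξ) = K (m - (m - n)) * (w ξ ^ (m - n) * φ ξ)
      rw [e3, sub_eq_add_neg, zpow_add₀ (hw ξ)]; ring
    simp only [hX, ha, e1]
    rw [coeffT_sum]
    · simp only [coeffT_const_mul]
    · intro y hy
      refine (bddMeas_const _).mul ((hB y ?_).bdd.mul hφ)
      rw [hJ, Finset.mem_Icc] at hy
      exact abs_le.2 hy
  have hXC : ∀ m ∈ I, CoeffBound p (fun ξ => w ξ ^ m * (T ξ * φ ξ)) _ := fun m hm =>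
    (hB m (hIJ m hm)).bound _ (hTm.bdd.mul hφ) _ (mul_nonneg hTm.nonneg hM)
      (hTm.bound φ hφ M hM hM')
  have haC : ∀ k ∈ J, CoeffBound p (fun ξ => w ξ ^ k * φ ξ) (B * M) := fun k hk =>
    (hB k (by rw [hJ, Finset.mem_Icc] at hk; exact abs_le.2 hk)).bound _ hφ _ hM hM'
  set S := ∑ x ∈ R, ‖coeffT (fun ξ => T ξ * φ ξ) x‖ ^ p with hS
  have h1 : ∀ m ∈ I, S ≤ B ^ p * ∑' x, ‖X m x‖ ^ p := by
    intro m hm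
    have := (hB (-m) (by rw [abs_neg]; exact hIJ m hm)).bound _
      ((hB m (hIJ m hm)).bdd.mul (hTm.bdd.mul hφ)) _
      (Real.rpow_nonneg (tsum_nonneg fun _ => by positivity) _) ((hXC m hm).tsum_rpow hp0) R
    rw [Real.mul_rpow hB0 (Real.rpow_nonneg (tsum_nonneg fun _ => by positivity) _),
      ← Real.rpow_mul (tsum_nonneg fun _ => by positivity), one_div_mul_cancel hp0.ne',
      Real.rpow_one] at this
    refine le_of_eq_of_le ?_ this
    refine Finset.sum_congr rfl fun x _ => ?_
    congr 3
    ext ξ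
    rw [← mul_assoc, zpow_neg, inv_mul_cancel₀ (zpow_ne_zero _ (hw ξ)), one_mul]
  have h2 : ∑ m ∈ I, ∑' x, ‖X m x‖ ^ p ≤ D ^ p * ∑ k ∈ J, ∑' x, ‖a k x‖ ^ p := by
    rw [← Summable.tsum_finsetSum fun m hm => (hXC m hm).summable,
      ← Summable.tsum_finsetSum fun k hk => (haC k hk).summable, ← tsum_mul_left]
    refine Summable.tsum_le_tsum (fun x => ?_) (summable_sum fun m hm => (hXC m hm).summable)
      ((summable_sum fun k hk => (haC k hk).summable).mul_left _)
    refine le_of_eq_of_le (Finset.sum_congr rfl fun m hm => ?_) (hK I J fun y => a y x)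
    exact congrArg (fun z => ‖z‖ ^ p) (hXa m hm x)
  have h3 : ∑ k ∈ J, ∑' x, ‖a k x‖ ^ p ≤ (4 * N + 1) * (B * M) ^ p := by
    rw [← hJcard, ← nsmul_eq_mul]
    exact Finset.sum_le_card_nsmul _ _ _ fun k hk => (haC k hk).tsum_le
  have h4 : (2 * N + 1) * S ≤ B ^ p * ∑ m ∈ I, ∑' x, ‖X m x‖ ^ p := by
    rw [← hIcard, ← nsmul_eq_mul, Finset.mul_sum]
    exact Finset.card_nsmul_le_sum _ _ _ h1
  have hN : (0 : ℝ) ≤ N := Nat.cast_nonneg N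
  have h5 : (2 * N + 1) * S ≤ (2 * N + 1) * (2 * (B ^ p * (D ^ p * (B * M) ^ p))) := by
    calc _ ≤ B ^ p * (D ^ p * ((4 * N + 1) * (B * M) ^ p)) := by
          refine h4.trans ?_
          gcongr
          refine h2.trans ?_
          gcongr
      _ = (4 * N + 1) * (B ^ p * (D ^ p * (B * M) ^ p)) := by ring
      _ ≤ (2 * (2 * N + 1)) * (B ^ p * (D ^ p * (B * M) ^ p)) := by
          gcongr; linarith
      _ = _ := by ring
  have h6 := le_of_mul_le_mul_left h5 (by positivity)
  calc S ≤ 2 ^ (1 : ℝ) * (B ^ p * (D ^ p * (B * M) ^ p)) := by rwa [Real.rpow_one]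
    _ ≤ 2 ^ p * (B ^ p * (D ^ p * (B * M) ^ p)) := by
        gcongr; norm_num
    _ = _ := by
        rw [← Real.mul_rpow hD (by positivity), ← Real.mul_rpow hB0 (by positivity),
          ← Real.mul_rpow two_pos.le (by positivity)]
        congr 1; ring

end Transference

lemma tent_nonneg (N : ℕ) (n : ℤ) : 0 ≤ tent N n := by unfold tent; positivity

lemma tent_le_one (N : ℕ) (n : ℤ) : tent N n ≤ 1 := by
  unfold tent
  refine div_le_one_of_le₀ ?_ (Nat.cast_nonneg N)
  have : ((N : ℤ) - |n|).toNat ≤ N := by have := abs_nonneg n; omega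
  exact_mod_cast this

lemma tent_eq_zero {N : ℕ} {n : ℤ} (h : N < |n|) : tent N n = 0 := by
  unfold tent
  rw [show ((N : ℤ) - |n|).toNat = 0 by omega]; simp

lemma tent_eq {N : ℕ} {n : ℤ} (hN : 1 ≤ N) (h : |n| ≤ N) : tent N n = 1 - |(n : ℝ)| / N := by
  have hN' : (N : ℝ) ≠ 0 := by positivity
  have : ((((N : ℤ) - |n|).toNat : ℤ) : ℝ) = N - |(n : ℝ)| := by
    rw [Int.toNat_of_nonneg (by linarith)]; push_cast; ring
  rw [tent, ← Int.cast_natCast (R := ℝ), this]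
  field_simp

lemma tendsto_tent (n : ℤ) : Filter.Tendsto (fun N => tent N n) Filter.atTop (nhds 1) := by
  have h : Filter.Tendsto (fun N : ℕ => 1 - |(n : ℝ)| / N) Filter.atTop (nhds (1 - 0)) :=
    tendsto_const_nhds.sub (tendsto_const_div_atTop_nhds_zero_nat _)
  rw [sub_zero] at h
  refine h.congr' ?_
  filter_upwards [Filter.eventually_ge_atTop (n.natAbs + 1)] with N hN
  rw [tent_eq (by omega) (by rw [← Int.natCast_natAbs]; omega)]

section Base

variable {d : ℕ} {p : ℝ}

lemma chiT_single (j : Fin d) (n : ℤ) (ξ : Fin d → ℝ) :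
    chiT (Pi.single j n) ξ = chi n (ξ j) := by
  rw [chiT, chi]
  congr 2
  rw [Finset.sum_eq_single j]
  · simp
  · intro b _ hb; simp [hb]
  · simp

lemma chi_zpow (n : ℤ) (t : ℝ) : chi (-1) t ^ (-n) = chi n t := by
  rw [chi, chi, ← Complex.exp_int_mul]
  congr 1; push_cast; ring

/-- The imaginary powers of the one-dimensional discrete Laplacian, regularised. -/
lemma exists_isMul_powSymbol (hp : 1 < p) : ∃ C, 0 < C ∧ ∀ z : ℂ, 0 < z.re → z.re ≤ 1 / 2 →
    ∀ j : Fin d, IsMul p (fun ξ : Fin d → ℝ => powSymbol z (ξ j)) (C * (1 + |z.im|) ^ 2) := by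
  obtain ⟨C, hC, hCK⟩ := exists_convBound p hp
  refine ⟨8 * C, by positivity, fun z hz hz2 j => ?_⟩
  set K := coeffI (powSymbol z) with hK
  have hA : 0 < 4 * (1 + |z.im|) ^ 2 := by positivity
  have hconv : ConvBound K p (C * (4 * (1 + |z.im|) ^ 2)) := by
    refine hCK K _ hA ?_ (smoothKernel_powSymbol hz hz2)
    refine (convBound_two_coeffI (powSymbol z) (continuous_powSymbol hz).measurable 2
      (norm_powSymbol_le hz hz2)).mono (by norm_num) (by norm_num) ?_
    nlinarith [abs_nonneg z.im]
  have hsum := summable_coeffI_powSymbol hz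
  have hdom : ∀ N n t, ‖(tent N n : ℂ) * K n * chi n t‖ ≤ ‖K n‖ := by
    intro N n t
    rw [norm_mul, norm_mul, norm_chi, Complex.norm_real, Real.norm_eq_abs,
      abs_of_nonneg (tent_nonneg N n), mul_one]
    exact mul_le_of_le_one_left (norm_nonneg _) (tent_le_one N n)
  set F : ℕ → (Fin d → ℝ) → ℂ := fun k ξ =>
    ∑ n ∈ Finset.Icc (-(k + 1 : ℕ) : ℤ) (k + 1 : ℕ),
      ((tent (k + 1) n : ℂ) * K n) * chi (-1) (ξ j) ^ (-n) with hF
  have hFt : ∀ k ξ, F k ξ = ∑' n, (tent (k + 1) n : ℂ) * K n * chi n (ξ j) := by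
    intro k ξ
    rw [hF, tsum_eq_sum (s := Finset.Icc (-(k + 1 : ℕ) : ℤ) (k + 1 : ℕ))]
    · simp only [chi_zpow]
    · intro n hn
      rw [tent_eq_zero, Complex.ofReal_zero, zero_mul, zero_mul]
      rw [Finset.mem_Icc] at hn
      by_contra! hle
      exact hn (abs_le.1 hle)
  refine IsMul.tendsto (F := F) (B := ∑' n, ‖K n‖) (by linarith) (fun k => ?_) (fun k ξ => ?_)
    ⟨((continuous_powSymbol hz).comp (continuous_apply j)).measurable, 2,
      fun ξ => norm_powSymbol_le hz hz2 _⟩ (Filter.Eventually.of_forall fun ξ => ?_)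
  · have := IsMul.transference (d := d) (w := fun ξ => chi (-1) (ξ j)) hp.le
      (fun ξ => by rw [chi]; exact Complex.exp_ne_zero _) (N := k + 1) (B := 1)
      (fun m _ => by
        have h := isMul_chiT (p := p) (Pi.single j (-m) : Fin d → ℤ)
        have e : (fun ξ : Fin d → ℝ => chi (-1) (ξ j) ^ m) = chiT (Pi.single j (-m)) := by
          ext ξ; rw [chiT_single, ← chi_zpow (-m), neg_neg]
        rwa [e])
      (hconv.tent_mul hp.le (by positivity) (k + 1) (by omega)) (by positivity)
      (fun n hn => by rw [tent_eq_zero hn, Complex.ofReal_zero, zero_mul])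
    exact this.mono (by linarith) (le_of_eq (by ring))
  · rw [hFt]
    exact tsum_of_norm_bounded hsum.hasSum fun n => hdom _ _ _
  · simp only [hFt]
    rw [← (hasSum_powSymbol hz (ξ j)).tsum_eq]
    refine tendsto_tsum_of_dominated_convergence hsum (fun n => ?_)
      (Filter.Eventually.of_forall fun k n => hdom _ _ _)
    have h1 := (Complex.continuous_ofReal.tendsto 1).comp
      ((tendsto_tent n).comp (Filter.tendsto_add_atTop_nat 1))
    have := (h1.mul_const (K n)).mul_const (chi n (ξ j))
    simpa only [Complex.ofReal_one, one_mul, Function.comp_def, hK] using this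

/-- The symbol `4 sin² (π ξ_j)` of the one-dimensional discrete Laplacian. -/
noncomputable def lapSymbol (j : Fin d) (ξ : Fin d → ℝ) : ℝ := 4 * Real.sin (π * ξ j) ^ 2

lemma measurable_lapSymbol (j : Fin d) : Measurable (lapSymbol j) := by
  unfold lapSymbol; fun_prop

lemma ae_lapSymbol_pos (j : Fin d) : ∀ᵐ ξ ∂volume.restrict (Td d), 0 < lapSymbol j ξ := by
  have h0 : ∀ᵐ t : ℝ, t ≠ 0 := by
    rw [ae_iff]; simp
  have h1 : ∀ᵐ ξ : Fin d → ℝ, ξ j ≠ 0 :=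
    (Measure.tendsto_eval_ae_ae (μ := fun _ : Fin d => (volume : Measure ℝ)) (i := j)).eventually h0
  filter_upwards [ae_restrict_of_ae h1, ae_restrict_mem (MeasurableSet.univ_pi fun _ => measurableSet_Icc)]
    with ξ hξ hξT
  have hj := hξT j (Set.mem_univ _)
  rw [Set.mem_Icc] at hj
  have : Real.sin (π * ξ j) ≠ 0 := by
    intro h
    rw [Real.sin_eq_zero_iff_of_lt_of_lt] at h
    · exact hξ (by simpa [Real.pi_ne_zero] using h)
    · nlinarith [Real.pi_pos]
    · nlinarith [Real.pi_pos]
  unfold lapSymbol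
  positivity

/-- A real symbol whose unimodular functions `e^{iux}` are multipliers of polynomially bounded
norm. -/
def PolyGroup (p : ℝ) (x : (Fin d → ℝ) → ℝ) : Prop :=
  Measurable x ∧ ∃ (C : ℝ) (k : ℕ), 0 ≤ C ∧
    ∀ u : ℝ, IsMul p (fun ξ => Complex.exp (Complex.I * (u * x ξ : ℝ))) (C * (1 + |u|) ^ k)

lemma polyGroup_log_lapSymbol (hp : 1 < p) (j : Fin d) :
    PolyGroup p fun ξ => Real.log (lapSymbol j ξ) := by
  obtain ⟨C, hC, h⟩ := exists_isMul_powSymbol (d := d) hp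
  have hmeas : Measurable fun ξ => Real.log (lapSymbol j ξ) := (measurable_lapSymbol j).log
  refine ⟨hmeas, C, 2, hC.le, fun u => ?_⟩
  set z : ℕ → ℂ := fun k => ((1 / (k + 2) : ℝ) : ℂ) + u * Complex.I with hz
  have hre : ∀ k, (z k).re = 1 / (k + 2) := fun k => by
    rw [hz, Complex.add_re, Complex.ofReal_re]; simp
  have him : ∀ k, (z k).im = u := fun k => by
    rw [hz, Complex.add_im, Complex.ofReal_im]; simp
  have hpos : ∀ k, 0 < (z k).re := fun k => by rw [hre]; positivity
  have hle : ∀ k, (z k).re ≤ 1 / 2 := fun k => by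
    rw [hre]
    exact one_div_le_one_div_of_le two_pos (by linarith [(Nat.cast_nonneg k : (0 : ℝ) ≤ k)])
  refine IsMul.tendsto (F := fun k ξ => powSymbol (z k) (ξ j)) (B := 2) (by linarith)
    (fun k => ?_) (fun k ξ => norm_powSymbol_le (hpos k) (hle k) _) ⟨?_, 1, fun ξ => ?_⟩ ?_
  · have := h (z k) (hpos k) (hle k) j
    rwa [him] at this
  · fun_prop
  · exact (Complex.norm_exp_I_mul_ofReal _).le
  · filter_upwards [ae_lapSymbol_pos j] with ξ hξ
    have hs : (0 : ℝ) < |2 * Real.sin (π * ξ j)| := by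
      rw [abs_pos]; intro h0
      unfold lapSymbol at hξ
      nlinarith
    have hlog : Real.log (lapSymbol j ξ) = 2 * Real.log |2 * Real.sin (π * ξ j)| := by
      rw [lapSymbol, show 4 * Real.sin (π * ξ j) ^ 2 = |2 * Real.sin (π * ξ j)| ^ 2 by
        rw [sq_abs]; ring, Real.log_pow]
      norm_num
    have e : ∀ w : ℂ, powSymbol w (ξ j) = Complex.exp (w * (Real.log (lapSymbol j ξ) : ℝ)) := by
      intro w
      rw [powSymbol, Complex.cpow_def_of_ne_zero (by exact_mod_cast hs.ne'),
        ← Complex.ofReal_log hs.le, hlog]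
      congr 1; push_cast; ring
    simp only [e]
    have hzl : Filter.Tendsto z Filter.atTop (nhds (u * Complex.I)) := by
      have h1 : Filter.Tendsto (fun k : ℕ => (1 / ((k : ℝ) + 2))) Filter.atTop (nhds 0) := by
        have := (tendsto_one_div_add_atTop_nhds_zero_nat (𝕜 := ℝ)).comp (Filter.tendsto_add_atTop_nat 1)
        refine this.congr fun k => ?_
        simp only [Function.comp_apply]; push_cast; ring_nf
      have h2 := ((Complex.continuous_ofReal.tendsto 0).comp h1).add_const (u * Complex.I)
      simpa only [Complex.ofReal_zero, zero_add, Function.comp_def] using h2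
    have := (Complex.continuous_exp.tendsto _).comp
      (hzl.mul_const ((Real.log (lapSymbol j ξ) : ℝ) : ℂ))
    refine this.trans (le_of_eq ?_)
    congr 2; push_cast; ring

lemma PolyGroup.const_mul {x : (Fin d → ℝ) → ℝ} (hp : 0 < p) (h : PolyGroup p x) (c : ℝ) :
    PolyGroup p fun ξ => c * x ξ := by
  obtain ⟨hm, C, k, hC, hx⟩ := h
  refine ⟨hm.const_mul c, C * (1 + |c|) ^ k, k, by positivity, fun u => ?_⟩
  have := (hx (u * c)).mono hp (C' := C * (1 + |c|) ^ k * (1 + |u|) ^ k) ?_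
  · simpa only [mul_assoc] using this
  · rw [mul_assoc, ← mul_pow, abs_mul]
    gcongr
    nlinarith [abs_nonneg c, abs_nonneg u]

lemma PolyGroup.add {x y : (Fin d → ℝ) → ℝ} (hx : PolyGroup p x) (hy : PolyGroup p y) :
    PolyGroup p fun ξ => x ξ + y ξ := by
  obtain ⟨hm, C, k, hC, hx⟩ := hx
  obtain ⟨hm', C', k', hC', hy⟩ := hy
  refine ⟨hm.add hm', C * C', k + k', by positivity, fun u => ?_⟩
  have := (hx u).mul (hy u)
  simp only [← Complex.exp_add, ← mul_add, ← Complex.ofReal_add] at this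
  rwa [show C * C' * (1 + |u|) ^ (k + k') = C * (1 + |u|) ^ k * (C' * (1 + |u|) ^ k') by ring]

lemma PolyGroup.sub {x y : (Fin d → ℝ) → ℝ} (hp : 0 < p) (hx : PolyGroup p x)
    (hy : PolyGroup p y) : PolyGroup p fun ξ => x ξ - y ξ := by
  simpa only [neg_one_mul, ← sub_eq_add_neg] using hx.add (hy.const_mul hp (-1))

lemma PolyGroup.congr {x y : (Fin d → ℝ) → ℝ} (hx : PolyGroup p x) (hy : Measurable y)
    (h : x =ᵐ[volume.restrict (Td d)] y) : PolyGroup p y := by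
  obtain ⟨_, C, k, hC, hx⟩ := hx
  refine ⟨hy, C, k, hC, fun u => (hx u).congr ⟨by fun_prop, 1, fun ξ => ?_⟩ ?_⟩
  · exact (Complex.norm_exp_I_mul_ofReal _).le
  · filter_upwards [h] with ξ hξ
    rw [hξ]

end Base

lemma tendsto_riemannSum {G : ℝ → ℝ} (hG : Continuous G) :
    Filter.Tendsto (fun N : ℕ => (∑ n ∈ Finset.range N, G (n / N)) / N) Filter.atTop
      (nhds (∫ v in (0 : ℝ)..1, G v)) := by
  rw [Metric.tendsto_atTop]
  intro ε hε
  have huc := isCompact_Icc.uniformContinuousOn_of_continuous (hG.continuousOn (s := Set.Icc 0 1))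
  rw [Metric.uniformContinuousOn_iff] at huc
  obtain ⟨δ, hδ, hGδ⟩ := huc (ε / 2) (by positivity)
  obtain ⟨N₀, hN₀⟩ := exists_nat_one_div_lt hδ
  refine ⟨N₀ + 1, fun N hN => ?_⟩
  have hNpos : (0 : ℝ) < N := by
    have : 0 < N := by omega
    exact_mod_cast this
  have hNδ : 1 / (N : ℝ) < δ := by
    refine lt_of_le_of_lt (one_div_le_one_div_of_le (by positivity) ?_) hN₀
    exact_mod_cast hN
  have hsum := intervalIntegral.sum_integral_adjacent_intervals (f := G) (μ := volume)
    (a := fun n : ℕ => (n : ℝ) / N) (n := N) fun k _ => hG.intervalIntegrable _ _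
  simp only [Nat.cast_zero, zero_div, div_self hNpos.ne'] at hsum
  have hstep : ∀ n : ℕ, ((n + 1 : ℕ) : ℝ) / N - n / N = 1 / N := fun n => by
    push_cast; ring
  rw [dist_eq_norm, ← hsum, Finset.sum_div, ← Finset.sum_sub_distrib]
  have hterm : ∀ n ∈ Finset.range N,
      ‖G (n / N) / N - ∫ v in (n / N : ℝ)..((n + 1 : ℕ) : ℝ) / N, G v‖ ≤ ε / 2 * (1 / N) := by
    intro n hn
    have hn' : ((n + 1 : ℕ) : ℝ) ≤ N := by exact_mod_cast Finset.mem_range.1 hn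
    have e : G (n / N) / N = ∫ v in (n / N : ℝ)..((n + 1 : ℕ) : ℝ) / N, G (n / N) := by
      rw [intervalIntegral.integral_const, hstep, smul_eq_mul]; ring
    rw [e, ← intervalIntegral.integral_sub (by simp) (hG.intervalIntegrable _ _)]
    have hle : (n / N : ℝ) ≤ ((n + 1 : ℕ) : ℝ) / N := by
      have := hstep n
      have : 0 < 1 / (N : ℝ) := by positivity
      linarith
    have := intervalIntegral.norm_integral_le_of_norm_le_const (a := (n / N : ℝ))
      (b := ((n + 1 : ℕ) : ℝ) / N) (f := fun v => G (n / N) - G v) (C := ε / 2) ?_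
    · rwa [hstep, abs_of_pos (by positivity)] at this
    · intro v hv
      rw [Set.uIoc_of_le hle] at hv
      have h1 : ((n + 1 : ℕ) : ℝ) / N ≤ 1 := by rw [div_le_one hNpos]; exact hn'
      have h0 : (0 : ℝ) ≤ n / N := by positivity
      rw [← dist_eq_norm]
      refine (hGδ _ ⟨h0, hle.trans h1⟩ _ ⟨h0.trans hv.1.le, hv.2.trans h1⟩ ?_).le
      rw [Real.dist_eq, abs_sub_comm, abs_of_nonneg (by linarith [hv.1])]
      have := hstep n
      linarith [hv.2]
  calc _ ≤ ∑ n ∈ Finset.range N, ε / 2 * (1 / N) := norm_sum_le_of_le _ hterm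
    _ = ε / 2 := by
      rw [Finset.sum_const, Finset.card_range, nsmul_eq_mul]; field_simp
    _ < ε := by linarith

lemma sum_Icc_neg_self (f : ℤ → ℂ) (M : ℕ) : ∑ n ∈ Finset.Icc (-M : ℤ) M, f n =
    f 0 + ∑ n ∈ Finset.range M, (f (n + 1) + f (-(n + 1))) := by
  induction M with
  | zero => simp
  | succ M ih =>
    have : Finset.Icc (-(M + 1 : ℕ) : ℤ) (M + 1 : ℕ) =
        insert ((M : ℤ) + 1) (insert (-((M : ℤ) + 1)) (Finset.Icc (-M : ℤ) M)) := by
      ext n; simp only [Finset.mem_insert, Finset.mem_Icc]; omega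
    rw [this, Finset.sum_insert, Finset.sum_insert, ih, Finset.sum_range_succ]
    · ring
    · simp only [Finset.mem_Icc]; omega
    · simp only [Finset.mem_insert, Finset.mem_Icc]; omega

lemma mul_sinc (a : ℝ) : a * Real.sinc a = Real.sin a := by
  by_cases h : a = 0
  · simp [h]
  · rw [Real.sinc_of_ne_zero h]; field_simp

/-- The integrand of the primitive of the Fejér kernel. -/
noncomputable def fejerIntegrand (t v : ℝ) : ℝ := (1 - v) * (2 * t * Real.sinc (2 * π * v * t))

lemma continuous_fejerIntegrand : Continuous (Function.uncurry fejerIntegrand) := by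
  unfold fejerIntegrand Function.uncurry
  have := Real.continuous_sinc
  fun_prop

/-- The primitive of the Fejér kernel. -/
noncomputable def fejerPrimitive (t : ℝ) : ℝ := ∫ v in (0 : ℝ)..1, fejerIntegrand t v

/-- Truncated Hilbert kernel evaluated on the character `e^{2πit/N}`. -/
lemma sum_tent_hilbert {N : ℕ} (hN : 1 ≤ N) (t : ℝ) :
    Complex.I / (2 * π) * ∑ n ∈ Finset.Icc (-N : ℤ) N, ((tent N n : ℂ) * (n : ℂ)⁻¹) *
      Complex.exp (Complex.I * (2 * π / N * t : ℝ)) ^ (-n) =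
    (((∑ n ∈ Finset.range N, fejerIntegrand t (n / N)) / N - 2 * t / N : ℝ) : ℂ) := by
  have hN0 : (N : ℝ) ≠ 0 := by positivity
  have e1 : ∑ n ∈ Finset.range N, fejerIntegrand t (n / N) - 2 * t =
      ∑ n ∈ Finset.range N, fejerIntegrand t ((n + 1 : ℕ) / N) := by
    have h1 := Finset.sum_range_succ (fun n : ℕ => fejerIntegrand t (n / N)) N
    rw [Finset.sum_range_succ'] at h1
    have h2 : fejerIntegrand t ((N : ℝ) / N) = 0 := by
      rw [div_self hN0]; simp [fejerIntegrand]
    have h3 : fejerIntegrand t (((0 : ℕ) : ℝ) / N) = 2 * t := by simp [fejerIntegrand]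
    rw [h2, h3] at h1
    linarith
  rw [← sub_div, e1, sum_Icc_neg_self, Finset.sum_div, Complex.ofReal_sum, mul_add, Finset.mul_sum]
  simp only [Int.cast_zero, inv_zero, mul_zero, zero_mul, zero_add]
  refine Finset.sum_congr rfl fun n hn => ?_
  have hn' : n + 1 ≤ N := Finset.mem_range.1 hn
  have hk : (((n : ℤ) + 1 : ℤ) : ℂ) ≠ 0 := by
    have : ((n : ℤ) + 1 : ℤ) ≠ 0 := by omega
    exact_mod_cast this
  set k : ℝ := ((n + 1 : ℕ) : ℝ) with hkdef
  have hk0 : 0 < k := by positivity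
  have ht1 : tent N ((n : ℤ) + 1) = 1 - k / N := by
    rw [tent_eq hN (by rw [abs_of_nonneg (by omega)]; omega)]
    congr 2
    rw [abs_of_nonneg (by positivity), hkdef]; push_cast; ring
  have ht2 : tent N (-((n : ℤ) + 1)) = 1 - k / N := by
    rw [← ht1, tent, tent, abs_neg]
  set θ : ℝ := 2 * π * (k / N) * t with hθ
  have hG : fejerIntegrand t (k / N) / N = (1 - k / N) * (Real.sin θ / (π * k)) := by
    rw [fejerIntegrand, ← mul_sinc θ, ← hθ]
    have := Real.pi_ne_zero
    rw [hθ]; field_simp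
  have hw1 : Complex.exp (Complex.I * (2 * π / N * t : ℝ)) ^ (-((n : ℤ) + 1)) =
      Complex.exp (-(θ : ℂ) * Complex.I) := by
    rw [← Complex.exp_int_mul, hθ, hkdef]; congr 1; push_cast; ring
  have hw2 : Complex.exp (Complex.I * (2 * π / N * t : ℝ)) ^ (- -((n : ℤ) + 1)) =
      Complex.exp ((θ : ℂ) * Complex.I) := by
    rw [← Complex.exp_int_mul, hθ, hkdef]; congr 1; push_cast; ring
  rw [hG, ht1, ht2, hw1, hw2]
  push_cast
  rw [Complex.sin]
  have hkc : (k : ℂ) = (n : ℂ) + 1 := by rw [hkdef]; push_cast; ring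
  have hkc0 : (n : ℂ) + 1 ≠ 0 := by rw [← hkc]; exact_mod_cast hk0.ne'
  have hNc : (N : ℂ) ≠ 0 := by exact_mod_cast hN0
  have hπ : (π : ℂ) ≠ 0 := by exact_mod_cast Real.pi_ne_zero
  have hneg : (-1 + -(n : ℂ)) = -((n : ℂ) + 1) := by ring
  rw [hkc, neg_mul, inv_neg]
  field_simp
  ring

section FejerMultiplier

variable {d : ℕ} {p : ℝ}

lemma IsMul.norm_le_of_const {c : ℂ} {C : ℝ} (hp : 0 < p)
    (h : IsMul (d := 0) p (fun _ => c) C) : ‖c‖ ≤ C := by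
  have h1 : ∀ (z : ℂ) (n : Fin 0 → ℤ), coeffT (fun _ => z) n = z := by
    intro z n
    simp [coeffT, chiT]
  have := h.bound (fun _ => 1) (bddMeas_const 1) 1 zero_le_one (fun R => ?_) {0}
  · simp only [mul_one, Finset.sum_singleton, h1] at this
    exact (Real.rpow_le_rpow_iff (norm_nonneg _) h.nonneg hp).1 this
  · simp only [h1, norm_one, Real.one_rpow, Finset.sum_const, nsmul_eq_mul, mul_one]
    exact_mod_cast Finset.card_le_one_of_subsingleton R

lemma exists_isMul_fejerPrimitive {x : (Fin d → ℝ) → ℝ} (hp : 1 < p) (hx : PolyGroup p x) :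
    ∃ C, IsMul p (fun ξ => (fejerPrimitive (x ξ) : ℂ)) C := by
  obtain ⟨D, hD, hconv⟩ := exists_convBound_hilbert p hp
  obtain ⟨hxm, C, k, hC, hx⟩ := hx
  have hp0 : 0 < p := by linarith
  set T : ℕ → ℝ → ℂ := fun N t => ∑ n ∈ Finset.Icc (-N : ℤ) N,
    ((tent N n : ℂ) * (n : ℂ)⁻¹) * Complex.exp (Complex.I * (2 * π / N * t : ℝ)) ^ (-n) with hT
  have hpow : ∀ (N : ℕ) (t : ℝ) (m : ℤ), Complex.exp (Complex.I * (2 * π / N * t : ℝ)) ^ m =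
      Complex.exp (Complex.I * ((2 * π / N * m) * t : ℝ)) := fun N t m => by
    rw [← Complex.exp_int_mul]; congr 1; push_cast; ring
  have hKc : ∀ N, 1 ≤ N → ConvBound (fun n => (tent N n : ℂ) * (n : ℂ)⁻¹) p D := fun N hN =>
    hconv.tent_mul hp.le hD.le N hN
  have hK0 : ∀ (N : ℕ) (n : ℤ), N < |n| → (tent N n : ℂ) * (n : ℂ)⁻¹ = 0 := fun N n hn => by
    rw [tent_eq_zero hn, Complex.ofReal_zero, zero_mul]
  have hTbdd : ∀ N, 1 ≤ N → ∀ t, ‖T N t‖ ≤ 2 * D := by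
    intro N hN t
    have := IsMul.transference (d := 0) (p := p)
      (w := fun _ => Complex.exp (Complex.I * (2 * π / N * t : ℝ))) hp.le
      (fun _ => Complex.exp_ne_zero _) (N := N) (B := 1) (fun m _ => ?_) (hKc N hN) hD.le (hK0 N)
    · exact (this.norm_le_of_const hp0).trans (by linarith)
    · have h1 := isMul_const (d := 0) (p := p) (Complex.exp (Complex.I * (2 * π / N * t : ℝ)) ^ m)
      rwa [norm_zpow, Complex.norm_exp_I_mul_ofReal, one_zpow] at h1
  set B : ℝ := C * (1 + 4 * π) ^ k with hB
  have hTmul : ∀ N, 1 ≤ N → IsMul p (fun ξ => T N (x ξ)) (2 * B ^ 2 * D) := by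
    intro N hN
    refine IsMul.transference (w := fun ξ => Complex.exp (Complex.I * (2 * π / N * x ξ : ℝ)))
      hp.le (fun _ => Complex.exp_ne_zero _) (fun m hm => ?_) (hKc N hN) hD.le (hK0 N)
    simp only [hpow]
    refine (hx _).mono hp0 ?_
    rw [hB]
    have hNpos : (0 : ℝ) < N := by exact_mod_cast hN
    have hm' : |(m : ℝ)| ≤ 2 * N := by exact_mod_cast hm
    gcongr
    rw [abs_mul, abs_of_nonneg (by positivity), div_mul_eq_mul_div, div_le_iff₀ hNpos]
    nlinarith [Real.pi_pos]
  set c : ℂ := Complex.I / (2 * π) with hc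
  have hlim : ∀ t, Filter.Tendsto (fun N : ℕ => c * T (N + 1) t) Filter.atTop
      (nhds (fejerPrimitive t : ℂ)) := by
    intro t
    have h1 : Filter.Tendsto (fun N : ℕ => (∑ n ∈ Finset.range N, fejerIntegrand t (n / N)) / N -
        2 * t / N) Filter.atTop (nhds (fejerPrimitive t - 0)) :=
      (tendsto_riemannSum (continuous_fejerIntegrand.uncurry_left t)).sub
        (tendsto_const_div_atTop_nhds_zero_nat _)
    rw [sub_zero] at h1
    have h2 := ((Complex.continuous_ofReal.tendsto _).comp h1).comp
      (Filter.tendsto_add_atTop_nat 1)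
    refine h2.congr fun N => ?_
    exact (sum_tent_hilbert (N := N + 1) (by omega) t).symm
  have hcont : Continuous fejerPrimitive :=
    intervalIntegral.continuous_parametric_intervalIntegral_of_continuous'
      continuous_fejerIntegrand 0 1
  have hbd : ∀ (N : ℕ) t, ‖c * T (N + 1) t‖ ≤ ‖c‖ * (2 * D) := fun N t => by
    rw [norm_mul]
    exact mul_le_mul_of_nonneg_left (hTbdd _ (by omega) t) (norm_nonneg _)
  refine ⟨‖c‖ * (2 * B ^ 2 * D), IsMul.tendsto (F := fun N ξ => c * T (N + 1) (x ξ))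
    (B := ‖c‖ * (2 * D)) hp0 (fun N => (isMul_const c).mul (hTmul _ (by omega)))
    (fun N ξ => hbd N _) ⟨?_, ‖c‖ * (2 * D), fun ξ => ?_⟩
    (Filter.Eventually.of_forall fun ξ => hlim _)⟩
  · exact Complex.measurable_ofReal.comp (hcont.measurable.comp hxm)
  · exact le_of_tendsto (hlim (x ξ)).norm (Filter.Eventually.of_forall fun N => hbd N _)

end FejerMultiplier

/-- The kernel `∫₀ᵗ e^{2πivs} ds` (with value `0` at `v = 0`). -/
noncomputable def primKernel (v t : ℝ) : ℂ :=
  (Complex.exp (Complex.I * (2 * π * v * t : ℝ)) + -1) / (2 * π * v * Complex.I)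

lemma norm_two_pi_mul_I (v : ℝ) : ‖(2 * π * v * Complex.I : ℂ)‖ = 2 * π * |v| := by
  rw [norm_mul, norm_mul, norm_mul, Complex.norm_I, Complex.norm_real, Complex.norm_real,
    Real.norm_eq_abs, Real.norm_eq_abs, abs_of_pos Real.pi_pos]
  simp

lemma norm_primKernel_le (v t : ℝ) : ‖primKernel v t‖ ≤ |t| := by
  rw [primKernel, norm_div, norm_two_pi_mul_I, ← sub_eq_add_neg]
  refine div_le_of_le_mul₀ (by positivity) (abs_nonneg t) ?_
  refine (Real.norm_exp_I_mul_ofReal_sub_one_le).trans (le_of_eq ?_)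
  rw [Real.norm_eq_abs, abs_mul, abs_mul, abs_of_pos Real.two_pi_pos]; ring

lemma measurable_primKernel {α : Type*} [MeasurableSpace α] {f g : α → ℝ} (hf : Measurable f)
    (hg : Measurable g) : Measurable fun a => primKernel (f a) (g a) := by
  unfold primKernel
  fun_prop

/-- The Fejér window. -/
noncomputable def fejerWindow (v : ℝ) : ℝ := max (1 - |v|) 0

lemma continuous_fejerWindow : Continuous fejerWindow := by unfold fejerWindow; fun_prop

lemma fejerWindow_of_le {v : ℝ} (h : |v| ≤ 1) : fejerWindow v = 1 - |v| :=
  max_eq_left (by linarith)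

lemma fejerWindow_of_ge {v : ℝ} (h : 1 ≤ |v|) : fejerWindow v = 0 :=
  max_eq_right (by linarith)

lemma integrable_fejerWindow_mul (t : ℝ) :
    Integrable fun v => (fejerWindow v : ℂ) * primKernel v t := by
  have h1 : Integrable fun v => fejerWindow v * |t| := by
    refine (continuous_fejerWindow.integrable_of_hasCompactSupport ?_).mul_const _
    refine HasCompactSupport.intro (isCompact_Icc (a := (-1 : ℝ)) (b := 1)) fun v hv => ?_
    refine fejerWindow_of_ge ?_
    by_contra! h
    exact hv (abs_le.1 h.le)
  refine h1.mono' ?_ (Filter.Eventually.of_forall fun v => ?_)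
  · exact ((Complex.measurable_ofReal.comp continuous_fejerWindow.measurable).mul
      (measurable_primKernel measurable_id measurable_const)).aestronglyMeasurable
  · rw [norm_mul, Complex.norm_real, Real.norm_eq_abs, abs_of_nonneg (le_max_right _ _)]
    exact mul_le_mul_of_nonneg_left (norm_primKernel_le v t) (le_max_right _ _)

lemma integral_fejerWindow_mul (t : ℝ) :
    ∫ v, (fejerWindow v : ℂ) * primKernel v t = fejerPrimitive t := by
  have hi := integrable_fejerWindow_mul t
  have hi' := hi.comp_neg
  rw [← intervalIntegral.integral_Iic_add_Ioi (b := 0) hi.integrableOn hi.integrableOn,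
    ← neg_zero, ← integral_comp_neg_Ioi 0 fun v => (fejerWindow v : ℂ) * primKernel v t, neg_zero,
    ← integral_add hi'.integrableOn hi.integrableOn, fejerPrimitive,
    intervalIntegral.integral_of_le zero_le_one, ← integral_complex_ofReal]
  symm
  rw [setIntegral_eq_of_subset_of_forall_sdiff_eq_zero (s := Set.Ioc 0 1) (t := Set.Ioi 0)
    measurableSet_Ioi (fun v hv => hv.1)]
  · refine setIntegral_congr_fun measurableSet_Ioc fun v hv => ?_
    have hv0 : (v : ℂ) ≠ 0 := by exact_mod_cast hv.1.ne'
    have hπ : (π : ℂ) ≠ 0 := by exact_mod_cast Real.pi_ne_zero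
    have e : fejerIntegrand t v = (1 - v) * (Real.sin (2 * π * v * t) / (π * v)) := by
      rw [fejerIntegrand, ← mul_sinc]
      have := Real.pi_ne_zero
      have := hv.1.ne'
      field_simp
    have h1 : fejerWindow v = 1 - v := by
      rw [fejerWindow_of_le] <;> rw [abs_of_pos hv.1]; exact hv.2
    have h2 : fejerWindow (-v) = 1 - v := by rw [← h1, fejerWindow, fejerWindow, abs_neg]
    simp only [primKernel, e, h1, h2]
    push_cast
    rw [Complex.sin]
    rw [show Complex.I * (2 * π * v * t) = 2 * π * v * t * Complex.I by ring,
      show Complex.I * (2 * π * -v * t) = -(2 * π * v * t) * Complex.I by ring]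
    field_simp
    ring_nf
    rw [Complex.I_sq]
    ring
  · intro v hv
    have h1 : 1 ≤ |v| := by
      by_contra! h
      exact hv.2 ⟨hv.1, (le_abs_self v).trans h.le⟩
    rw [fejerWindow_of_ge h1, fejerWindow_of_ge (by rwa [abs_neg])]; simp

lemma norm_sub_fejerWindow_le {g : ℝ → ℂ} {E C₀ : ℝ} {k : ℕ} (hC₀ : 0 ≤ C₀)
    (hgE : ∀ v, ‖g v‖ * (1 + |v|) ^ (k + 2) ≤ E) (hgL : ∀ v, ‖g v - g 0‖ ≤ E * |v|) (v : ℝ) :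
    ‖(g v - g 0 * fejerWindow v) / (2 * π * v * Complex.I)‖ * (C₀ * (1 + |2 * π * v|) ^ k + 2) ≤
      2 * (C₀ * (1 + 2 * π) ^ k + 2) * E * (1 + v ^ 2)⁻¹ := by
  set A : ℝ := C₀ * (1 + 2 * π) ^ k + 2 with hA
  have hA0 : 0 < A := by positivity
  have hg0 : ‖g 0‖ ≤ E := by simpa using hgE 0
  have hE : 0 ≤ E := (norm_nonneg _).trans hg0
  rcases eq_or_ne v 0 with rfl | hv0
  · simp only [Complex.ofReal_zero, mul_zero, zero_mul, div_zero, norm_zero]; positivity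
  have hv : 0 < |v| := abs_pos.2 hv0
  rw [norm_div, norm_two_pi_mul_I, abs_mul, abs_of_pos Real.two_pi_pos]
  have hπ := Real.pi_gt_three
  rw [← div_eq_mul_inv, le_div_iff₀ (by positivity), div_mul_eq_mul_div, div_mul_eq_mul_div,
    div_le_iff₀ (by positivity)]
  have hsq : v ^ 2 = |v| ^ 2 := (sq_abs v).symm
  rcases le_or_gt |v| 1 with h | h
  · have h1 : ‖(g v - g 0 * fejerWindow v)‖ ≤ 2 * E * |v| := by
      have e : (g v - g 0 * fejerWindow v) = (g v - g 0) + g 0 * (|v| : ℝ) := by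
        rw [fejerWindow_of_le h]; push_cast; ring
      rw [e]
      refine (norm_add_le _ _).trans ?_
      rw [norm_mul, Complex.norm_real, Real.norm_eq_abs, abs_abs]
      nlinarith [hgL v]
    have h2 : C₀ * (1 + 2 * π * |v|) ^ k + 2 ≤ A := by
      have : 2 * π * |v| ≤ 2 * π := mul_le_of_le_one_right Real.two_pi_pos.le h
      rw [hA]
      gcongr
    calc _ ≤ (2 * E * |v|) * A * (1 + 1) := by
          gcongr
          rw [hsq]; nlinarith
      _ ≤ 2 * A * E * (2 * π * |v|) := by
          have : 0 ≤ A * E * |v| := by positivity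
          nlinarith
  · have e : (g v - g 0 * fejerWindow v) = g v := by rw [fejerWindow_of_ge h.le]; simp
    rw [e]
    have h2 : C₀ * (1 + 2 * π * |v|) ^ k + 2 ≤ A * (1 + |v|) ^ k := by
      have h3 : (1 + 2 * π * |v|) ^ k ≤ (1 + 2 * π) ^ k * (1 + |v|) ^ k := by
        rw [← mul_pow]
        gcongr
        nlinarith
      have h4 : 1 ≤ (1 + |v|) ^ k := one_le_pow₀ (by linarith)
      rw [hA]
      nlinarith [mul_le_mul_of_nonneg_left h3 hC₀]
    calc _ ≤ ‖g v‖ * (A * (1 + |v|) ^ k) * (1 + |v|) ^ 2 := by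
          gcongr
          rw [hsq]; nlinarith
      _ = A * (‖g v‖ * (1 + |v|) ^ (k + 2)) := by ring
      _ ≤ A * E := by gcongr; exact hgE v
      _ ≤ 2 * A * E * (2 * π * |v|) := by
          have : 0 ≤ A * E := by positivity
          have : 1 ≤ 2 * (2 * π * |v|) := by nlinarith
          nlinarith

section PrimMultiplier

variable {d : ℕ} {p : ℝ}

/-- Primitives of functions with decaying, Lipschitz Fourier transform act on polynomially bounded
groups of multipliers. -/
lemma exists_isMul_integral_primKernel {x : (Fin d → ℝ) → ℝ} (hp : 1 < p) (hx : PolyGroup p x) :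
    ∃ (k : ℕ) (C : ℝ), 0 < C ∧ ∀ g : ℝ → ℂ, Measurable g → ∀ E : ℝ,
      (∀ v, ‖g v‖ * (1 + |v|) ^ (k + 2) ≤ E) → (∀ v, ‖g v - g 0‖ ≤ E * |v|) →
      IsMul p (fun ξ => ∫ v, g v * primKernel v (x ξ)) (C * E) := by
  obtain ⟨CF, hCF⟩ := exists_isMul_fejerPrimitive hp hx
  obtain ⟨hxm, C₀, k, hC₀, hx⟩ := hx
  have hp0 : 0 < p := by linarith
  set A : ℝ := C₀ * (1 + 2 * π) ^ k + 2 with hA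
  have hA0 : 0 < A := by positivity
  set J : ℝ := ∫ v : ℝ, (1 + v ^ 2)⁻¹ with hJ
  have hJ0 : 0 ≤ J := integral_nonneg fun v => by positivity
  refine ⟨k, 2 * A * J + CF + 1, by have := hCF.nonneg; positivity, fun g hg E hgE hgL => ?_⟩
  have hg0 : ‖g 0‖ ≤ E := by simpa using hgE 0
  have hE : 0 ≤ E := (norm_nonneg _).trans hg0
  set r : ℝ → ℂ := fun v => g v - g 0 * fejerWindow v with hr
  have hrm : Measurable r :=
    hg.sub (measurable_const.mul (Complex.measurable_ofReal.comp continuous_fejerWindow.measurable))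
  have key : ∀ v, ‖r v / (2 * π * v * Complex.I)‖ * (C₀ * (1 + |2 * π * v|) ^ k + 2) ≤
      2 * A * E * (1 + v ^ 2)⁻¹ := norm_sub_fejerWindow_le hC₀ hgE hgL
  have hform : ∀ v t, r v * primKernel v t = r v / (2 * π * v * Complex.I) *
      (Complex.exp (Complex.I * (2 * π * v * t : ℝ)) + -1) := fun v t => by
    rw [primKernel]; ring
  have hbound : ∀ v t, ‖r v * primKernel v t‖ ≤ 2 * A * E * (1 + v ^ 2)⁻¹ := by
    intro v t
    refine le_trans ?_ (key v)
    rw [hform, norm_mul]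
    gcongr
    refine (norm_add_le _ _).trans ?_
    rw [Complex.norm_exp_I_mul_ofReal, norm_neg, norm_one]
    have : 0 ≤ C₀ * (1 + |2 * π * v|) ^ k := by positivity
    linarith
  have hint : Integrable fun v : ℝ => 2 * A * E * (1 + v ^ 2)⁻¹ :=
    integrable_inv_one_add_sq.const_mul _
  have hmain : IsMul p (fun ξ => ∫ v, r v * primKernel v (x ξ))
      (∫ v : ℝ, 2 * A * E * (1 + v ^ 2)⁻¹) := by
    have hk : Measurable fun z : ℝ × (Fin d → ℝ) => primKernel z.1 (x z.2) :=
      measurable_primKernel measurable_fst (hxm.comp measurable_snd)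
    have hqm : Measurable (Function.uncurry fun (v : ℝ) ξ => r v * primKernel v (x ξ)) := by
      rw [Function.uncurry_def]
      exact (hrm.comp measurable_fst).mul hk
    refine IsMul.integral (q := fun v ξ => r v * primKernel v (x ξ))
      (B := fun v => 2 * A * E * (1 + v ^ 2)⁻¹) (C := fun v => 2 * A * E * (1 + v ^ 2)⁻¹)
      hp.le hqm (fun v ξ => hbound v (x ξ)) hint (fun v => ?_) hint
    · simp only [hform]
      have h1 := (isMul_const (d := d) (p := p) (r v / (2 * π * v * Complex.I))).mul
        ((hx (2 * π * v)).add hp.le (isMul_const (-1)))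
      refine h1.mono hp0 (le_trans ?_ (key v))
      refine mul_le_mul_of_nonneg_left ?_ (norm_nonneg _)
      rw [norm_neg, norm_one]; linarith
  have htot : (fun ξ => ∫ v, g v * primKernel v (x ξ)) = fun ξ =>
      (∫ v, r v * primKernel v (x ξ)) + g 0 * fejerPrimitive (x ξ) := by
    ext ξ
    rw [← integral_fejerWindow_mul, ← integral_const_mul, ← integral_add]
    · refine integral_congr_ae (Filter.Eventually.of_forall fun v => ?_)
      simp only [hr]; ring
    · exact hint.mono' ((hrm.mul (measurable_primKernel
        measurable_id measurable_const)).aestronglyMeasurable)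
        (Filter.Eventually.of_forall fun v => hbound v _)
    · exact (integrable_fejerWindow_mul _).const_mul _
  rw [htot]
  refine (hmain.add hp.le ((isMul_const (g 0)).mul hCF)).mono hp0 ?_
  rw [integral_const_mul, ← hJ]
  have := mul_le_mul_of_nonneg_right hg0 hCF.nonneg
  nlinarith

end PrimMultiplier

section

open scoped FourierTransform

lemma norm_fourier_le {h : ℝ → ℂ} {b : ℝ → ℝ} (hb : Integrable b) (h1 : ∀ t, ‖h t‖ ≤ b t) (v : ℝ) :
    ‖𝓕 h v‖ ≤ ∫ t, b t := by
  rw [Real.fourier_real_eq_integral_exp_smul]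
  refine norm_integral_le_of_norm_le hb (Filter.Eventually.of_forall fun t => ?_)
  rw [norm_smul, Complex.norm_exp_ofReal_mul_I, one_mul]
  exact h1 t

lemma integrable_exp_smul {h : ℝ → ℂ} (hi : Integrable h) (v : ℝ) :
    Integrable fun t : ℝ => Complex.exp (↑(-2 * π * t * v) * Complex.I) • h t := by
  refine hi.mono ?_ (Filter.Eventually.of_forall fun t => ?_)
  · have hc : Continuous fun t : ℝ => Complex.exp (↑(-2 * π * t * v) * Complex.I) := by fun_prop
    exact hc.aestronglyMeasurable.smul hi.1
  · rw [norm_smul, Complex.norm_exp_ofReal_mul_I, one_mul]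

lemma fourier_add_const_mul {f g : ℝ → ℂ} (hf : Integrable f) (hg : Integrable g) (c : ℂ) (v : ℝ) :
    𝓕 (fun t => f t + c * g t) v = 𝓕 f v + c * 𝓕 g v := by
  simp only [Real.fourier_real_eq_integral_exp_smul]
  rw [← integral_const_mul, ← integral_add (integrable_exp_smul hf v)
    ((integrable_exp_smul hg v).const_mul c)]
  congr 1 with t
  simp only [smul_eq_mul]
  ring

lemma norm_fourier_sub_zero_le {h : ℝ → ℂ} {b : ℝ → ℝ} (hi : Integrable h)
    (hb : Integrable fun t => |t| * b t) (h1 : ∀ t, ‖h t‖ ≤ b t) (v : ℝ) :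
    ‖𝓕 h v - 𝓕 h 0‖ ≤ 2 * π * (∫ t, |t| * b t) * |v| := by
  simp only [Real.fourier_real_eq_integral_exp_smul]
  rw [← integral_sub (integrable_exp_smul hi v) (integrable_exp_smul hi 0)]
  calc _ ≤ ∫ t, 2 * π * |v| * (|t| * b t) := by
        refine norm_integral_le_of_norm_le (hb.const_mul _) (Filter.Eventually.of_forall fun t => ?_)
        rw [← sub_smul, norm_smul, mul_zero, Complex.ofReal_zero, zero_mul, Complex.exp_zero,
          mul_comm _ Complex.I]
        have h2 : ‖Complex.exp (Complex.I * (-2 * π * t * v : ℝ)) - 1‖ ≤ 2 * π * |v| * |t| := by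
          refine (Real.norm_exp_I_mul_ofReal_sub_one_le).trans (le_of_eq ?_)
          rw [Real.norm_eq_abs, abs_mul, abs_mul, abs_mul, abs_of_pos Real.pi_pos]
          simp; ring
        calc _ ≤ (2 * π * |v| * |t|) * b t :=
              mul_le_mul h2 (h1 t) (norm_nonneg _) (by positivity)
          _ = _ := by ring
    _ = _ := by rw [integral_const_mul]; ring

/-- Fourier inversion, integrated from `0` to `t`. -/
lemma intervalIntegral_eq_integral_fourier {h : ℝ → ℂ} (hc : Continuous h) (hi : Integrable h)
    (hF : Integrable (𝓕 h)) (t : ℝ) :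
    ∫ s in (0 : ℝ)..t, h s = ∫ v, 𝓕 h v * primKernel v t := by
  have hinv : ∀ s, h s = ∫ v : ℝ, Complex.exp ((2 * π * v : ℝ) * Complex.I * s) * 𝓕 h v := by
    intro s
    have := congrFun (hc.fourierInv_fourier_eq hi hF) s
    rw [← this, Real.fourierInv_eq']
    congr 1 with v
    simp only [smul_eq_mul, RCLike.inner_apply, conj_trivial]
    congr 2
    push_cast
    ring
  have hI : ∀ s v : ℝ, ‖Complex.exp ((2 * π * v : ℝ) * Complex.I * s) * 𝓕 h v‖ = ‖𝓕 h v‖ := by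
    intro s v
    rw [norm_mul, show ((2 * π * v : ℝ) : ℂ) * Complex.I * s = ((2 * π * v * s : ℝ) : ℂ) * Complex.I by
      push_cast; ring, Complex.norm_exp_ofReal_mul_I, one_mul]
  simp_rw [hinv]
  rw [intervalIntegral_integral_swap]
  · refine integral_congr_ae ?_
    filter_upwards [compl_mem_ae_iff.2 (measure_singleton (0 : ℝ))] with v hv
    have hv : v ≠ 0 := hv
    have hv' : ((2 * π * v : ℝ) : ℂ) * Complex.I ≠ 0 :=
      mul_ne_zero (Complex.ofReal_ne_zero.2 (mul_ne_zero Real.two_pi_pos.ne' hv)) Complex.I_ne_zero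
    rw [intervalIntegral.integral_mul_const, integral_exp_mul_complex hv', primKernel, mul_comm]
    congr 1
    push_cast
    rw [mul_zero, Complex.exp_zero, sub_eq_add_neg]
    congr 3
    ring
  · have h2 : Integrable (fun z : ℝ × ℝ => ‖𝓕 h z.2‖)
        ((volume.restrict (Set.uIoc 0 t)).prod volume) := by
      have : IsFiniteMeasure (volume.restrict (Set.uIoc 0 t)) :=
        ⟨by simp [Set.uIoc]⟩
      exact hF.norm.comp_snd _
    refine h2.mono' ?_ (Filter.Eventually.of_forall fun z => (hI z.1 z.2).le)
    refine AEStronglyMeasurable.mul (Continuous.aestronglyMeasurable (by fun_prop)) ?_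
    exact hF.1.comp_snd

end

section

open scoped FourierTransform

/-- The softplus function `log (1 + eᵗ)`, a primitive of the sigmoid. -/
noncomputable def softplus (t : ℝ) : ℝ := Real.log (1 + Real.exp t)

lemma hasDerivAt_softplus (t : ℝ) : HasDerivAt softplus (Real.sigmoid t) t := by
  have h := ((Real.hasDerivAt_exp t).const_add 1).log (by positivity)
  refine h.congr_deriv ?_
  rw [Real.sigmoid_def, Real.exp_neg]
  field_simp
  ring

lemma continuous_softplus : Continuous softplus :=
  continuous_iff_continuousAt.2 fun t => (hasDerivAt_softplus t).continuousAt

lemma softplus_neg (t : ℝ) : softplus (-t) = softplus t - t := by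
  unfold softplus
  rw [eq_sub_iff_add_eq]
  nth_rw 2 [← Real.log_exp t]
  rw [← Real.log_mul (by positivity) (by positivity), add_mul, ← Real.exp_add]
  simp [add_comm]

/-- The logistic density. -/
noncomputable def logisticDensity (t : ℝ) : ℝ := Real.sigmoid t * (1 - Real.sigmoid t)

lemma logisticDensity_nonneg (t : ℝ) : 0 ≤ logisticDensity t :=
  mul_nonneg (Real.sigmoid_nonneg t) (by linarith [Real.sigmoid_le_one t])

lemma continuous_logisticDensity : Continuous logisticDensity :=
  continuous_sigmoid.mul (continuous_const.sub continuous_sigmoid)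

lemma logisticDensity_le_exp (t : ℝ) : logisticDensity t ≤ Real.exp (-|t|) := by
  have key : ∀ u : ℝ, Real.sigmoid u ≤ Real.exp u := by
    intro u
    rw [Real.sigmoid_def, ← one_div, div_le_iff₀ (by positivity), mul_add, mul_one, ← Real.exp_add]
    simp [(Real.exp_pos u).le]
  rw [logisticDensity, ← Real.sigmoid_neg]
  rcases le_total 0 t with h | h
  · rw [abs_of_nonneg h]
    exact (mul_le_of_le_one_left (Real.sigmoid_nonneg _) (Real.sigmoid_le_one _)).trans (key _)
  · rw [abs_of_nonpos h, neg_neg]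
    exact (mul_le_of_le_one_right (Real.sigmoid_nonneg _) (Real.sigmoid_le_one _)).trans (key _)

lemma one_add_abs_mul_logisticDensity_le (t : ℝ) :
    (1 + |t|) * logisticDensity t ≤ 6 * Real.exp 1 * (1 + t ^ 2)⁻¹ := by
  have h1 := Real.pow_div_factorial_le_exp (x := 1 + |t|) (by positivity) 3
  have h2 := logisticDensity_le_exp t
  rw [← div_eq_mul_inv, le_div_iff₀ (by positivity)]
  rw [div_le_iff₀ (by positivity), Real.exp_add] at h1
  rw [show ((Nat.factorial 3 : ℕ) : ℝ) = 6 by norm_num [Nat.factorial]] at h1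
  have h3 : Real.exp |t| * Real.exp (-|t|) = 1 := by rw [← Real.exp_add]; simp
  have h4 : 1 + t ^ 2 ≤ (1 + |t|) ^ 2 := by rw [← sq_abs t]; nlinarith [abs_nonneg t]
  calc (1 + |t|) * logisticDensity t * (1 + t ^ 2)
      ≤ (1 + |t|) * Real.exp (-|t|) * (1 + |t|) ^ 2 := by gcongr
    _ = (1 + |t|) ^ 3 * Real.exp (-|t|) := by ring
    _ ≤ (Real.exp 1 * Real.exp |t| * 6) * Real.exp (-|t|) := by gcongr
    _ = 6 * Real.exp 1 * (Real.exp |t| * Real.exp (-|t|)) := by ring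
    _ = _ := by rw [h3, mul_one]

lemma integrable_logisticDensity : Integrable logisticDensity := by
  refine (integrable_inv_one_add_sq.const_mul (6 * Real.exp 1)).mono'
    continuous_logisticDensity.aestronglyMeasurable (Filter.Eventually.of_forall fun t => ?_)
  rw [Real.norm_eq_abs, abs_of_nonneg (logisticDensity_nonneg t)]
  refine le_trans ?_ (one_add_abs_mul_logisticDensity_le t)
  nlinarith [logisticDensity_nonneg t, abs_nonneg t]

lemma integrable_abs_mul_logisticDensity : Integrable fun t => |t| * logisticDensity t := by
  refine (integrable_inv_one_add_sq.const_mul (6 * Real.exp 1)).mono'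
    (continuous_abs.mul continuous_logisticDensity).aestronglyMeasurable
    (Filter.Eventually.of_forall fun t => ?_)
  rw [Real.norm_eq_abs, abs_of_nonneg (mul_nonneg (abs_nonneg t) (logisticDensity_nonneg t))]
  refine le_trans ?_ (one_add_abs_mul_logisticDensity_le t)
  nlinarith [logisticDensity_nonneg t, abs_nonneg t]

/-- The logistic density weighted by `Q(σ)` and by the oscillation `exp (i u log (1 + eᵗ))`. -/
noncomputable def logisticWave (Q : Polynomial ℂ) (u t : ℝ) : ℂ :=
  (logisticDensity t : ℂ) * Q.eval (Real.sigmoid t : ℂ) *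
    Complex.exp (Complex.I * (u * softplus t : ℝ))

lemma continuous_logisticWave (Q : Polynomial ℂ) (u : ℝ) : Continuous (logisticWave Q u) := by
  have h1 := continuous_logisticDensity
  have h2 := continuous_sigmoid
  have h3 := continuous_softplus
  have h4 : Continuous fun t => Q.eval (Real.sigmoid t : ℂ) := by fun_prop
  unfold logisticWave
  fun_prop

lemma exists_norm_logisticWave_le (Q : Polynomial ℂ) : ∃ B, 0 ≤ B ∧ ∀ u t,
    ‖logisticWave Q u t‖ ≤ B * logisticDensity t := by
  obtain ⟨B, hB⟩ := (isCompact_Icc (a := (0 : ℝ)) (b := 1)).exists_bound_of_continuousOn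
    (f := fun x : ℝ => Q.eval (x : ℂ)) (by fun_prop)
  refine ⟨B, (norm_nonneg _).trans (hB 0 (by simp)), fun u t => ?_⟩
  rw [logisticWave, mul_comm Complex.I, norm_mul, norm_mul, Complex.norm_exp_ofReal_mul_I, mul_one,
    mul_comm, Complex.norm_real, Real.norm_eq_abs, abs_of_nonneg (logisticDensity_nonneg t)]
  exact mul_le_mul_of_nonneg_right (hB _ ⟨Real.sigmoid_nonneg t, Real.sigmoid_le_one t⟩)
    (logisticDensity_nonneg t)

lemma integrable_logisticWave (Q : Polynomial ℂ) (u : ℝ) : Integrable (logisticWave Q u) := by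
  obtain ⟨B, -, hB⟩ := exists_norm_logisticWave_le Q
  exact (integrable_logisticDensity.const_mul B).mono'
    (continuous_logisticWave Q u).aestronglyMeasurable (Filter.Eventually.of_forall (hB u))

open Polynomial in
lemma hasDerivAt_logisticWave (Q : Polynomial ℂ) (u t : ℝ) :
    HasDerivAt (logisticWave Q u)
      (logisticWave ((1 - 2 * X) * Q + X * (1 - X) * derivative Q) u t +
        (Complex.I * u) * logisticWave (X * Q) u t) t := by
  have hσ : HasDerivAt (fun t => (Real.sigmoid t : ℂ))
      ((Real.sigmoid t * (1 - Real.sigmoid t) : ℝ) : ℂ) t := (hasDerivAt_sigmoid t).ofReal_comp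
  have hw : HasDerivAt (fun t => (Real.sigmoid t : ℂ) * (1 - Real.sigmoid t)) _ t :=
    hσ.mul (hσ.const_sub 1)
  have hQ : HasDerivAt (fun t => Q.eval (Real.sigmoid t : ℂ)) _ t :=
    HasDerivAt.comp (h₂ := fun z => Q.eval z) t (Q.hasDerivAt (Real.sigmoid t : ℂ)) hσ
  have hℓ : HasDerivAt (fun t => Complex.exp (Complex.I * ((u * softplus t : ℝ) : ℂ))) _ t :=
    ((((hasDerivAt_softplus t).const_mul u).ofReal_comp).const_mul Complex.I).cexp
  have h := (hw.mul hQ).mul hℓ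
  have he : logisticWave Q u = fun t => (Real.sigmoid t : ℂ) * (1 - Real.sigmoid t) *
      Q.eval (Real.sigmoid t : ℂ) * Complex.exp (Complex.I * (u * softplus t : ℝ)) := by
    ext t; simp [logisticWave, logisticDensity]
  rw [he]
  refine h.congr_deriv ?_
  simp [logisticWave, logisticDensity]
  ring

lemma exists_pow_mul_norm_fourier_logisticWave_le (j : ℕ) : ∀ Q : Polynomial ℂ, ∃ C, 0 ≤ C ∧
    ∀ u v : ℝ, (2 * π * |v|) ^ j * ‖𝓕 (logisticWave Q u) v‖ ≤ C * (1 + |u|) ^ j := by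
  induction j with
  | zero =>
    intro Q
    obtain ⟨B, hB0, hB⟩ := exists_norm_logisticWave_le Q
    refine ⟨∫ t, B * logisticDensity t,
      integral_nonneg fun t => mul_nonneg hB0 (logisticDensity_nonneg t), fun u v => ?_⟩
    rw [pow_zero, pow_zero, one_mul, mul_one]
    exact norm_fourier_le (integrable_logisticDensity.const_mul B) (hB u) v
  | succ j ih =>
    intro Q
    obtain ⟨C₁, h1, hC1⟩ := ih ((1 - 2 * .X) * Q + .X * (1 - .X) * Q.derivative)
    obtain ⟨C₂, h2, hC2⟩ := ih (.X * Q)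
    refine ⟨C₁ + C₂, by positivity, fun u v => ?_⟩
    have hd : deriv (logisticWave Q u) = fun t =>
        logisticWave ((1 - 2 * .X) * Q + .X * (1 - .X) * Q.derivative) u t +
          (Complex.I * u) * logisticWave (.X * Q) u t :=
      funext fun t => (hasDerivAt_logisticWave Q u t).deriv
    have hF := congrFun (Real.fourier_deriv (integrable_logisticWave Q u)
      (fun t => (hasDerivAt_logisticWave Q u t).differentiableAt)
      (hd ▸ (integrable_logisticWave _ u).add ((integrable_logisticWave _ u).const_mul _))) v
    rw [hd, fourier_add_const_mul (integrable_logisticWave _ u) (integrable_logisticWave _ u)] at hF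
    have hn : 2 * π * |v| * ‖𝓕 (logisticWave Q u) v‖ ≤
        ‖𝓕 (logisticWave ((1 - 2 * .X) * Q + .X * (1 - .X) * Q.derivative) u) v‖ +
          |u| * ‖𝓕 (logisticWave (.X * Q) u) v‖ := by
      have := congrArg norm hF
      rw [norm_smul, show (2 * π * Complex.I * v : ℂ) = 2 * π * v * Complex.I by ring,
        norm_two_pi_mul_I] at this
      rw [← this]
      refine (norm_add_le _ _).trans (le_of_eq ?_)
      simp
    have hv : 0 ≤ 2 * π * |v| := by positivity
    calc (2 * π * |v|) ^ (j + 1) * ‖𝓕 (logisticWave Q u) v‖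
        = (2 * π * |v|) ^ j * (2 * π * |v| * ‖𝓕 (logisticWave Q u) v‖) := by ring
      _ ≤ (2 * π * |v|) ^ j * _ := mul_le_mul_of_nonneg_left hn (by positivity)
      _ = (2 * π * |v|) ^ j *
            ‖𝓕 (logisticWave ((1 - 2 * .X) * Q + .X * (1 - .X) * Q.derivative) u) v‖ +
          |u| * ((2 * π * |v|) ^ j * ‖𝓕 (logisticWave (.X * Q) u) v‖) := by ring
      _ ≤ C₁ * (1 + |u|) ^ j + |u| * (C₂ * (1 + |u|) ^ j) :=
        add_le_add (hC1 u v) (mul_le_mul_of_nonneg_left (hC2 u v) (abs_nonneg u))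
      _ ≤ (C₁ + C₂) * (1 + |u|) ^ (j + 1) := by
        have h5 : 0 ≤ (1 + |u|) ^ j := by positivity
        rw [pow_succ]
        nlinarith [mul_nonneg h1 h5, mul_nonneg h2 h5, abs_nonneg u,
          mul_nonneg (mul_nonneg h1 h5) (abs_nonneg u), mul_nonneg (mul_nonneg h2 h5) (abs_nonneg u)]

end

section

open scoped FourierTransform

lemma exists_norm_fourier_logisticWave_mul_le (Q : Polynomial ℂ) (n : ℕ) : ∃ C, 0 ≤ C ∧
    ∀ u v : ℝ, ‖𝓕 (logisticWave Q u) v‖ * (1 + |v|) ^ n ≤ C * (1 + |u|) ^ n := by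
  obtain ⟨C₀, h0, hC0⟩ := exists_pow_mul_norm_fourier_logisticWave_le 0 Q
  obtain ⟨C₁, h1, hC1⟩ := exists_pow_mul_norm_fourier_logisticWave_le n Q
  refine ⟨2 ^ n * (C₀ + C₁), by positivity, fun u v => ?_⟩
  have hA := hC0 u v
  rw [pow_zero, pow_zero, one_mul, mul_one] at hA
  have hB : |v| ^ n * ‖𝓕 (logisticWave Q u) v‖ ≤ C₁ * (1 + |u|) ^ n := by
    refine le_trans ?_ (hC1 u v)
    gcongr
    nlinarith [Real.pi_gt_three, abs_nonneg v]
  have hu : 1 ≤ (1 + |u|) ^ n := one_le_pow₀ (by linarith [abs_nonneg u])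
  have hv : (1 + |v|) ^ n ≤ 2 ^ n * (1 + |v| ^ n) := by
    calc (1 + |v|) ^ n ≤ (2 * max 1 |v|) ^ n := by
          gcongr
          linarith [le_max_left 1 |v|, le_max_right 1 |v|]
      _ = 2 ^ n * (max 1 |v|) ^ n := mul_pow _ _ _
      _ ≤ _ := by
          gcongr
          rcases max_cases 1 |v| with h | h <;> rw [h.1]
          · rw [one_pow]; linarith [pow_nonneg (abs_nonneg v) n]
          · linarith
  calc ‖𝓕 (logisticWave Q u) v‖ * (1 + |v|) ^ n
      ≤ ‖𝓕 (logisticWave Q u) v‖ * (2 ^ n * (1 + |v| ^ n)) := by gcongr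
    _ = 2 ^ n * (‖𝓕 (logisticWave Q u) v‖ + |v| ^ n * ‖𝓕 (logisticWave Q u) v‖) := by ring
    _ ≤ 2 ^ n * (C₀ * (1 + |u|) ^ n + C₁ * (1 + |u|) ^ n) := by
        gcongr
        exact hA.trans (le_mul_of_one_le_right h0 hu)
    _ = _ := by ring

lemma continuous_fourier_logisticWave (Q : Polynomial ℂ) (u : ℝ) :
    Continuous (𝓕 (logisticWave Q u)) :=
  VectorFourier.fourierIntegral_continuous Real.continuous_fourierChar
    (L := innerₗ ℝ) continuous_inner (integrable_logisticWave Q u)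

lemma integrable_fourier_logisticWave (Q : Polynomial ℂ) (u : ℝ) :
    Integrable (𝓕 (logisticWave Q u)) := by
  obtain ⟨C, hC0, hC⟩ := exists_norm_fourier_logisticWave_mul_le Q 2
  refine (integrable_inv_one_add_sq.const_mul (C * (1 + |u|) ^ 2)).mono'
    (continuous_fourier_logisticWave Q u).aestronglyMeasurable
    (Filter.Eventually.of_forall fun v => ?_)
  rw [← div_eq_mul_inv, le_div_iff₀ (by positivity)]
  refine le_trans ?_ (hC u v)
  gcongr
  rw [← sq_abs v]
  nlinarith [abs_nonneg v]

/-- The part of `exp (i u log (1 + eᵗ))` that decays at `+∞`. -/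
noncomputable def softplusWave (u t : ℝ) : ℂ :=
  (1 - Real.sigmoid t : ℝ) * Complex.exp (Complex.I * (u * softplus t : ℝ))

lemma hasDerivAt_softplusWave (u t : ℝ) :
    HasDerivAt (softplusWave u) ((Complex.I * u) * logisticWave 1 u t - logisticWave 1 u t) t := by
  have hσ : HasDerivAt (fun t => ((1 - Real.sigmoid t : ℝ) : ℂ)) _ t :=
    ((hasDerivAt_sigmoid t).const_sub 1).ofReal_comp
  have hℓ : HasDerivAt (fun t => Complex.exp (Complex.I * ((u * softplus t : ℝ) : ℂ))) _ t :=
    ((((hasDerivAt_softplus t).const_mul u).ofReal_comp).const_mul Complex.I).cexp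
  refine (hσ.mul hℓ).congr_deriv ?_
  simp [logisticWave, logisticDensity]
  ring

lemma softplusWave_eq (u t : ℝ) : softplusWave u t =
    softplusWave u 0 + (Complex.I * u + -1) * ∫ v, 𝓕 (logisticWave 1 u) v * primKernel v t := by
  have hc := continuous_logisticWave 1 u
  rw [← intervalIntegral_eq_integral_fourier hc (integrable_logisticWave 1 u)
    (integrable_fourier_logisticWave 1 u), ← intervalIntegral.integral_const_mul]
  have h := intervalIntegral.integral_eq_sub_of_hasDerivAt (a := 0) (b := t)
    (fun s _ => hasDerivAt_softplusWave u s) (Continuous.intervalIntegrable (by fun_prop) _ _)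
  rw [eq_comm, ← eq_sub_iff_add_eq', ← h]
  congr 1 with s
  ring

lemma exp_softplus_eq (u t : ℝ) : Complex.exp (Complex.I * (u * softplus t : ℝ)) =
    softplusWave u t + Complex.exp (Complex.I * (u * t : ℝ)) * softplusWave u (-t) := by
  rw [softplusWave, softplusWave, softplus_neg, Real.sigmoid_neg, mul_left_comm, ← Complex.exp_add,
    show Complex.I * (u * t : ℝ) + Complex.I * (u * (softplus t - t) : ℝ) =
      Complex.I * (u * softplus t : ℝ) by push_cast; ring]
  push_cast
  ring

lemma norm_softplusWave_le (u t : ℝ) : ‖softplusWave u t‖ ≤ 1 := by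
  rw [softplusWave, norm_mul, mul_comm Complex.I, Complex.norm_exp_ofReal_mul_I, mul_one,
    Complex.norm_real, Real.norm_eq_abs, abs_le]
  constructor <;> linarith [Real.sigmoid_nonneg t, Real.sigmoid_le_one t]

variable {d : ℕ} {p : ℝ}

lemma exists_isMul_softplusWave {x : (Fin d → ℝ) → ℝ} (hp : 1 < p) (hx : PolyGroup p x) :
    ∃ (C : ℝ) (k : ℕ), 0 ≤ C ∧
      ∀ u : ℝ, IsMul p (fun ξ => softplusWave u (x ξ)) (C * (1 + |u|) ^ k) := by
  obtain ⟨k, C, hC, H⟩ := exists_isMul_integral_primKernel hp hx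
  obtain ⟨E₁, hE1, h1⟩ := exists_norm_fourier_logisticWave_mul_le 1 (k + 2)
  obtain ⟨B, hB0, hB⟩ := exists_norm_logisticWave_le 1
  have hbi : Integrable fun t => |t| * (B * logisticDensity t) := by
    simpa only [mul_left_comm] using integrable_abs_mul_logisticDensity.const_mul B
  set E₂ : ℝ := 2 * π * ∫ t, |t| * (B * logisticDensity t) with hE₂
  have hE2 : 0 ≤ E₂ := mul_nonneg Real.two_pi_pos.le (integral_nonneg fun t =>
    mul_nonneg (abs_nonneg t) (mul_nonneg hB0 (logisticDensity_nonneg t)))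
  refine ⟨1 + C * (E₁ + E₂), k + 3, by positivity, fun u => ?_⟩
  have hu : 1 ≤ 1 + |u| := by linarith [abs_nonneg u]
  have hI := H (𝓕 (logisticWave 1 u)) (continuous_fourier_logisticWave 1 u).measurable
    ((E₁ + E₂) * (1 + |u|) ^ (k + 2)) (fun v => (h1 u v).trans (by gcongr; linarith))
    (fun v => (norm_fourier_sub_zero_le (integrable_logisticWave 1 u) hbi (hB u) v).trans
      (mul_le_mul_of_nonneg_right ((show E₂ ≤ E₁ + E₂ by linarith).trans
        (le_mul_of_one_le_right (by positivity) (one_le_pow₀ hu))) (abs_nonneg v)))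
  have hM := (isMul_const (d := d) (p := p) (softplusWave u 0)).add hp.le
    ((isMul_const (Complex.I * u + -1)).mul hI)
  simp only [← softplusWave_eq] at hM
  refine hM.mono (by linarith) ?_
  have hn : ‖Complex.I * u + -1‖ ≤ 1 + |u| := by
    refine (norm_add_le _ _).trans (le_of_eq ?_)
    simp [add_comm]
  calc _ ≤ 1 + (1 + |u|) * (C * ((E₁ + E₂) * (1 + |u|) ^ (k + 2))) :=
        add_le_add (norm_softplusWave_le u 0) (mul_le_mul_of_nonneg_right hn (by positivity))
    _ = 1 + C * (E₁ + E₂) * (1 + |u|) ^ (k + 3) := by ring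
    _ ≤ _ := by
        rw [add_mul, one_mul]
        gcongr
        exact one_le_pow₀ hu

lemma PolyGroup.softplus {x : (Fin d → ℝ) → ℝ} (hp : 1 < p) (hx : PolyGroup p x) :
    PolyGroup p fun ξ => softplus (x ξ) := by
  obtain ⟨C₁, k₁, h1, H1⟩ := exists_isMul_softplusWave hp hx
  obtain ⟨C₂, k₂, h2, H2⟩ := exists_isMul_softplusWave hp (hx.const_mul (by linarith) (-1))
  obtain ⟨hm, C₃, k₃, h3, H3⟩ := hx
  refine ⟨continuous_softplus.measurable.comp hm, C₁ + C₃ * C₂, k₁ + (k₃ + k₂), by positivity,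
    fun u => ?_⟩
  have hu : 1 ≤ 1 + |u| := by linarith [abs_nonneg u]
  have h := (H1 u).add hp.le ((H3 u).mul (H2 u))
  simp only [neg_one_mul, ← exp_softplus_eq] at h
  refine h.mono (by linarith) ?_
  calc C₁ * (1 + |u|) ^ k₁ + C₃ * (1 + |u|) ^ k₃ * (C₂ * (1 + |u|) ^ k₂)
      = C₁ * (1 + |u|) ^ k₁ + C₃ * C₂ * (1 + |u|) ^ (k₃ + k₂) := by ring
    _ ≤ C₁ * (1 + |u|) ^ (k₁ + (k₃ + k₂)) + C₃ * C₂ * (1 + |u|) ^ (k₁ + (k₃ + k₂)) :=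
        add_le_add (mul_le_mul_of_nonneg_left (pow_le_pow_right₀ hu (by omega)) h1)
          (mul_le_mul_of_nonneg_left (pow_le_pow_right₀ hu (by omega)) (by positivity))
    _ = _ := by ring

lemma PolyGroup.log_add {a b : (Fin d → ℝ) → ℝ} (hp : 1 < p) (hma : Measurable a)
    (hmb : Measurable b) (ha : ∀ᵐ ξ ∂volume.restrict (Td d), 0 < a ξ)
    (hb : ∀ᵐ ξ ∂volume.restrict (Td d), 0 < b ξ)
    (hA : PolyGroup p fun ξ => Real.log (a ξ)) (hB : PolyGroup p fun ξ => Real.log (b ξ)) :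
    PolyGroup p fun ξ => Real.log (a ξ + b ξ) := by
  refine (hB.add ((hA.sub (by linarith) hB).softplus hp)).congr
    (Real.measurable_log.comp (hma.add hmb)) ?_
  filter_upwards [ha, hb] with ξ h1 h2
  unfold _root_.softplus
  rw [← Real.log_div h1.ne' h2.ne', Real.exp_log (div_pos h1 h2),
    ← Real.log_mul h2.ne' (by positivity)]
  congr 1
  field_simp
  ring

lemma PolyGroup.log_sum {ι : Type*} {s : Finset ι} (hs : s.Nonempty) {a : ι → (Fin d → ℝ) → ℝ}
    (hp : 1 < p) (hm : ∀ i, Measurable (a i))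
    (ha : ∀ i, ∀ᵐ ξ ∂volume.restrict (Td d), 0 < a i ξ)
    (hA : ∀ i, PolyGroup p fun ξ => Real.log (a i ξ)) :
    PolyGroup p fun ξ => Real.log (∑ i ∈ s, a i ξ) := by
  suffices h : (∀ᵐ ξ ∂volume.restrict (Td d), 0 < ∑ i ∈ s, a i ξ) ∧
      PolyGroup p fun ξ => Real.log (∑ i ∈ s, a i ξ) from h.2
  induction hs using Finset.Nonempty.cons_induction with
  | singleton i => simpa using ⟨ha i, hA i⟩
  | cons i s hi hs ih =>
    simp only [Finset.sum_cons]
    refine ⟨?_, PolyGroup.log_add hp (hm i) (Finset.measurable_fun_sum s fun j _ => hm j) (ha i)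
      ih.1 (hA i) ih.2⟩
    filter_upwards [ha i, ih.1] with ξ h1 h2 using add_pos h1 h2

end

section

open scoped FourierTransform SchwartzMap

variable {d : ℕ} {p : ℝ}

lemma PolyGroup.exists_isMul_schwartz {x : (Fin d → ℝ) → ℝ} (hp : 1 ≤ p) (hx : PolyGroup p x)
    (F : 𝓢(ℝ, ℂ)) : ∃ C, IsMul p (fun ξ => F (x ξ)) C := by
  obtain ⟨hm, C, k, hC, H⟩ := hx
  set G : 𝓢(ℝ, ℂ) := 𝓕 F with hG
  have hinv : ∀ t : ℝ, F t = ∫ v : ℝ, G v * Complex.exp (Complex.I * ((2 * π * v) * t : ℝ)) := by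
    intro t
    have h := congrFun (F.continuous.fourierInv_fourier_eq F.integrable
      (by rw [← SchwartzMap.fourier_coe]; exact (𝓕 F).integrable)) t
    rw [← h, Real.fourierInv_eq', ← SchwartzMap.fourier_coe]
    congr 1 with v
    simp only [smul_eq_mul, RCLike.inner_apply, conj_trivial]
    rw [mul_comm, ← hG]
    congr 2
    push_cast
    ring
  simp only [hinv]
  have hqm : Measurable (Function.uncurry fun (v : ℝ) (ξ : Fin d → ℝ) =>
      G v * Complex.exp (Complex.I * ((2 * π * v) * x ξ : ℝ))) := by
    rw [Function.uncurry_def]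
    have := G.continuous.measurable
    fun_prop
  refine ⟨_, IsMul.integral (q := fun v ξ => G v * Complex.exp (Complex.I * ((2 * π * v) * x ξ : ℝ)))
    (B := fun v => ‖G v‖) (C := fun v => ‖G v‖ * (C * (1 + |2 * π * v|) ^ k)) hp hqm
    (fun v ξ => ?_) G.integrable.norm (fun v => (isMul_const (G v)).mul (H (2 * π * v))) ?_⟩
  · rw [mul_comm Complex.I, norm_mul, Complex.norm_exp_ofReal_mul_I, mul_one]
  · have hb : Integrable fun v => C * (2 ^ (k - 1) *
        (‖G v‖ + (2 * π) ^ k * (‖v‖ ^ k * ‖G v‖))) :=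
      ((G.integrable.norm.add ((G.integrable_pow_mul volume k).const_mul _)).const_mul _).const_mul C
    refine hb.mono' ?_ (Filter.Eventually.of_forall fun v => ?_)
    · have := G.continuous
      exact Continuous.aestronglyMeasurable (by fun_prop)
    · rw [Real.norm_eq_abs, abs_of_nonneg (by positivity)]
      have h := add_pow_le zero_le_one (abs_nonneg (2 * π * v)) k
      rw [one_pow, abs_mul, mul_pow, abs_of_pos Real.two_pi_pos] at h
      calc ‖G v‖ * (C * (1 + |2 * π * v|) ^ k) = C * ((1 + |2 * π * v|) ^ k * ‖G v‖) := by ring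
        _ ≤ C * (2 ^ (k - 1) * (1 + (2 * π) ^ k * |v| ^ k) * ‖G v‖) := by
          rw [abs_mul, abs_of_pos Real.two_pi_pos]
          gcongr
        _ = _ := by rw [Real.norm_eq_abs]; ring

/-- A bounded exponent generating a polynomially bounded group exponentiates to a multiplier. -/
lemma PolyGroup.exists_isMul_exp {x : (Fin d → ℝ) → ℝ} (hp : 1 ≤ p) (hx : PolyGroup p x)
    {M : ℝ} (hM : ∀ᵐ ξ ∂volume.restrict (Td d), |x ξ| ≤ M) (c : ℝ) :
    ∃ m C, IsMul p m C ∧ m =ᵐ[volume.restrict (Td d)] fun ξ => (Real.exp (c * x ξ) : ℂ) := by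
  let b : ContDiffBump (0 : ℝ) := ⟨|M| + 1, |M| + 2, by positivity, by linarith⟩
  have hs : HasCompactSupport fun t : ℝ => (b t : ℂ) * (Real.exp (c * t) : ℂ) :=
    (b.hasCompactSupport.comp_left (g := fun t : ℝ => (t : ℂ)) Complex.ofReal_zero).mul_right
  have hd : ContDiff ℝ (↑(⊤ : ℕ∞)) fun t : ℝ => (b t : ℂ) * (Real.exp (c * t) : ℂ) := by
    have h1 : ContDiff ℝ (↑(⊤ : ℕ∞)) fun t : ℝ => (b t : ℂ) :=
      Complex.ofRealCLM.contDiff.comp b.contDiff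
    have h2 : ContDiff ℝ (↑(⊤ : ℕ∞)) fun t : ℝ => (Real.exp (c * t) : ℂ) :=
      Complex.ofRealCLM.contDiff.comp (Real.contDiff_exp.comp (contDiff_const.mul contDiff_id))
    exact h1.mul h2
  obtain ⟨C, hC⟩ := hx.exists_isMul_schwartz hp (hs.toSchwartzMap hd)
  refine ⟨_, C, hC, ?_⟩
  filter_upwards [hM] with ξ hξ
  have h1 : b (x ξ) = 1 := by
    refine b.one_of_mem_closedBall ?_
    rw [mem_closedBall_zero_iff, Real.norm_eq_abs]
    exact hξ.trans ((le_abs_self M).trans (by simp [b]))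
  change ((b (x ξ) : ℂ)) * _ = _
  rw [h1, Complex.ofReal_one, one_mul]

lemma integral_chi_Icc (n : ℤ) :
    ∫ t in Set.Icc (-(1 : ℝ) / 2) (1 / 2), chi n t = if n = 0 then 1 else 0 := by
  rw [integral_Icc_eq_integral_Ioc, ← intervalIntegral.integral_of_le (by norm_num)]
  split_ifs with h
  · simp only [h, chi_zero, intervalIntegral.integral_const]
    norm_num
  · rw [integral_chi_of_ne_zero n h, div_eq_zero_iff, sub_eq_zero]
    left
    rw [chi, chi, Complex.exp_eq_exp_iff_exists_int]
    refine ⟨n, ?_⟩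
    push_cast
    ring

lemma chiT_eq_prod (n : Fin d → ℤ) (ξ : Fin d → ℝ) : chiT n ξ = ∏ j, chi (n j) (ξ j) := by
  simp only [chiT, chi, Finset.mul_sum, Complex.exp_sum]

lemma integral_chiT (n : Fin d → ℤ) : ∫ ξ in Td d, chiT n ξ = if n = 0 then 1 else 0 := by
  simp only [chiT_eq_prod]
  rw [Td, volume_pi, Measure.restrict_pi_pi,
    integral_fintype_prod_eq_prod (𝕜 := ℂ) (fun j t => chi (n j) t)]
  simp only [integral_chi_Icc]
  split_ifs with h
  · simp [h]
  · obtain ⟨j, hj⟩ := Function.ne_iff.1 h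
    exact Finset.prod_eq_zero (Finset.mem_univ j) (if_neg hj)

lemma Ftd_eq_tsum (f : (Fin d → ℤ) → ℂ) (ξ : Fin d → ℝ) : Ftd d f ξ = ∑' n, f n * chiT n ξ := rfl

lemma norm_mul_chiT (f : (Fin d → ℤ) → ℂ) (n : Fin d → ℤ) (ξ : Fin d → ℝ) :
    ‖f n * chiT n ξ‖ = ‖f n‖ := by rw [norm_mul, norm_chiT, mul_one]

lemma bddMeas_Ftd {f : (Fin d → ℤ) → ℂ} (hf : Summable fun n => ‖f n‖) : BddMeas (Ftd d f) := by
  refine ⟨?_, ∑' n, ‖f n‖, fun ξ => ?_⟩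
  · exact (continuous_tsum (fun n => continuous_const.mul (continuous_chiT n)) hf
      fun n ξ => (norm_mul_chiT f n ξ).le).measurable
  · exact tsum_of_norm_bounded hf.hasSum fun n => (norm_mul_chiT f n ξ).le

lemma coeffT_Ftd {f : (Fin d → ℤ) → ℂ} (hf : Summable fun n => ‖f n‖) : coeffT (Ftd d f) = f := by
  ext n
  have hn : ∀ k ξ, ‖f k * (chiT k ξ * chiT (-n) ξ)‖ = ‖f k‖ := fun k ξ => by
    rw [norm_mul, norm_mul, norm_chiT, norm_chiT, mul_one, mul_one]
  have hc : ∀ k, Continuous fun ξ => f k * (chiT k ξ * chiT (-n) ξ) := fun k =>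
    continuous_const.mul ((continuous_chiT k).mul (continuous_chiT _))
  have h1 : ∀ ξ, Ftd d f ξ * chiT (-n) ξ = ∑' k, f k * (chiT k ξ * chiT (-n) ξ) := fun ξ => by
    rw [Ftd_eq_tsum, ← tsum_mul_right]
    simp only [mul_assoc]
  simp only [coeffT, h1]
  rw [← integral_tsum_of_summable_integral_norm]
  · simp only [integral_const_mul, ← chiT_add, integral_chiT]
    rw [tsum_eq_single n fun k hk => by rw [if_neg (by rwa [← sub_eq_add_neg, sub_eq_zero]), mul_zero]]
    simp
  · exact fun k => (integrable_const ‖f k‖).mono' (hc k).aestronglyMeasurable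
      (Filter.Eventually.of_forall fun ξ => (hn k ξ).le)
  · simpa only [hn, integral_const, probReal_univ, one_smul] using hf

lemma TmultZ_eq_coeffT (μ : (Fin d → ℝ) → ℝ) (f : (Fin d → ℤ) → ℂ) :
    TmultZ d μ f = coeffT fun ξ => (μ ξ : ℂ) * Ftd d f ξ := by
  ext n
  simp only [TmultZ, coeffT, chiT]
  congr 1 with ξ
  simp

lemma lpN_rpow (hp : 0 < p) (f : (Fin d → ℤ) → ℂ) :
    lpN d p f ^ p = ∑' n, ENNReal.ofReal (‖f n‖ ^ p) := by
  rw [lpN, ← ENNReal.rpow_mul, one_div_mul_cancel hp.ne', ENNReal.rpow_one]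
  congr 1 with n
  rw [← ENNReal.ofReal_rpow_of_nonneg (norm_nonneg _) hp.le, ofReal_norm, enorm_eq_nnnorm]

lemma lpN_le_iff (hp : 0 < p) (f : (Fin d → ℤ) → ℂ) {M : ℝ} (hM : 0 ≤ M) :
    lpN d p f ≤ ENNReal.ofReal M ↔ ∀ R : Finset (Fin d → ℤ), ∑ n ∈ R, ‖f n‖ ^ p ≤ M ^ p := by
  rw [← ENNReal.rpow_le_rpow_iff hp, lpN_rpow hp, ENNReal.ofReal_rpow_of_nonneg hM hp.le,
    ENNReal.tsum_eq_iSup_sum, iSup_le_iff]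
  refine forall_congr' fun R => ?_
  rw [← ENNReal.ofReal_sum_of_nonneg fun _ _ => by positivity,
    ENNReal.ofReal_le_ofReal_iff (by positivity)]

lemma IsMul.lpN_TmultZ_le {m : (Fin d → ℝ) → ℂ} {μ : (Fin d → ℝ) → ℝ} {C C' : ℝ} (hp : 0 < p)
    (hm : IsMul p m C) (hC : C ≤ C') (hC' : 0 < C')
    (he : m =ᵐ[volume.restrict (Td d)] fun ξ => (μ ξ : ℂ))
    {f : (Fin d → ℤ) → ℂ} (hf : Summable fun n => ‖f n‖) :
    lpN d p (TmultZ d μ f) ≤ ENNReal.ofReal C' * lpN d p f := by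
  by_cases htop : lpN d p f = ⊤
  · rw [htop, ENNReal.mul_top (ENNReal.ofReal_pos.2 hC').ne']
    exact le_top
  have hM : 0 ≤ (lpN d p f).toReal := ENNReal.toReal_nonneg
  rw [← ENNReal.ofReal_toReal htop, ← ENNReal.ofReal_mul hC'.le,
    lpN_le_iff hp _ (mul_nonneg hC'.le hM), TmultZ_eq_coeffT,
    ← coeffT_congr (φ := fun ξ => m ξ * Ftd d f ξ)]
  · refine (hm.mono hp hC).bound _ (bddMeas_Ftd hf) _ hM ?_
    rw [CoeffBound, coeffT_Ftd hf]
    exact (lpN_le_iff hp f hM).1 (ENNReal.ofReal_toReal htop).ge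
  · filter_upwards [he] with ξ hξ
    rw [hξ]

end

section

lemma abs_log_rpow_sum_div_sum_rpow_le {ι : Type*} [Fintype ι] [Nonempty ι] {a : ι → ℝ} {s : ℝ}
    (ha : ∀ i, 0 < a i) (hs : 0 ≤ s) :
    |s * Real.log (∑ i, a i) - Real.log (∑ i, a i ^ s)| ≤
      (s + 1) * Real.log (Fintype.card ι) := by
  obtain ⟨k, -, hk⟩ := Finset.exists_max_image Finset.univ a Finset.univ_nonempty
  have hk : ∀ i, a i ≤ a k := fun i => hk i (Finset.mem_univ i)
  have hn : 0 < (Fintype.card ι : ℝ) := by exact_mod_cast Fintype.card_pos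
  have hn0 : 0 ≤ Real.log (Fintype.card ι) :=
    Real.log_nonneg (by exact_mod_cast Fintype.card_pos)
  have h1 : Real.log (a k) ≤ Real.log (∑ i, a i) := Real.log_le_log (ha k)
    (Finset.single_le_sum (f := a) (fun i _ => (ha i).le) (Finset.mem_univ k))
  have h2 : Real.log (∑ i, a i) ≤ Real.log (Fintype.card ι) + Real.log (a k) := by
    rw [← Real.log_mul hn.ne' (ha k).ne']
    refine Real.log_le_log (Finset.sum_pos (fun i _ => ha i) Finset.univ_nonempty) ?_
    simpa using Finset.sum_le_card_nsmul Finset.univ a (a k) fun i _ => hk i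
  have hp : ∀ i, 0 < a i ^ s := fun i => Real.rpow_pos_of_pos (ha i) s
  have h3 : s * Real.log (a k) ≤ Real.log (∑ i, a i ^ s) := by
    rw [← Real.log_rpow (ha k)]
    exact Real.log_le_log (hp k)
      (Finset.single_le_sum (f := fun i => a i ^ s) (fun i _ => (hp i).le) (Finset.mem_univ k))
  have h4 : Real.log (∑ i, a i ^ s) ≤ Real.log (Fintype.card ι) + s * Real.log (a k) := by
    rw [← Real.log_rpow (ha k), ← Real.log_mul hn.ne' (hp k).ne']
    refine Real.log_le_log (Finset.sum_pos (fun i _ => hp i) Finset.univ_nonempty) ?_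
    simpa using Finset.sum_le_card_nsmul Finset.univ (fun i => a i ^ s) (a k ^ s)
      fun i _ => Real.rpow_le_rpow (ha i).le (hk i) hs
  have h5 := mul_le_mul_of_nonneg_left h1 hs
  have h6 := mul_le_mul_of_nonneg_left h2 hs
  have h7 := mul_nonneg hs hn0
  rw [abs_le]
  constructor <;> nlinarith

variable {d : ℕ} {p : ℝ}

/-- The logarithm of the multiplier `μ`. -/
noncomputable def logSymbol (s : ℝ) (ξ : Fin d → ℝ) : ℝ :=
  s * Real.log (∑ j, lapSymbol j ξ) - Real.log (∑ j, lapSymbol j ξ ^ s)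

lemma polyGroup_logSymbol [Nonempty (Fin d)] (hp : 1 < p) (s : ℝ) :
    PolyGroup p (logSymbol (d := d) s) := by
  have hp0 : 0 < p := by linarith
  have h1 := PolyGroup.log_sum (s := Finset.univ) Finset.univ_nonempty hp
    (measurable_lapSymbol (d := d)) ae_lapSymbol_pos (polyGroup_log_lapSymbol hp)
  have hm : ∀ j : Fin d, Measurable fun ξ => lapSymbol j ξ ^ s := fun j =>
    (measurable_lapSymbol j).pow_const s
  have h2 := PolyGroup.log_sum (s := Finset.univ) (a := fun (j : Fin d) ξ => lapSymbol j ξ ^ s)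
    Finset.univ_nonempty hp hm
    (fun j => by filter_upwards [ae_lapSymbol_pos j] with ξ h using Real.rpow_pos_of_pos h s)
    (fun j => ((polyGroup_log_lapSymbol hp j).const_mul hp0 s).congr
      (Real.measurable_log.comp (hm j)) (by
        filter_upwards [ae_lapSymbol_pos j] with ξ h using (Real.log_rpow h s).symm))
  exact (h1.const_mul hp0 s).sub hp0 h2

lemma muS_eq_exp_logSymbol [Nonempty (Fin d)] (s : ℝ) {ξ : Fin d → ℝ}
    (h : ∀ j, 0 < lapSymbol j ξ) : muS d s ξ = Real.exp (logSymbol s ξ) := by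
  have h0 : ξ ≠ 0 := by
    rintro rfl
    simpa [lapSymbol] using h (Classical.arbitrary _)
  have h1 : 0 < ∑ j, lapSymbol j ξ := Finset.sum_pos (fun j _ => h j) Finset.univ_nonempty
  have h2 : 0 < ∑ j, lapSymbol j ξ ^ s :=
    Finset.sum_pos (fun j _ => Real.rpow_pos_of_pos (h j) s) Finset.univ_nonempty
  rw [muS, if_neg h0, logSymbol, Real.exp_sub, Real.exp_log h2, mul_comm s, ← Real.rpow_def_of_pos h1,
    Finset.mul_sum]
  rfl

end

/-- **`ℓ^p(ℤ^d)` boundedness of the multipliers `μ` and `μ⁻¹`** comparing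
`(-Δ_{ℤ^d})^s` with `∑_j L_j^s`: for `s > 0` and `1 < p < ∞` there is `C = C(d,s,p)`
such that both multiplier operators have `ℓ^p` norm at most `C`. -/
theorem stmt8 (d : ℕ) (hd : 1 ≤ d) (s : ℝ) (hs : 0 < s) (p : ℝ) (hp : 1 < p) :
    ∃ C : ℝ, 0 < C ∧
      ∀ f : (Fin d → ℤ) → ℂ, Summable (fun n => ‖f n‖) →
        lpN d p (TmultZ d (muS d s) f) ≤ ENNReal.ofReal C * lpN d p f ∧
        lpN d p (TmultZ d (fun ξ => (muS d s ξ)⁻¹) f) ≤ ENNReal.ofReal C * lpN d p f := by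
  have : Nonempty (Fin d) := Fin.pos_iff_nonempty.1 hd
  have hpos : ∀ᵐ ξ ∂volume.restrict (Td d), ∀ j : Fin d, 0 < lapSymbol j ξ :=
    ae_all_iff.2 ae_lapSymbol_pos
  have hb : ∀ᵐ ξ ∂volume.restrict (Td d), |logSymbol s ξ| ≤
      (s + 1) * Real.log (Fintype.card (Fin d)) := by
    filter_upwards [hpos] with ξ h using abs_log_rpow_sum_div_sum_rpow_le h hs.le
  obtain ⟨m₁, C₁, h1, he1⟩ := (polyGroup_logSymbol hp s).exists_isMul_exp hp.le hb 1
  obtain ⟨m₂, C₂, h2, he2⟩ := (polyGroup_logSymbol hp s).exists_isMul_exp hp.le hb (-1)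
  have hC1 := h1.nonneg
  have hC2 := h2.nonneg
  refine ⟨C₁ + C₂ + 1, by positivity, fun f hf => ⟨?_, ?_⟩⟩
  · refine h1.lpN_TmultZ_le (by linarith) (by linarith) (by positivity) ?_ hf
    filter_upwards [he1, hpos] with ξ he h
    rw [he, muS_eq_exp_logSymbol s h, one_mul]
  · refine h2.lpN_TmultZ_le (by linarith) (by linarith) (by positivity) ?_ hf
    filter_upwards [he2, hpos] with ξ he h
    rw [he, muS_eq_exp_logSymbol s h, neg_one_mul, Real.exp_neg]
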